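/- Let $(Y,\mu)$ be a probability space, $F:Y\to Y$ a measure-preserving map and $\varphi:Y\to\{1,2,3,\dots\}$ a measurable function. Let $R:L^1(Y,\mu)\to L^1(Y,\mu)$ be the transfer operator of $F$, characterized by $\int_Y (Rv)\,w\,d\mu=\int_Y v\,(w\circ F)\,d\mu$ for all $v\in L^1(Y,\mu)$, $w\in L^\infty(Y,\mu)$, and put $R_nv=R(1_{\{\varphi=n\}}v)$ for $n\ge1$. Let $\mathcal B\subset L^\infty(Y,\mu)$ be a linear subspace which contains the constant functions and is a complex Banach space for a norm $\|\cdot\|$ with $|v|_\infty\le\|v\|$ for all $v\in\mathcal B$. Assume: (H1) each $R_n$, $n\ge1$, maps $\mathcal B$ boundedly into $\mathcal B$, and there is $C>0$ with $\|R_n\|_{\mathcal B}\le C\mu(\varphi=n)$ for all $n\ge1$; hence $R(z)=\sum_{n\ge1}z^nR_n$ is a bounded operator on $\mathcal B$ for every $z\in\mathbb C$ with $|z|\le1$; (H2)(i) $1$ is a simple isolated eigenvalue of $R(1)=R$ on $\mathcal B$, that is, $1$ is an eigenvalue and an isolated point of the spectrum and has algebraic multiplicity one: the spectral projection $\frac{1}{2\pi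 i}\oint_{|z-1|=r}(zI-R(1))^{-1}\,dz$ (where $r>0$ is so small that $1$ is the only point of the spectrum in $\{|z-1|\le r\}$) has rank one; (H2)(ii) for every $z\in\mathbb C$ with $|z|\le1$ and $z\ne1$, the number $1$ does not belong to the spectrum of $R(z)$ on $\mathcal B$. Define $T_0=I$ and $T_n=\sum_{j=1}^nT_{n-j}R_j$ for $n\ge1$, and $Pv=\bigl(\int_Yv\,d\mu\bigr)\cdot 1$ for $v\in\mathcal B$. Suppose that $\mu(\varphi>n)=c\,(n^{-1}+H(n))$ for all $n\ge1$, where $c>0$ and $H(n)=O(n^{-q})$ for some $q>1$. Let $H_1(x)=1/c$ for $x\in[0,1)$ and $H_1(x)=\lfloor x\rfloor^{-1}-x^{-1}+H(\lfloor x\rfloor)$ for $x\ge1$. Then $H_1$ is integrable on $(0,\infty)$, and with $c_H=\int_0^\infty H_1(x)\,dx$ one has, in the operator norm on $\mathcal B$, $$(\log n)\,T_n=c^{-1}\bigl\{1-c_H(\log n)^{-1}+O((\log n)^{-2})\bigr\}P+O\bigl((\log n)^{1/2}n^{-1/2}\bigr).$$ Precisely, there are real numbers $e_n$ and a constant $K$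 such that for all $n\ge2$: $|e_n|\le K(\log n)^{-2}$ and $\bigl\|(\log n)T_n-c^{-1}(1-c_H(\log n)^{-1}+e_n)P\bigr\|\le K(\log n)^{1/2}n^{-1/2}$. In particular, $\|(\log n)T_n-c^{-1}(1-c_H(\log n)^{-1})P\|=O((\log n)^{-2})+O((\log n)^{1/2}n^{-1/2})$. -/

import Mathlib

open MeasureTheory
open scoped ENNReal

noncomputable section

namespace OperatorRenewal

section Space

variable {Y : Type*} [MeasurableSpace Y]

/-- `R : L¹(Y, μ) → L¹(Y, μ)` is the transfer operator of `F`. -/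
def IsTransferOperator (μ : Measure Y) (F : Y → Y) (R : Lp ℂ 1 μ →L[ℂ] Lp ℂ 1 μ) : Prop :=
  ∀ (v : Lp ℂ 1 μ) (w : Y → ℂ), MemLp w ∞ μ →
    ∫ y, R v y * w y ∂μ = ∫ y, v y * w (F y) ∂μ

/-- A realization of the normed space `B` as a space of (classes of) essentially bounded functions:
an inclusion of `B` into `L^∞(Y, μ)` with `|v|_∞ ≤ ‖v‖`, whose image contains the constants. -/
structure BoundedFunctionSpace (μ : Measure Y) [IsFiniteMeasure μ]
    (B : Type*) [NormedAddCommGroup B] [NormedSpace ℂ B] where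
  incl : B →ₗ[ℂ] Lp ℂ ∞ μ
  incl_injective : Function.Injective incl
  norm_incl_le : ∀ v : B, ‖incl v‖ ≤ ‖v‖
  one : B
  incl_one : incl one = Lp.const ∞ μ (1 : ℂ)

/-- The element `1_s v` of `L¹`, for `v` in `L^∞`. -/
def indicatorL1 {μ : Measure Y} [IsFiniteMeasure μ] {s : Set Y} (hs : MeasurableSet s)
    (v : Lp ℂ ∞ μ) : Lp ℂ 1 μ :=
  (((Lp.memLp v).indicator hs).mono_exponent le_top).toLp (s.indicator v)

theorem norm_integral_le_norm_Linf {μ : Measure Y} [IsProbabilityMeasure μ] (v : Lp ℂ ∞ μ) :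
    ‖∫ y, v y ∂μ‖ ≤ ‖v‖ := by
  have h : ∀ᵐ y ∂μ, ‖v y‖ ≤ ‖v‖ := by
    have h1 := ae_le_eLpNormEssSup (f := v) (μ := μ)
    filter_upwards [h1] with y hy
    rw [Lp.norm_def, eLpNorm_exponent_top]
    have h2 := ENNReal.toReal_mono (by
      rw [← eLpNorm_exponent_top]; exact Lp.eLpNorm_ne_top v) hy
    simpa using h2
  simpa using norm_integral_le_of_norm_le_const h

/-- The operator `P v = (∫ v dμ) · 1` on `B`. -/
def meanProjection {μ : Measure Y} [IsProbabilityMeasure μ]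
    {B : Type*} [NormedAddCommGroup B] [NormedSpace ℂ B] (S : BoundedFunctionSpace μ B) :
    B →L[ℂ] B :=
  LinearMap.mkContinuous
    { toFun := fun v => (∫ y, S.incl v y ∂μ) • S.one
      map_add' := fun v w => by
        rw [map_add, integral_congr_ae (Lp.coeFn_add _ _), ← add_smul]
        congr 1
        exact integral_add ((Lp.memLp (S.incl v)).integrable le_top)
          ((Lp.memLp (S.incl w)).integrable le_top)
      map_smul' := fun a v => by
        rw [map_smul, integral_congr_ae (Lp.coeFn_smul _ _), RingHom.id_apply, smul_smul]
        congr 1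
        exact integral_const_mul a _ }
    ‖S.one‖
    (fun v => by
      change ‖(∫ y, S.incl v y ∂μ) • S.one‖ ≤ _
      rw [norm_smul, mul_comm]
      exact mul_le_mul_of_nonneg_left
        ((norm_integral_le_norm_Linf _).trans (S.norm_incl_le v)) (norm_nonneg _))

end Space

section Operators

variable {B : Type*} [NormedAddCommGroup B] [NormedSpace ℂ B]

/-- The spectral projection `(2πi)⁻¹ ∮ (z - A)⁻¹ dz` over the circle of centre `a`, radius `r`. -/
def spectralProjection (A : B →L[ℂ] B) (a : ℂ) (r : ℝ) : B →L[ℂ] B :=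
  (2 * (Real.pi : ℂ) * Complex.I)⁻¹ • ∮ z in C(a, r), resolvent A z

/-- `a` is an eigenvalue of `A` and an isolated point of the spectrum, and it is simple: it has
algebraic multiplicity one, that is, the spectral projection at `a` has rank one. -/
def IsSimpleIsolatedEigenvalue (A : B →L[ℂ] B) (a : ℂ) : Prop :=
  Module.End.HasEigenvalue (A : B →ₗ[ℂ] B) a ∧
  ∃ r : ℝ, 0 < r ∧ spectrum ℂ A ∩ Metric.closedBall a r = {a} ∧
    Module.finrank ℂ (LinearMap.range (spectralProjection A a r : B →ₗ[ℂ] B)) = 1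

/-- `R(z) = ∑_{n ≥ 1} zⁿ Rₙ`. -/
def returnSeries (R : ℕ → B →L[ℂ] B) (z : ℂ) : B →L[ℂ] B :=
  ∑' n : ℕ, z ^ (n + 1) • R (n + 1)

/-- The renewal operators: `T₀ = I` and `Tₙ = ∑_{j=1}^{n} T_{n-j} R_j` for `n ≥ 1`. -/
def renewal (R : ℕ → B →L[ℂ] B) : ℕ → B →L[ℂ] B
  | 0 => ContinuousLinearMap.id ℂ B
  | n + 1 => ∑ i : Fin (n + 1), (renewal R (n - i)).comp (R (i + 1))

theorem renewal_eq_sum (R : ℕ → B →L[ℂ] B) (n : ℕ) (hn : 1 ≤ n) :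
    renewal R n = ∑ j ∈ Finset.Icc 1 n, (renewal R (n - j)).comp (R j) := by
  obtain ⟨m, rfl⟩ : ∃ m, n = m + 1 := ⟨n - 1, by omega⟩
  rw [renewal, Fin.sum_univ_eq_sum_range (fun i => (renewal R (m - i)).comp (R (i + 1))) (m + 1),
    ← Finset.Ico_add_one_right_eq_Icc, Finset.sum_Ico_eq_sum_range]
  refine Finset.sum_congr (by simp) fun i _ => ?_
  rw [show m + 1 - (1 + i) = m - i by omega, add_comm 1 i]

end Operators

/-- `H₁(x) = 1/c` for `x < 1` and `H₁(x) = ⌊x⌋⁻¹ - x⁻¹ + H(⌊x⌋)` for `x ≥ 1`. -/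
def tailCorrection (c : ℝ) (H : ℕ → ℝ) (x : ℝ) : ℝ :=
  if x < 1 then 1 / c else (⌊x⌋₊ : ℝ)⁻¹ - x⁻¹ + H ⌊x⌋₊

/-- `c_H = ∫_0^∞ H₁(x) dx`. -/
def tailConstant (c : ℝ) (H : ℕ → ℝ) : ℝ :=
  ∫ x in Set.Ioi (0 : ℝ), tailCorrection c H x

end OperatorRenewal

end

noncomputable section

namespace OperatorRenewal

section CoefficientBound

variable {E : Type*} [NormedAddCommGroup E] [NormedSpace ℂ E]

/-- The point `r e^{iθ}`. -/
def polarPoint (r θ : ℝ) : ℂ := r * Complex.exp (θ * Complex.I)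

theorem norm_polarPoint {r : ℝ} (hr : 0 ≤ r) (θ : ℝ) : ‖polarPoint r θ‖ = r := by
  rw [polarPoint, norm_mul, Complex.norm_exp_ofReal_mul_I, mul_one, Complex.norm_real,
    Real.norm_of_nonneg hr]

theorem continuous_polarPoint (r : ℝ) : Continuous (polarPoint r) := by
  unfold polarPoint; fun_prop

theorem polarPoint_periodic (r : ℝ) : Function.Periodic (polarPoint r) (2 * Real.pi) := by
  intro θ
  simp only [polarPoint]
  push_cast
  rw [add_mul, Complex.exp_add, Complex.exp_two_pi_mul_I, mul_one]

theorem norm_polarPoint_sub_le {r : ℝ} (hr : 0 ≤ r) (hr1 : r ≤ 1) (θ h : ℝ) :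
    ‖polarPoint r (θ + h) - polarPoint r θ‖ ≤ |h| := by
  have : polarPoint r (θ + h) - polarPoint r θ
      = (r * Complex.exp (θ * Complex.I)) * (Complex.exp (Complex.I * h) - 1) := by
    simp only [polarPoint]
    push_cast
    rw [add_mul, Complex.exp_add, mul_comm (h : ℂ)]
    ring
  rw [this, norm_mul, norm_mul, Complex.norm_exp_ofReal_mul_I, mul_one, Complex.norm_real,
    Real.norm_of_nonneg hr]
  have h1 := Real.norm_exp_I_mul_ofReal_sub_one_le (x := h)
  rw [Real.norm_eq_abs] at h1
  calc r * _ ≤ 1 * ‖Complex.exp (Complex.I * h) - 1‖ := by gcongr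
    _ ≤ |h| := by rw [one_mul]; exact h1

theorem abs_le_norm_one_sub_polarPoint {r θ : ℝ} (hr : 1 / 2 ≤ r)
    (hθ : |θ| ≤ Real.pi) : |θ| / 4 ≤ ‖1 - polarPoint r θ‖ := by
  have h0 : ‖1 - polarPoint r θ‖ ^ 2 = (1 - r) ^ 2 + 2 * r * (1 - Real.cos θ) := by
    rw [← Complex.normSq_eq_norm_sq, Complex.normSq_apply, polarPoint]
    simp only [Complex.sub_re, Complex.one_re, Complex.mul_re, Complex.ofReal_re,
      Complex.exp_ofReal_mul_I_re, Complex.ofReal_im, Complex.exp_ofReal_mul_I_im, zero_mul,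
      sub_zero, Complex.sub_im, Complex.one_im, Complex.mul_im, add_zero]
    nlinarith [Real.sin_sq_add_cos_sq θ]
  have h1 : Real.cos θ ≤ 1 - 2 / Real.pi ^ 2 * θ ^ 2 := Real.cos_le_one_sub_mul_cos_sq hθ
  have hpi : (1 : ℝ) / 16 ≤ 2 / Real.pi ^ 2 := by
    rw [div_le_div_iff₀ (by norm_num) (by positivity)]
    nlinarith [Real.pi_lt_four, Real.pi_pos]
  have h2 : (|θ| / 4) ^ 2 ≤ ‖1 - polarPoint r θ‖ ^ 2 := by
    rw [h0, div_pow, sq_abs]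
    have h3 : (1 / 16) * θ ^ 2 ≤ 1 - Real.cos θ := by
      have := mul_le_mul_of_nonneg_right hpi (sq_nonneg θ)
      linarith
    nlinarith [sq_nonneg (1 - r), sq_nonneg θ]
  exact le_of_sq_le_sq h2 (norm_nonneg _)

theorem integral_exp_int_mul_I (k : ℤ) :
    ∫ θ in (-Real.pi)..Real.pi, Complex.exp (k * (θ * Complex.I)) = if k = 0 then 2 * (Real.pi : ℂ) else 0 := by
  split_ifs with hk
  · subst hk
    simp
    ring
  · have hk' : (k : ℂ) * Complex.I ≠ 0 := mul_ne_zero (by exact_mod_cast hk) Complex.I_ne_zero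
    have := integral_exp_mul_complex (a := -Real.pi) (b := Real.pi) hk'
    simp only [← mul_assoc] 
    simp only [mul_right_comm _ _ Complex.I]
    rw [this, div_eq_zero_iff]
    left
    rw [sub_eq_zero, Complex.exp_eq_exp_iff_exists_int]
    refine ⟨k, ?_⟩
    push_cast
    ring

theorem integral_exp_mul_powerSeries [CompleteSpace E] {a : ℕ → E} {f : ℂ → E}
    (hf : ∀ z : ℂ, ‖z‖ < 1 → HasSum (fun n => z ^ n • a n) (f z))
    (ha : ∀ r : ℝ, 0 ≤ r → r < 1 → Summable fun n => ‖a n‖ * r ^ n)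
    {r : ℝ} (hr : 0 ≤ r) (hr1 : r < 1) (n : ℕ) :
    ∫ θ in (-Real.pi)..Real.pi, Complex.exp (-(n * (θ * Complex.I))) • f (polarPoint r θ)
      = (2 * (Real.pi : ℂ) * r ^ n) • a n := by
  have key : HasSum (fun k : ℕ => ∫ θ in (-Real.pi)..Real.pi,
      Complex.exp (-(n * (θ * Complex.I))) • (polarPoint r θ ^ k • a k))
      (∫ θ in (-Real.pi)..Real.pi, Complex.exp (-(n * (θ * Complex.I))) • f (polarPoint r θ)) := by
    refine intervalIntegral.hasSum_integral_of_dominated_convergence (fun k _ => ‖a k‖ * r ^ k)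
      (fun k => ?_) (fun k => ?_) ?_ ?_ ?_
    · refine Continuous.aestronglyMeasurable ?_
      have := continuous_polarPoint r
      fun_prop
    · refine Filter.Eventually.of_forall fun θ _ => ?_
      rw [norm_smul, norm_smul, norm_pow, norm_polarPoint hr, ← mul_assoc (n : ℂ),
        ← neg_mul, show -((n : ℂ) * (θ : ℂ)) = ((-(n * θ) : ℝ) : ℂ) by push_cast; ring,
        Complex.norm_exp_ofReal_mul_I, one_mul, mul_comm]
    · exact Filter.Eventually.of_forall fun θ _ => ha r hr hr1
    · exact intervalIntegrable_const
    · refine Filter.Eventually.of_forall fun θ _ => ?_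
      exact (hf _ (by rwa [norm_polarPoint hr])).const_smul _
  have hterm : ∀ k : ℕ, ∫ θ in (-Real.pi)..Real.pi,
      Complex.exp (-(n * (θ * Complex.I))) • (polarPoint r θ ^ k • a k)
      = if k = n then (2 * (Real.pi : ℂ) * r ^ n) • a n else 0 := by
    intro k
    have : ∀ θ : ℝ, Complex.exp (-(n * (θ * Complex.I))) • (polarPoint r θ ^ k • a k)
        = Complex.exp (((k - n : ℤ) : ℂ) * (θ * Complex.I)) • ((r : ℂ) ^ k • a k) := by
      intro θ
      rw [polarPoint, mul_pow, ← Complex.exp_nat_mul, smul_smul, smul_smul]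
      congr 1
      push_cast
      rw [sub_mul, sub_eq_add_neg, Complex.exp_add]
      ring
    simp only [this]
    rw [intervalIntegral.integral_smul_const, integral_exp_int_mul_I]
    by_cases h : k = n
    · subst h
      simp [smul_smul]
    · have : (k : ℤ) - n ≠ 0 := by omega
      simp [h, this]
  simp only [hterm] at key
  exact key.unique (hasSum_ite_eq n _)

theorem continuous_comp_polarPoint [CompleteSpace E] {a : ℕ → E} {f : ℂ → E}
    (hf : ∀ z : ℂ, ‖z‖ < 1 → HasSum (fun n => z ^ n • a n) (f z))
    (ha : ∀ r : ℝ, 0 ≤ r → r < 1 → Summable fun n => ‖a n‖ * r ^ n)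
    {r : ℝ} (hr : 0 ≤ r) (hr1 : r < 1) : Continuous fun θ => f (polarPoint r θ) := by
  have h1 : (fun θ => f (polarPoint r θ)) = fun θ => ∑' n, polarPoint r θ ^ n • a n := by
    funext θ
    exact (hf _ (by rwa [norm_polarPoint hr])).tsum_eq.symm
  rw [h1]
  have := continuous_polarPoint r
  refine continuous_tsum (u := fun n => ‖a n‖ * r ^ n) (fun n => by fun_prop) (ha r hr hr1) ?_
  intro n θ
  rw [norm_smul, norm_pow, norm_polarPoint hr, mul_comm]

theorem norm_coeff_le_integral_norm_sub [CompleteSpace E] {a : ℕ → E} {f : ℂ → E}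
    (hf : ∀ z : ℂ, ‖z‖ < 1 → HasSum (fun n => z ^ n • a n) (f z))
    (ha : ∀ r : ℝ, 0 ≤ r → r < 1 → Summable fun n => ‖a n‖ * r ^ n)
    {r : ℝ} (hr : 0 ≤ r) (hr1 : r < 1) {n : ℕ} (hn : 1 ≤ n) :
    4 * Real.pi * (r ^ n * ‖a n‖) ≤ ∫ θ in (-Real.pi)..Real.pi,
      ‖f (polarPoint r θ) - f (polarPoint r (θ + Real.pi / n))‖ := by
  have hn0 : (n : ℂ) ≠ 0 := by exact_mod_cast (by omega : n ≠ 0)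
  have hFc := continuous_comp_polarPoint hf ha hr hr1
  have hJ := integral_exp_mul_powerSeries hf ha hr hr1 n
  set G : ℝ → E := fun θ => Complex.exp (-(n * (θ * Complex.I))) • f (polarPoint r θ) with hG
  have hGc : Continuous G := Continuous.smul (by fun_prop) hFc
  have hGper : Function.Periodic G (2 * Real.pi) := by
    intro θ
    simp only [hG]
    rw [polarPoint_periodic r θ]
    congr 1
    rw [Complex.exp_eq_exp_iff_exists_int]
    refine ⟨-n, ?_⟩
    push_cast
    ring
  have hGs : ∀ θ : ℝ, G (θ + Real.pi / n)
      = - (Complex.exp (-(n * (θ * Complex.I))) • f (polarPoint r (θ + Real.pi / n))) := by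
    intro θ
    simp only [hG]
    rw [← neg_smul]
    congr 1
    have : -((n : ℂ) * (((θ + Real.pi / n : ℝ) : ℂ) * Complex.I))
        = -(n * (θ * Complex.I)) + -(Real.pi * Complex.I) := by
      push_cast
      field_simp
      ring
    rw [this, Complex.exp_add, Complex.exp_neg (Real.pi * Complex.I), Complex.exp_pi_mul_I]
    norm_num
  have hshift : ∫ θ in (-Real.pi)..Real.pi, G (θ + Real.pi / n)
      = ∫ θ in (-Real.pi)..Real.pi, G θ := by
    rw [intervalIntegral.integral_comp_add_right]
    have := hGper.intervalIntegral_add_eq (-Real.pi + Real.pi / n) (-Real.pi)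
    rw [show -Real.pi + Real.pi / n + 2 * Real.pi = Real.pi + Real.pi / n by ring,
      show -Real.pi + 2 * Real.pi = Real.pi by ring] at this
    exact this
  have h2 : (2 : ℂ) • ((2 * (Real.pi : ℂ) * r ^ n) • a n)
      = ∫ θ in (-Real.pi)..Real.pi, Complex.exp (-(n * (θ * Complex.I))) •
          (f (polarPoint r θ) - f (polarPoint r (θ + Real.pi / n))) := by
    rw [two_smul, ← hJ]
    nth_rewrite 2 [← hshift]
    rw [← intervalIntegral.integral_add (hGc.intervalIntegrable _ _)
      ((show Continuous fun θ => G (θ + Real.pi / n) by fun_prop).intervalIntegrable _ _)]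
    refine intervalIntegral.integral_congr fun θ _ => ?_
    rw [hGs, smul_sub, ← sub_eq_add_neg]
  have h3 : 4 * Real.pi * (r ^ n * ‖a n‖) = ‖(2 : ℂ) • ((2 * (Real.pi : ℂ) * r ^ n) • a n)‖ := by
    rw [norm_smul, norm_smul, norm_mul, norm_mul, norm_pow, Complex.norm_real, Complex.norm_real,
      Real.norm_of_nonneg hr, Real.norm_of_nonneg Real.pi_pos.le]
    norm_num
    ring
  rw [h3, h2]
  refine (intervalIntegral.norm_integral_le_integral_norm (by linarith [Real.pi_pos])).trans_eq ?_
  refine intervalIntegral.integral_congr fun θ _ => ?_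
  rw [norm_smul, ← mul_assoc (n : ℂ),
        ← neg_mul, show -((n : ℂ) * (θ : ℂ)) = ((-(n * θ) : ℝ) : ℂ) by push_cast; ring,
        Complex.norm_exp_ofReal_mul_I, one_mul]

theorem integral_le_of_le_rpow_neg {G : ℝ → ℝ} {A b M : ℝ} (hA : 0 < A) (hAb : A ≤ b) (hM : 0 ≤ M)
    (hG : Continuous G) (h : ∀ θ ∈ Set.Icc A b, G θ ≤ M * θ ^ (-(3 / 2) : ℝ)) :
    ∫ θ in A..b, G θ ≤ 2 * M * A ^ (-(1 / 2) : ℝ) := by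
  have h0 : (0 : ℝ) ∉ Set.uIcc A b := by
    rw [Set.uIcc_of_le hAb]; simp [hA]
  have hi := intervalIntegral.intervalIntegrable_rpow (μ := volume) (r := (-(3 / 2) : ℝ)) (Or.inr h0)
  calc ∫ θ in A..b, G θ ≤ ∫ θ in A..b, M * θ ^ (-(3 / 2) : ℝ) :=
        intervalIntegral.integral_mono_on hAb (hG.intervalIntegrable _ _) (hi.const_mul M) h
    _ = M * ((b ^ (-(1 / 2) : ℝ) - A ^ (-(1 / 2) : ℝ)) / (-(1 / 2))) := by
        rw [intervalIntegral.integral_const_mul, integral_rpow (Or.inr ⟨by norm_num, h0⟩)]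
        norm_num
    _ ≤ 2 * M * A ^ (-(1 / 2) : ℝ) := by
        have : 0 ≤ M * b ^ (-(1 / 2) : ℝ) := mul_nonneg hM (Real.rpow_nonneg (hA.le.trans hAb) _)
        linarith

theorem integral_le_of_le_rpow {G : ℝ → ℝ} {b C ε : ℝ} (hb : 0 ≤ b) (hε : 0 < ε)
    (hG : Continuous G) (h : ∀ θ, 0 < θ → θ ≤ b → G θ ≤ C * θ ^ (ε - 1)) :
    ∫ θ in (0 : ℝ)..b, G θ ≤ C / ε * b ^ ε := by
  have hi := intervalIntegral.intervalIntegrable_rpow' (a := 0) (b := b) (r := ε - 1) (by linarith)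
  calc ∫ θ in (0 : ℝ)..b, G θ ≤ ∫ θ in (0 : ℝ)..b, C * θ ^ (ε - 1) := by
        refine intervalIntegral.integral_mono_on_of_le_Ioo hb (hG.intervalIntegrable _ _)
          (hi.const_mul C) fun θ hθ => h θ hθ.1 hθ.2.le
    _ = C / ε * b ^ ε := by
        rw [intervalIntegral.integral_const_mul, integral_rpow (Or.inl (by linarith))]
        rw [sub_add_cancel, Real.zero_rpow hε.ne']
        ring

/-- Fourier coefficient estimate: the coefficients of a power series whose sum has an integrable
singularity at `1` are controlled by the size of the sum near `1` and by its modulus of continuity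
away from `1`. -/
theorem norm_coeff_le [CompleteSpace E] {a : ℕ → E} {f : ℂ → E}
    (hf : ∀ z : ℂ, ‖z‖ < 1 → HasSum (fun n => z ^ n • a n) (f z))
    (ha : ∀ r : ℝ, 0 ≤ r → r < 1 → Summable fun n => ‖a n‖ * r ^ n)
    {ε C M A : ℝ} (hε : 0 < ε) (hε1 : ε ≤ 1) (hC : 0 ≤ C) (hM : 0 ≤ M) {n : ℕ} (hn : 1 ≤ n)
    (hA1 : A ≤ 1) (hnA : 8 * (Real.pi / n) ≤ A)
    (hb : ∀ z : ℂ, ‖z‖ < 1 → ‖f z‖ ≤ C * ‖1 - z‖ ^ (ε - 1))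
    (hd : ∀ z w : ℂ, ∀ ρ : ℝ, ‖z‖ < 1 → ‖w‖ < 1 → ‖z - w‖ ≤ Real.pi / n → A / 8 ≤ ρ → ρ ≤ 1 →
      ρ ≤ ‖1 - z‖ → ρ ≤ ‖1 - w‖ → ‖f z - f w‖ ≤ M * ρ ^ (-(3 / 2) : ℝ)) :
    ‖a n‖ ≤ 100 / ε * (C * A ^ ε + M * A ^ (-(1 / 2) : ℝ)) := by
  have hπ := Real.pi_pos
  have hn0 : (0 : ℝ) < n := by exact_mod_cast hn
  set h := Real.pi / n with hh
  have hh0 : 0 < h := by positivity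
  have hA0 : 0 < A := by linarith
  have hπ3 := Real.pi_gt_three
  have hπ4 := Real.pi_lt_four
  suffices main : ∀ r : ℝ, 1 / 2 ≤ r → r < 1 →
      r ^ n * ‖a n‖ ≤ 100 / ε * (C * A ^ ε + M * A ^ (-(1 / 2) : ℝ)) by
    have ht : Filter.Tendsto (fun r : ℝ => r ^ n * ‖a n‖) (nhdsWithin 1 (Set.Iio 1))
        (nhds (1 ^ n * ‖a n‖)) :=
      ((continuous_pow n).mul continuous_const).continuousAt.tendsto.mono_left nhdsWithin_le_nhds
    rw [one_pow, one_mul] at ht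
    refine le_of_tendsto ht ?_
    filter_upwards [Ioo_mem_nhdsLT (show (1 / 2 : ℝ) < 1 by norm_num)] with r hr
    exact main r hr.1.le hr.2
  intro r hr hr1
  have hr0 : 0 ≤ r := by linarith
  have hFc := continuous_comp_polarPoint hf ha hr0 hr1
  set F : ℝ → E := fun θ => f (polarPoint r θ) with hF
  have hΔ := norm_coeff_le_integral_norm_sub hf ha hr0 hr1 hn
  change _ ≤ ∫ θ in (-Real.pi)..Real.pi, ‖F θ - F (θ + h)‖ at hΔ
  set D : ℝ → ℝ := fun θ => ‖F θ - F (θ + h)‖ with hD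
  have hDc : Continuous D := by fun_prop
  have hnc : Continuous fun θ => ‖F θ‖ := by fun_prop
  -- the outer part
  have hout : ∀ θ : ℝ, A ≤ |θ| → |θ| ≤ Real.pi → D θ ≤ M * 64 * |θ| ^ (-(3 / 2) : ℝ) := by
    intro θ h1 h2
    have h3 := abs_le_norm_one_sub_polarPoint (r := r) hr h2
    have h4 := norm_polarPoint_sub_le hr0 hr1.le θ h
    rw [abs_of_pos hh0] at h4
    have h5 : ‖1 - polarPoint r θ‖ - h ≤ ‖1 - polarPoint r (θ + h)‖ := by
      have := norm_sub_norm_le (1 - polarPoint r θ) (polarPoint r (θ + h) - polarPoint r θ)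
      rw [show 1 - polarPoint r θ - (polarPoint r (θ + h) - polarPoint r θ)
        = 1 - polarPoint r (θ + h) by ring] at this
      linarith
    have h6 := hd (polarPoint r θ) (polarPoint r (θ + h)) (|θ| / 8)
      (by rwa [norm_polarPoint hr0]) (by rwa [norm_polarPoint hr0])
      (by rwa [norm_sub_rev]) (by linarith) (by linarith) (by linarith) (by linarith)
    refine h6.trans ?_
    rw [mul_assoc]
    refine mul_le_mul_of_nonneg_left ?_ hM
    rw [Real.div_rpow (abs_nonneg _) (by norm_num), div_eq_inv_mul,
      ← Real.rpow_neg (by norm_num)]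
    refine mul_le_mul_of_nonneg_right ?_ (Real.rpow_nonneg (abs_nonneg _) _)
    calc (8 : ℝ) ^ (-(-(3 / 2)) : ℝ) ≤ (8 : ℝ) ^ (2 : ℝ) :=
          Real.rpow_le_rpow_of_exponent_le (by norm_num) (by norm_num)
      _ = 64 := by norm_num
  have hM' : 0 ≤ M * 64 := by positivity
  have hAπ : A ≤ Real.pi := by linarith
  have hright : ∫ θ in A..Real.pi, D θ ≤ 2 * (M * 64) * A ^ (-(1 / 2) : ℝ) := by
    refine integral_le_of_le_rpow_neg hA0 hAπ hM' hDc fun θ hθ => ?_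
    have h1 : |θ| = θ := abs_of_pos (hA0.trans_le hθ.1)
    have := hout θ (by rw [h1]; exact hθ.1) (by rw [h1]; exact hθ.2)
    rwa [h1] at this
  have hleft : ∫ θ in (-Real.pi)..(-A), D θ ≤ 2 * (M * 64) * A ^ (-(1 / 2) : ℝ) := by
    rw [← intervalIntegral.integral_comp_neg]
    refine integral_le_of_le_rpow_neg hA0 hAπ hM' (hDc.comp continuous_neg) fun θ hθ => ?_
    have h1 : |-θ| = θ := by rw [abs_neg, abs_of_pos (hA0.trans_le hθ.1)]
    have := hout (-θ) (h1.symm ▸ hθ.1) (h1.symm ▸ hθ.2)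
    rwa [h1] at this
  -- the inner part
  have hinn : ∀ θ : ℝ, 0 < |θ| → |θ| ≤ 2 * A → ‖F θ‖ ≤ (C * 4) * |θ| ^ (ε - 1) := by
    intro θ h1 h2
    have h3 := abs_le_norm_one_sub_polarPoint (r := r) hr (show |θ| ≤ Real.pi by linarith)
    refine (hb _ (by rwa [norm_polarPoint hr0])).trans ?_
    rw [mul_assoc]
    refine mul_le_mul_of_nonneg_left ?_ hC
    calc ‖1 - polarPoint r θ‖ ^ (ε - 1) ≤ (|θ| / 4) ^ (ε - 1) :=
          Real.rpow_le_rpow_of_nonpos (by positivity) h3 (by linarith)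
      _ = 4 ^ (-(ε - 1)) * |θ| ^ (ε - 1) := by
          rw [Real.div_rpow (abs_nonneg _) (by norm_num), div_eq_inv_mul,
            ← Real.rpow_neg (by norm_num)]
      _ ≤ 4 * |θ| ^ (ε - 1) := by
          refine mul_le_mul_of_nonneg_right ?_ (Real.rpow_nonneg (abs_nonneg _) _)
          calc (4 : ℝ) ^ (-(ε - 1)) ≤ 4 ^ (1 : ℝ) :=
                Real.rpow_le_rpow_of_exponent_le (by norm_num) (by linarith)
            _ = 4 := by norm_num
  have hin1 : ∫ θ in (0 : ℝ)..(2 * A), ‖F θ‖ ≤ C * 4 / ε * (2 * A) ^ ε := by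
    refine integral_le_of_le_rpow (by linarith) hε hnc fun θ h1 h2 => ?_
    have := hinn θ (by rwa [abs_of_pos h1]) (by rwa [abs_of_pos h1])
    rwa [abs_of_pos h1] at this
  have hin2 : ∫ θ in (-(2 * A))..0, ‖F θ‖ ≤ C * 4 / ε * (2 * A) ^ ε := by
    have := intervalIntegral.integral_comp_neg (a := 0) (b := 2 * A) (fun θ => ‖F θ‖)
    rw [neg_zero] at this
    rw [← this]
    refine integral_le_of_le_rpow (by linarith) hε (hnc.comp continuous_neg) fun θ h1 h2 => ?_
    have := hinn (-θ) (by rwa [abs_neg, abs_of_pos h1]) (by rwa [abs_neg, abs_of_pos h1])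
    rwa [abs_neg, abs_of_pos h1] at this
  have hin : ∫ θ in (-(2 * A))..(2 * A), ‖F θ‖ ≤ 16 * C / ε * A ^ ε := by
    rw [← intervalIntegral.integral_add_adjacent_intervals (hnc.intervalIntegrable _ 0)
      (hnc.intervalIntegrable 0 _)]
    have h2 : (2 * A) ^ ε ≤ 2 * A ^ ε := by
      rw [Real.mul_rpow (by norm_num) hA0.le]
      refine mul_le_mul_of_nonneg_right ?_ (Real.rpow_nonneg hA0.le _)
      calc (2 : ℝ) ^ ε ≤ 2 ^ (1 : ℝ) := Real.rpow_le_rpow_of_exponent_le (by norm_num) hε1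
        _ = 2 := by norm_num
    have h3 : C * 4 / ε * (2 * A) ^ ε ≤ C * 4 / ε * (2 * A ^ ε) :=
      mul_le_mul_of_nonneg_left h2 (by positivity)
    have h4 : C * 4 / ε * (2 * A ^ ε) + C * 4 / ε * (2 * A ^ ε) = 16 * C / ε * A ^ ε := by ring
    linarith
  have hsub : ∀ x y : ℝ, -(2 * A) ≤ x → x ≤ y → y ≤ 2 * A →
      ∫ θ in x..y, ‖F θ‖ ≤ 16 * C / ε * A ^ ε := by
    intro x y h1 h2 h3
    refine le_trans ?_ hin
    exact intervalIntegral.integral_mono_interval h1 h2 h3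
      (Filter.Eventually.of_forall fun θ => norm_nonneg _) (hnc.intervalIntegrable _ _)
  have hmid : ∫ θ in (-A)..A, D θ ≤ 32 * C / ε * A ^ ε := by
    have hnc' : Continuous fun θ => ‖F (θ + h)‖ := by fun_prop
    calc ∫ θ in (-A)..A, D θ ≤ ∫ θ in (-A)..A, (‖F θ‖ + ‖F (θ + h)‖) :=
          intervalIntegral.integral_mono_on (by linarith) (hDc.intervalIntegrable _ _)
            ((hnc.add hnc').intervalIntegrable _ _) fun θ _ => norm_sub_le _ _
      _ = (∫ θ in (-A)..A, ‖F θ‖) + ∫ θ in (-A + h)..(A + h), ‖F θ‖ := by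
          rw [intervalIntegral.integral_add (hnc.intervalIntegrable _ _)
            (hnc'.intervalIntegrable _ _),
            intervalIntegral.integral_comp_add_right (fun θ => ‖F θ‖)]
      _ ≤ 16 * C / ε * A ^ ε + 16 * C / ε * A ^ ε :=
          add_le_add (hsub _ _ (by linarith) (by linarith) (by linarith))
            (hsub _ _ (by linarith) (by linarith) (by linarith))
      _ = 32 * C / ε * A ^ ε := by ring
  have hsplit : ∫ θ in (-Real.pi)..Real.pi, D θ
      = (∫ θ in (-Real.pi)..(-A), D θ) + (∫ θ in (-A)..A, D θ) + ∫ θ in A..Real.pi, D θ := by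
    rw [intervalIntegral.integral_add_adjacent_intervals (hDc.intervalIntegrable _ _)
      (hDc.intervalIntegrable _ _), intervalIntegral.integral_add_adjacent_intervals
      (hDc.intervalIntegrable _ _) (hDc.intervalIntegrable _ _)]
  set X := A ^ (-(1 / 2) : ℝ) with hX
  have hX0 : 0 ≤ M * X := mul_nonneg hM (Real.rpow_nonneg hA0.le _)
  have hY0 : 0 ≤ C * A ^ ε := mul_nonneg hC (Real.rpow_nonneg hA0.le _)
  have hXε : M * X ≤ M * X / ε := by
    rw [le_div_iff₀ hε]; nlinarith
  have hZ : 0 ≤ r ^ n * ‖a n‖ := by positivity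
  have e1 : 32 * C / ε * A ^ ε = 32 * (C * A ^ ε / ε) := by ring
  have e2 : 100 / ε * (C * A ^ ε + M * X) = 100 * (C * A ^ ε / ε) + 100 * (M * X / ε) := by ring
  have hY1 : 0 ≤ C * A ^ ε / ε := by positivity
  rw [e2]
  rw [hsplit] at hΔ
  rw [e1] at hmid
  have : 12 * (r ^ n * ‖a n‖) ≤ 4 * Real.pi * (r ^ n * ‖a n‖) := by nlinarith
  linarith

end CoefficientBound

section PowerSeries

theorem powerSeries_coeff_unique {E : Type*} [NormedAddCommGroup E] [NormedSpace ℂ E]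
    [CompleteSpace E] {a a' : ℕ → E} {f : ℂ → E}
    (hf : ∀ z : ℂ, ‖z‖ < 1 → HasSum (fun n => z ^ n • a n) (f z))
    (ha : ∀ r : ℝ, 0 ≤ r → r < 1 → Summable fun n => ‖a n‖ * r ^ n)
    (hf' : ∀ z : ℂ, ‖z‖ < 1 → HasSum (fun n => z ^ n • a' n) (f z))
    (ha' : ∀ r : ℝ, 0 ≤ r → r < 1 → Summable fun n => ‖a' n‖ * r ^ n) : a = a' := by
  funext n
  have h1 := integral_exp_mul_powerSeries hf ha (r := 1 / 2) (by norm_num) (by norm_num) n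
  have h2 := integral_exp_mul_powerSeries hf' ha' (r := 1 / 2) (by norm_num) (by norm_num) n
  rw [h1] at h2
  refine smul_right_injective E (r := 2 * (Real.pi : ℂ) * ((1 / 2 : ℝ) : ℂ) ^ n) ?_ h2
  have : (Real.pi : ℂ) ≠ 0 := by exact_mod_cast Real.pi_ne_zero
  simp [this]

theorem exists_powerSeries_of_differentiableOn {E : Type*} [NormedAddCommGroup E]
    [NormedSpace ℂ E] [CompleteSpace E] {f : ℂ → E}
    (hf : DifferentiableOn ℂ f (Metric.ball 0 1)) :
    ∃ a : ℕ → E, (∀ z : ℂ, ‖z‖ < 1 → HasSum (fun n => z ^ n • a n) (f z)) ∧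
      ∀ r : ℝ, 0 ≤ r → r < 1 → Summable fun n => ‖a n‖ * r ^ n := by
  have hR : ∀ R : NNReal, 0 < R → R < 1 →
      HasFPowerSeriesOnBall f (cauchyPowerSeries f 0 R) 0 R := by
    intro R h0 h1
    refine DifferentiableOn.hasFPowerSeriesOnBall (hf.mono ?_) h0
    exact Metric.closedBall_subset_ball (by exact_mod_cast h1)
  have h12 := hR (1 / 2) (by norm_num) (by rw [← NNReal.coe_lt_coe]; norm_num)
  set q := cauchyPowerSeries f 0 ((1 / 2 : NNReal) : ℝ) with hq
  have hall : ∀ R : NNReal, 0 < R → R < 1 → HasFPowerSeriesOnBall f q 0 R := by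
    intro R h0 h1
    exact h12.exchange_radius (hR R h0 h1)
  refine ⟨fun n => q.coeff n, fun z hz => ?_, fun r hr hr1 => ?_⟩
  · obtain ⟨R, hzR, hR1⟩ := exists_between hz
    have hR0 : 0 < R := (norm_nonneg z).trans_lt hzR
    lift R to NNReal using hR0.le
    have := (hall R (by exact_mod_cast hR0) (by exact_mod_cast hR1)).hasSum (y := z)
      (by simpa [Metric.mem_eball, edist_zero_right, enorm_eq_nnnorm] using (by exact_mod_cast hzR))
    simpa using this
  · obtain ⟨R, hzR, hR1⟩ := exists_between hr1
    have hR0 : 0 < R := hr.trans_lt hzR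
    lift R to NNReal using hR0.le
    lift r to NNReal using hr
    have h1 := (hall R (by exact_mod_cast hR0) (by exact_mod_cast hR1)).r_le
    have h2 := q.summable_norm_mul_pow (r := r) (lt_of_lt_of_le (by exact_mod_cast hzR) h1)
    simpa using h2

variable {𝒜 : Type*} [NormedRing 𝒜] [NormedAlgebra ℂ 𝒜] [CompleteSpace 𝒜]

theorem differentiableOn_tsum_pow_succ_smul {b : ℕ → 𝒜} (hb : Summable fun n => ‖b n‖) :
    DifferentiableOn ℂ (fun z : ℂ => ∑' n, z ^ (n + 1) • b n) (Metric.ball 0 1) := by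
  refine Complex.differentiableOn_tsum_of_summable_norm hb (fun n => by fun_prop) Metric.isOpen_ball ?_
  intro n z hz
  rw [norm_smul, norm_pow]
  have hz' : ‖z‖ ≤ 1 := by simpa using (Metric.mem_ball.1 hz).le
  exact mul_le_of_le_one_left (norm_nonneg _) (pow_le_one₀ (norm_nonneg _) hz')

theorem summable_pow_succ_smul {b : ℕ → 𝒜} (hb : Summable fun n => ‖b n‖) {z : ℂ} (hz : ‖z‖ ≤ 1) :
    Summable fun n => z ^ (n + 1) • b n := by
  refine Summable.of_norm_bounded hb fun n => ?_
  rw [norm_smul, norm_pow]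
  exact mul_le_of_le_one_left (norm_nonneg _) (pow_le_one₀ (norm_nonneg _) hz)

/-- The generating function of a renewal sequence is the inverse of `1 - ∑ zⁿ⁺¹ bₙ`. -/
theorem renewal_generating_function {b t : ℕ → 𝒜} (hb : Summable fun n => ‖b n‖)
    (ht0 : t 0 = 1) (ht : ∀ n, t (n + 1) = ∑ i ∈ Finset.range (n + 1), t (n - i) * b i)
    (hU : ∀ z : ℂ, ‖z‖ < 1 → IsUnit (1 - ∑' n, z ^ (n + 1) • b n)) :
    (∀ z : ℂ, ‖z‖ < 1 → HasSum (fun n => z ^ n • t n)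
      (Ring.inverse (1 - ∑' n, z ^ (n + 1) • b n))) ∧
      ∀ r : ℝ, 0 ≤ r → r < 1 → Summable fun n => ‖t n‖ * r ^ n := by
  set S : ℂ → 𝒜 := fun z => ∑' n, z ^ (n + 1) • b n with hS
  have hSd : DifferentiableOn ℂ S (Metric.ball 0 1) := differentiableOn_tsum_pow_succ_smul hb
  have hQ : DifferentiableOn ℂ (fun z => Ring.inverse (1 - S z)) (Metric.ball 0 1) := by
    intro z hz
    obtain ⟨v, hv⟩ := hU z (by simpa using hz)
    have h1 : DifferentiableWithinAt ℂ (fun z => 1 - S z) (Metric.ball 0 1) z :=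
      (differentiableWithinAt_const _).sub (hSd z hz)
    have h2 : DifferentiableAt ℂ (Ring.inverse : 𝒜 → 𝒜) ((fun z => 1 - S z) z) := by
      show DifferentiableAt ℂ (Ring.inverse : 𝒜 → 𝒜) (1 - S z)
      rw [← hv]
      exact differentiableAt_inverse v.isUnit
    exact h2.comp_differentiableWithinAt z h1
  obtain ⟨a, ha, has⟩ := exists_powerSeries_of_differentiableOn hQ
  suffices hat : a = t by rw [← hat]; exact ⟨ha, has⟩
  set s : ℕ → 𝒜 := fun n => Nat.casesOn n 1 fun k => -b k with hs
  have hss : ∀ r : ℝ, 0 ≤ r → r < 1 → Summable fun n => ‖s n‖ * r ^ n := by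
    intro r hr hr1
    rw [← summable_nat_add_iff 1]
    refine Summable.of_nonneg_of_le (fun n => by positivity) (fun n => ?_) hb
    simp only [hs, norm_neg]
    exact mul_le_of_le_one_right (norm_nonneg _) (pow_le_one₀ hr hr1.le)
  have hsS : ∀ z : ℂ, ‖z‖ < 1 → HasSum (fun n => z ^ n • s n) (1 - S z) := by
    intro z hz
    rw [← hasSum_nat_add_iff' 1]
    have := (summable_pow_succ_smul hb hz.le).hasSum.neg
    simpa [hs, hS] using this
  have hnorm : ∀ (c : ℕ → 𝒜) (z : ℂ), (fun n => ‖z ^ n • c n‖) = fun n => ‖c n‖ * ‖z‖ ^ n := by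
    intro c z
    funext n
    rw [norm_smul, norm_pow, mul_comm]
  set d : ℕ → 𝒜 := fun n => ∑ k ∈ Finset.range (n + 1), a k * s (n - k) with hd
  have hterm : ∀ (z : ℂ) (n : ℕ), ∑ k ∈ Finset.range (n + 1), (z ^ k • a k) * (z ^ (n - k) • s (n - k))
      = z ^ n • d n := by
    intro z n
    rw [hd, Finset.smul_sum]
    refine Finset.sum_congr rfl fun k hk => ?_
    rw [smul_mul_smul_comm, ← pow_add, Nat.add_sub_cancel' (Nat.lt_succ_iff.1 (Finset.mem_range.1 hk))]
  have hdsum : ∀ z : ℂ, ‖z‖ < 1 → HasSum (fun n => z ^ n • d n) 1 := by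
    intro z hz
    have h1 : Summable fun n => ‖z ^ n • a n‖ := by
      rw [hnorm]; exact has _ (norm_nonneg _) hz
    have h2 : Summable fun n => ‖z ^ n • s n‖ := by
      rw [hnorm]; exact hss _ (norm_nonneg _) hz
    have h3 := tsum_mul_tsum_eq_tsum_sum_range_of_summable_norm h1 h2
    have h4 := summable_norm_sum_mul_range_of_summable_norm h1 h2
    simp only [hterm] at h3 h4
    rw [(ha z hz).tsum_eq, (hsS z hz).tsum_eq, Ring.inverse_mul_cancel _ (hU z hz)] at h3
    rw [h3]
    exact h4.of_norm.hasSum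
  have hdn : ∀ r : ℝ, 0 ≤ r → r < 1 → Summable fun n => ‖d n‖ * r ^ n := by
    intro r hr hr1
    have hz : ‖(r : ℂ)‖ = r := by rw [Complex.norm_real, Real.norm_of_nonneg hr]
    have h1 : Summable fun n => ‖(r : ℂ) ^ n • a n‖ := by
      rw [hnorm, hz]; exact has _ hr hr1
    have h2 : Summable fun n => ‖(r : ℂ) ^ n • s n‖ := by
      rw [hnorm, hz]; exact hss _ hr hr1
    have h4 := summable_norm_sum_mul_range_of_summable_norm h1 h2
    simp only [hterm] at h4
    rw [hnorm, hz] at h4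
    exact h4
  have hδ : d = fun n => if n = 0 then 1 else 0 := by
    refine powerSeries_coeff_unique (f := fun _ => 1) hdsum hdn (fun z _ => ?_) (fun r _ _ => ?_)
    · refine (hasSum_ite_eq 0 (1 : 𝒜)).congr_fun fun n => ?_
      by_cases h : n = 0 <;> simp [h]
    · refine summable_of_ne_finset_zero (s := {0}) fun n hn => ?_
      have : n ≠ 0 := by simpa using hn
      simp [this]
  have ha0 : a 0 = 1 := by
    have := congrFun hδ 0
    simpa [hd, hs] using this
  have harec : ∀ n, a (n + 1) = ∑ i ∈ Finset.range (n + 1), a (n - i) * b i := by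
    intro n
    have h1 := congrFun hδ (n + 1)
    simp only [hd] at h1
    rw [Finset.sum_range_succ] at h1
    have h2 : ∑ k ∈ Finset.range (n + 1), a k * s (n + 1 - k)
        = -∑ i ∈ Finset.range (n + 1), a (n - i) * b i := by
      rw [← Finset.sum_range_reflect, ← Finset.sum_neg_distrib]
      refine Finset.sum_congr rfl fun i hi => ?_
      have hi' := Finset.mem_range.1 hi
      rw [show n + 1 - 1 - i = n - i by omega, show n + 1 - (n - i) = i + 1 by omega]
      simp [hs]
    rw [h2] at h1
    simp only [Nat.sub_self, hs, Nat.add_eq_zero_iff, one_ne_zero, and_false,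
      if_false] at h1
    rw [neg_add_eq_zero] at h1
    simpa using h1.symm
  funext n
  induction n using Nat.strong_induction_on with
  | _ n ih =>
    cases n with
    | zero => rw [ha0, ht0]
    | succ n =>
      rw [harec, ht]
      refine Finset.sum_congr rfl fun i _ => ?_
      rw [ih (n - i) (by omega)]

end PowerSeries

section Modulus

/-- The modulus of continuity `x (5 - log x)`, comparable with `x log (1/x)` for small `x`. -/
def logModulus (x : ℝ) : ℝ := x * (5 - Real.log x)

theorem four_le_five_sub_log {x : ℝ} (hx : 0 < x) (hx2 : x ≤ 2) : 4 ≤ 5 - Real.log x := by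
  have h1 := Real.log_le_log hx hx2
  have h2 := Real.log_two_lt_d9
  linarith

theorem five_sub_log_le {x y : ℝ} (hx : 0 < x) (hxy : x ≤ y) (hy : y ≤ 2) :
    5 - Real.log x ≤ (y / x) ^ (1 / 4 : ℝ) * (5 - Real.log y) := by
  have hy0 := hx.trans_le hxy
  have h4 := four_le_five_sub_log hy0 hy
  have hl := Real.log_le_log hx hxy
  rw [Real.rpow_def_of_pos (div_pos hy0 hx), Real.log_div hy0.ne' hx.ne']
  have h1 := Real.add_one_le_exp ((Real.log y - Real.log x) * (1 / 4))
  nlinarith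

theorem rpow_mul_five_sub_log_mono {x y : ℝ} (hx : 0 < x) (hxy : x ≤ y) (hy : y ≤ 2) :
    x ^ (1 / 4 : ℝ) * (5 - Real.log x) ≤ y ^ (1 / 4 : ℝ) * (5 - Real.log y) := by
  have hy0 := hx.trans_le hxy
  have h := five_sub_log_le hx hxy hy
  rw [Real.div_rpow hy0.le hx.le] at h
  have hxp : 0 < x ^ (1 / 4 : ℝ) := Real.rpow_pos_of_pos hx _
  calc x ^ (1 / 4 : ℝ) * (5 - Real.log x)
      ≤ x ^ (1 / 4 : ℝ) * (y ^ (1 / 4 : ℝ) / x ^ (1 / 4 : ℝ) * (5 - Real.log y)) := by gcongr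
    _ = _ := by field_simp

theorem logModulus_mono {x y : ℝ} (hx : 0 < x) (hxy : x ≤ y) (hy : y ≤ 2) :
    logModulus x ≤ logModulus y := by
  have hy0 := hx.trans_le hxy
  have h := rpow_mul_five_sub_log_mono hx hxy hy
  have key : ∀ w : ℝ, 0 < w → logModulus w = w ^ (3 / 4 : ℝ) * (w ^ (1 / 4 : ℝ) * (5 - Real.log w)) := by
    intro w hw
    rw [← mul_assoc, ← Real.rpow_add hw]
    norm_num [logModulus]
  rw [key x hx, key y hy0]
  have h4 := four_le_five_sub_log hx (hxy.trans hy)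
  exact mul_le_mul (Real.rpow_le_rpow hx.le hxy (by norm_num)) h
    (mul_nonneg (Real.rpow_nonneg hx.le _) (by linarith)) (Real.rpow_nonneg hy0.le _)

theorem four_mul_le_logModulus {x : ℝ} (hx : 0 < x) (hx2 : x ≤ 2) : 4 * x ≤ logModulus x := by
  have := four_le_five_sub_log hx hx2
  rw [logModulus]
  nlinarith

theorem logModulus_pos {x : ℝ} (hx : 0 < x) (hx2 : x ≤ 2) : 0 < logModulus x := by
  have := four_mul_le_logModulus hx hx2
  linarith

theorem logModulus_le_ten {x : ℝ} (hx : 0 < x) (hx2 : x ≤ 2) : logModulus x ≤ 10 := by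
  refine (logModulus_mono hx hx2 le_rfl).trans ?_
  have := Real.log_pos (show (1 : ℝ) < 2 by norm_num)
  rw [logModulus]
  linarith

theorem continuous_logModulus : Continuous logModulus := by
  have h : logModulus = fun x => 5 * x - x * Real.log x := by
    funext x; rw [logModulus]; ring
  rw [h]
  exact (continuous_const.mul continuous_id).sub Real.continuous_mul_log

theorem logModulus_zero : logModulus 0 = 0 := by simp [logModulus]

theorem norm_pow_sub_pow_le_mul {z w : ℂ} (hz : ‖z‖ ≤ 1) (hw : ‖w‖ ≤ 1) (n : ℕ) :
    ‖z ^ n - w ^ n‖ ≤ n * ‖z - w‖ := by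
  induction n with
  | zero => simp
  | succ n ih =>
    have h1 : z ^ (n + 1) - w ^ (n + 1) = z * (z ^ n - w ^ n) + (z - w) * w ^ n := by ring
    rw [h1]
    refine (norm_add_le _ _).trans ?_
    rw [norm_mul, norm_mul, norm_pow]
    have h2 : ‖w‖ ^ n ≤ 1 := pow_le_one₀ (norm_nonneg _) hw
    have h3 : ‖z‖ * ‖z ^ n - w ^ n‖ ≤ 1 * (n * ‖z - w‖) := by gcongr
    have h4 : ‖z - w‖ * ‖w‖ ^ n ≤ ‖z - w‖ * 1 := by gcongr
    push_cast
    linarith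

theorem norm_pow_sub_pow_le_two {z w : ℂ} (hz : ‖z‖ ≤ 1) (hw : ‖w‖ ≤ 1) (n : ℕ) :
    ‖z ^ n - w ^ n‖ ≤ 2 := by
  have h1 : ‖z‖ ^ n ≤ 1 := pow_le_one₀ (norm_nonneg _) hz
  have h2 : ‖w‖ ^ n ≤ 1 := pow_le_one₀ (norm_nonneg _) hw
  refine (norm_sub_le _ _).trans ?_
  rw [norm_pow, norm_pow]
  linarith

/-- If the tails of `p` are `O(1/m)`, the truncated first moments of `p` grow at most
logarithmically. -/
theorem truncated_moment_le {p τ : ℕ → ℝ} (hp : ∀ n, 0 ≤ p n)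
    (hτ : ∀ m, HasSum (fun n => if m ≤ n then p n else 0) (τ m))
    {c₁ : ℝ} (hc₁ : 0 ≤ c₁) (hτ0 : τ 0 = 1) (hτb : ∀ m : ℕ, 1 ≤ m → τ m ≤ c₁ * (m : ℝ)⁻¹)
    {t : ℝ} (ht : 0 < t) (ht2 : t ≤ 2) :
    Summable (fun n : ℕ => p n * min 2 ((n + 1) * t)) ∧
      ∑' n : ℕ, p n * min 2 ((n + 1) * t) ≤ (1 + c₁) * logModulus t := by
  set N := ⌈2 / t⌉₊ with hN
  have hN1 : 1 ≤ N := Nat.one_le_ceil_iff.2 (by positivity)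
  have hNt : 2 / t ≤ N := Nat.le_ceil _
  have hN4 : (N : ℝ) ≤ 4 / t := by
    have h1 := (Nat.ceil_lt_add_one (show 0 ≤ 2 / t by positivity)).le
    have h2 : 1 ≤ 2 / t := by rw [le_div_iff₀ ht]; linarith
    have h3 : 4 / t = 2 / t + 2 / t := by ring
    linarith
  have hsum := hasSum_sum (s := Finset.range N) fun m _ => hτ m
  have hmin : ∀ n : ℕ, ∑ m ∈ Finset.range N, (if m ≤ n then p n else 0)
      = p n * (min (n + 1) N : ℕ) := by
    intro n
    rw [← Finset.sum_filter, Finset.sum_const, nsmul_eq_mul, mul_comm]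
    congr 2
    have : Finset.filter (fun m => m ≤ n) (Finset.range N) = Finset.range (min (n + 1) N) := by
      ext m; simp only [Finset.mem_filter, Finset.mem_range]; omega
    rw [this, Finset.card_range]
  simp only [hmin] at hsum
  have hle : ∀ n : ℕ, p n * min 2 ((n + 1) * t) ≤ t * (p n * (min (n + 1) N : ℕ)) := by
    intro n
    have h1 : min 2 ((n + 1) * t) ≤ t * (min (n + 1) N : ℕ) := by
      rcases le_total (n + 1) N with h | h
      · rw [min_eq_left h]
        push_cast
        rw [mul_comm t]
        exact min_le_right _ _
      · rw [min_eq_right h]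
        refine (min_le_left _ _).trans ?_
        rw [div_le_iff₀ ht] at hNt
        linarith
    calc _ ≤ p n * (t * (min (n + 1) N : ℕ)) := mul_le_mul_of_nonneg_left h1 (hp n)
      _ = _ := by ring
  have hnn : ∀ n : ℕ, 0 ≤ p n * min 2 ((n + 1) * t) := fun n =>
    mul_nonneg (hp n) (le_min (by norm_num) (by positivity))
  have hS : Summable (fun n : ℕ => p n * min 2 ((n + 1) * t)) :=
    Summable.of_nonneg_of_le hnn hle (hsum.mul_left t).summable
  refine ⟨hS, ?_⟩
  have h1 := hS.tsum_le_tsum hle (hsum.mul_left t).summable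
  rw [(hsum.mul_left t).tsum_eq] at h1
  have h2 : ∑ m ∈ Finset.range N, τ m ≤ 1 + c₁ * (1 + Real.log N) := by
    obtain ⟨k, hk⟩ : ∃ k, N = k + 1 := ⟨N - 1, by omega⟩
    rw [hk, Finset.sum_range_succ', hτ0, add_comm]
    gcongr
    have h3 : ∑ m ∈ Finset.range k, τ (m + 1) ≤ c₁ * ∑ m ∈ Finset.range k, ((m + 1 : ℕ) : ℝ)⁻¹ := by
      rw [Finset.mul_sum]
      exact Finset.sum_le_sum fun m _ => hτb (m + 1) (by omega)
    refine h3.trans (mul_le_mul_of_nonneg_left ?_ hc₁)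
    have h4 := harmonic_le_one_add_log (k + 1)
    rw [harmonic, Finset.sum_range_succ] at h4
    push_cast at h4 ⊢
    have : (0 : ℝ) ≤ ((k : ℝ) + 1)⁻¹ := by positivity
    linarith
  have h3 : Real.log N ≤ 2 - Real.log t := by
    have h4 := Real.log_le_log (by exact_mod_cast hN1) hN4
    rw [Real.log_div (by norm_num) ht.ne', show (4 : ℝ) = 2 ^ 2 by norm_num, Real.log_pow] at h4
    have := Real.log_two_lt_d9
    push_cast at h4
    linarith
  have h4 := four_le_five_sub_log ht ht2
  calc _ ≤ t * ∑ m ∈ Finset.range N, τ m := h1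
    _ ≤ t * (1 + c₁ * (1 + Real.log N)) := by gcongr
    _ ≤ t * (1 * (5 - Real.log t) + c₁ * (5 - Real.log t)) := by
        gcongr
        · linarith
        · linarith
    _ = _ := by rw [logModulus]; ring

theorem norm_tsum_sub_tsum_le {𝒜 : Type*} [NormedRing 𝒜] [NormedAlgebra ℂ 𝒜] [CompleteSpace 𝒜]
    {p τ : ℕ → ℝ} (hp : ∀ n, 0 ≤ p n)
    (hτ : ∀ m, HasSum (fun n => if m ≤ n then p n else 0) (τ m))
    {c₁ : ℝ} (hc₁ : 0 ≤ c₁) (hτ0 : τ 0 = 1) (hτb : ∀ m : ℕ, 1 ≤ m → τ m ≤ c₁ * (m : ℝ)⁻¹)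
    {b : ℕ → 𝒜} {C : ℝ} (hC : 0 ≤ C) (hb : ∀ n, ‖b n‖ ≤ C * p n) {z w : ℂ} (hz : ‖z‖ ≤ 1)
    (hw : ‖w‖ ≤ 1) :
    ‖(∑' n, z ^ (n + 1) • b n) - ∑' n, w ^ (n + 1) • b n‖
      ≤ C * (1 + c₁) * logModulus ‖z - w‖ := by
  have hpS : Summable p := by simpa using (hτ 0).summable
  have hbS : Summable fun n => ‖b n‖ :=
    Summable.of_nonneg_of_le (fun n => norm_nonneg _) hb (hpS.mul_left C)
  rcases eq_or_ne z w with rfl | hzw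
  · simp [logModulus_zero]
  have ht : 0 < ‖z - w‖ := norm_pos_iff.2 (sub_ne_zero.2 hzw)
  have ht2 : ‖z - w‖ ≤ 2 := (norm_sub_le _ _).trans (by linarith)
  obtain ⟨h1, h2⟩ := truncated_moment_le hp hτ hc₁ hτ0 hτb ht ht2
  rw [← (summable_pow_succ_smul hbS hz).tsum_sub (summable_pow_succ_smul hbS hw)]
  have hle : ∀ n : ℕ, ‖z ^ (n + 1) • b n - w ^ (n + 1) • b n‖
      ≤ C * (p n * min 2 ((n + 1) * ‖z - w‖)) := by
    intro n
    rw [← sub_smul, norm_smul, mul_comm, ← mul_assoc]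
    refine mul_le_mul (hb n) (le_min (norm_pow_sub_pow_le_two hz hw _) ?_) (norm_nonneg _)
      (mul_nonneg hC (hp n))
    have := norm_pow_sub_pow_le_mul hz hw (n + 1)
    push_cast at this
    exact this
  refine (tsum_of_norm_bounded (h1.mul_left C).hasSum hle).trans ?_
  rw [tsum_mul_left, mul_assoc]
  exact mul_le_mul_of_nonneg_left h2 hC

end Modulus

section ScalarSeries

theorem continuousOn_tsum_pow_succ_smul {𝒜 : Type*} [NormedRing 𝒜] [NormedAlgebra ℂ 𝒜]
    [CompleteSpace 𝒜] {b : ℕ → 𝒜} (hb : Summable fun n => ‖b n‖) :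
    ContinuousOn (fun z : ℂ => ∑' n, z ^ (n + 1) • b n) (Metric.closedBall 0 1) := by
  refine continuousOn_tsum (fun n => by fun_prop) hb ?_
  intro n z hz
  rw [norm_smul, norm_pow]
  have hz' : ‖z‖ ≤ 1 := by simpa using hz
  exact mul_le_of_le_one_left (norm_nonneg _) (pow_le_one₀ (norm_nonneg _) hz')

/-- A probability vector `p` (with `p n` the mass at `n + 1`) whose tails `τ` satisfy
`τ m = c (1/m + H m)` with `H m = O(m^{-q})`, `q > 1`. -/
structure IsTailExpansion (p τ H : ℕ → ℝ) (c q K : ℝ) : Prop where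
  nonneg : ∀ n, 0 ≤ p n
  hasSum_tail : ∀ m, HasSum (fun n => if m ≤ n then p n else 0) (τ m)
  tail_zero : τ 0 = 1
  c_pos : 0 < c
  one_lt_q : 1 < q
  tail_eq : ∀ m : ℕ, 1 ≤ m → τ m = c * ((m : ℝ)⁻¹ + H m)
  abs_H_le : ∀ m : ℕ, 1 ≤ m → |H m| ≤ K * (m : ℝ) ^ (-q)

namespace IsTailExpansion

variable {p τ H : ℕ → ℝ} {c q K : ℝ} (h : IsTailExpansion p τ H c q K)
include h

theorem K_nonneg : 0 ≤ K := by
  have := h.abs_H_le 1 le_rfl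
  simp only [Nat.cast_one, Real.one_rpow, mul_one] at this
  exact (abs_nonneg _).trans this

theorem tail_le (m : ℕ) (hm : 1 ≤ m) : τ m ≤ c * (1 + K) * (m : ℝ)⁻¹ := by
  rw [h.tail_eq m hm, mul_assoc]
  refine mul_le_mul_of_nonneg_left ?_ h.c_pos.le
  have h1 := (le_abs_self _).trans (h.abs_H_le m hm)
  have hm1 : (1 : ℝ) ≤ m := by exact_mod_cast hm
  have h2 : (m : ℝ) ^ (-q) ≤ (m : ℝ)⁻¹ := by
    rw [← Real.rpow_neg_one]
    exact Real.rpow_le_rpow_of_exponent_le hm1 (by linarith [h.one_lt_q])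
  have := mul_le_mul_of_nonneg_left h2 h.K_nonneg
  linarith

theorem const_nonneg : 0 ≤ c * (1 + K) :=
  mul_nonneg h.c_pos.le (by linarith [h.K_nonneg])

theorem hasSum_one : HasSum p 1 := by
  have := h.hasSum_tail 0
  rw [h.tail_zero] at this
  simpa using this

theorem summable_norm_ofReal : Summable fun n => ‖((p n : ℝ) : ℂ)‖ := by
  simpa using h.hasSum_one.summable.abs

theorem eq_tail_sub (n : ℕ) : p n = τ n - τ (n + 1) := by
  have h1 := (h.hasSum_tail n).sub (h.hasSum_tail (n + 1))
  refine ((hasSum_ite_eq n (p n)).congr_fun fun k => ?_).unique h1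
  rcases lt_trichotomy k n with hk | hk | hk
  · simp [show ¬ n ≤ k by omega, show ¬ n + 1 ≤ k by omega, hk.ne]
  · simp [hk]
  · simp [show n ≤ k by omega, show n + 1 ≤ k by omega, hk.ne']

theorem summable_H_mul_rpow {ε : ℝ} (hε : ε < q - 1) :
    Summable fun n : ℕ => |H (n + 1)| * ((n + 1 : ℕ) : ℝ) ^ ε := by
  have h1 : Summable fun n : ℕ => K * ((n + 1 : ℕ) : ℝ) ^ (-(q - ε)) := by
    refine Summable.mul_left K ?_
    rw [summable_nat_add_iff 1 (f := fun n : ℕ => (n : ℝ) ^ (-(q - ε)))]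
    exact Real.summable_nat_rpow.2 (by linarith)
  refine Summable.of_nonneg_of_le (fun n => by positivity) (fun n => ?_) h1
  have hpos : (0 : ℝ) < (n + 1 : ℕ) := by positivity
  rw [show -(q - ε) = -q + ε by ring, Real.rpow_add hpos, ← mul_assoc]
  exact mul_le_mul_of_nonneg_right (h.abs_H_le _ (by omega)) (by positivity)

theorem summable_abs_H : Summable fun n : ℕ => |H (n + 1)| := by
  simpa using h.summable_H_mul_rpow (ε := 0) (by linarith [h.one_lt_q])

theorem one_sub_series_eq {z : ℂ} (hz : ‖z‖ < 1) :
    1 - ∑' n, z ^ (n + 1) • ((p n : ℝ) : ℂ)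
      = c * (1 - z) * (-Complex.log (1 - z) + ((c⁻¹ + ∑' n, H (n + 1) : ℝ) : ℂ)
        + ∑' n, (z ^ (n + 1) - 1) * ((H (n + 1) : ℝ) : ℂ)) := by
  have hc : (c : ℂ) ≠ 0 := by exact_mod_cast h.c_pos.ne'
  have hHS : Summable fun n : ℕ => H (n + 1) := h.summable_abs_H.of_abs
  have hH1 : HasSum (fun n : ℕ => ((H (n + 1) : ℝ) : ℂ)) ((∑' n, H (n + 1) : ℝ) : ℂ) :=
    Complex.hasSum_ofReal.2 hHS.hasSum
  have hH2 : Summable fun n : ℕ => (z ^ (n + 1) - 1) * ((H (n + 1) : ℝ) : ℂ) := by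
    refine Summable.of_norm_bounded (h.summable_abs_H.mul_left 2) fun n => ?_
    rw [norm_mul, Complex.norm_real, Real.norm_eq_abs]
    refine mul_le_mul_of_nonneg_right ?_ (abs_nonneg _)
    simpa using norm_pow_sub_pow_le_two hz.le (w := 1) (by simp) (n + 1)
  have hL : HasSum (fun n : ℕ => z ^ (n + 1) * (((n + 1 : ℕ) : ℂ))⁻¹) (-Complex.log (1 - z)) := by
    have := Complex.hasSum_taylorSeries_neg_log hz
    rw [← hasSum_nat_add_iff' 1] at this
    simpa [div_eq_mul_inv] using this
  set X : ℂ := c * (-Complex.log (1 - z) + ((c⁻¹ + ∑' n, H (n + 1) : ℝ) : ℂ)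
        + ∑' n, (z ^ (n + 1) - 1) * ((H (n + 1) : ℝ) : ℂ)) with hX
  have hτ1 : HasSum (fun n : ℕ => z ^ (n + 1) * ((τ (n + 1) : ℝ) : ℂ)) (X - 1) := by
    have := ((hL.add (hH1.add hH2.hasSum)).mul_left (c : ℂ))
    have hX1 : X - 1 = c * (-Complex.log (1 - z) + (((∑' n, H (n + 1) : ℝ) : ℂ)
        + ∑' n, (z ^ (n + 1) - 1) * ((H (n + 1) : ℝ) : ℂ))) := by
      rw [hX, Complex.ofReal_add, Complex.ofReal_inv]
      field_simp
      ring
    rw [hX1]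
    refine this.congr_fun fun n => ?_
    rw [h.tail_eq (n + 1) (by omega)]
    push_cast
    ring
  have hτ : HasSum (fun n : ℕ => z ^ n * ((τ n : ℝ) : ℂ)) X := by
    rw [← hasSum_nat_add_iff' 1]
    simpa [h.tail_zero] using hτ1
  have hg := (hτ.mul_left z).sub hτ1
  have hg' : HasSum (fun n => z ^ (n + 1) • ((p n : ℝ) : ℂ)) (z * X - (X - 1)) := by
    refine hg.congr_fun fun n => ?_
    rw [h.eq_tail_sub n, smul_eq_mul]
    push_cast
    ring
  rw [hg'.tsum_eq]
  have : c * (1 - z) * (-Complex.log (1 - z) + ((c⁻¹ + ∑' n, H (n + 1) : ℝ) : ℂ)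
        + ∑' n, (z ^ (n + 1) - 1) * ((H (n + 1) : ℝ) : ℂ)) = (1 - z) * X := by rw [hX]; ring
  rw [this]
  ring

theorem norm_H_series_le {ε : ℝ} (hε : 0 < ε) (hε1 : ε ≤ 1) (hεq : ε < q - 1) {z : ℂ}
    (hz : ‖z‖ ≤ 1) :
    ‖∑' n, (z ^ (n + 1) - 1) * ((H (n + 1) : ℝ) : ℂ)‖
      ≤ (2 * ∑' n : ℕ, |H (n + 1)| * ((n + 1 : ℕ) : ℝ) ^ ε) * ‖1 - z‖ ^ ε := by
  have hS := (h.summable_H_mul_rpow hεq).mul_left (2 * ‖1 - z‖ ^ ε)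
  refine (tsum_of_norm_bounded hS.hasSum fun n => ?_).trans_eq ?_
  · rw [norm_mul, Complex.norm_real, Real.norm_eq_abs]
    have h2 : ‖z ^ (n + 1) - 1‖ ≤ 2 := by
      simpa using norm_pow_sub_pow_le_two hz (w := 1) (by simp) (n + 1)
    have h1 : ‖z ^ (n + 1) - 1‖ ≤ (n + 1 : ℕ) * ‖1 - z‖ := by
      have := norm_pow_sub_pow_le_mul hz (w := 1) (by simp) (n + 1)
      rw [norm_sub_rev 1 z]
      simpa using this
    set x := ((n + 1 : ℕ) : ℝ) * ‖1 - z‖ with hx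
    have hx0 : 0 ≤ x := by positivity
    have h3 : ‖z ^ (n + 1) - 1‖ ≤ 2 * x ^ ε := by
      rcases le_total x 1 with hx1 | hx1
      · have : x ≤ x ^ ε := by
          rcases hx0.eq_or_lt with h0 | h0
          · rw [← h0, Real.zero_rpow hε.ne']
          · simpa using Real.rpow_le_rpow_of_exponent_ge h0 hx1 hε1
        linarith
      · have := Real.one_le_rpow hx1 hε.le
        linarith
    calc _ ≤ 2 * x ^ ε * |H (n + 1)| := mul_le_mul_of_nonneg_right h3 (abs_nonneg _)
      _ = _ := by
        rw [hx, Real.mul_rpow (by positivity) (norm_nonneg _)]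
        ring
  · rw [tsum_mul_left]
    ring

end IsTailExpansion

theorem norm_one_sub_le_two {z : ℂ} (hz : ‖z‖ ≤ 1) : ‖1 - z‖ ≤ 2 := by
  refine (norm_sub_le _ _).trans ?_
  rw [norm_one]
  linarith

theorem neg_log_norm_le_norm_neg_log (x : ℂ) : -Real.log ‖x‖ ≤ ‖-Complex.log x‖ := by
  rw [← Complex.log_re, ← Complex.neg_re]
  exact Complex.re_le_norm _

namespace IsTailExpansion
variable {p τ H : ℕ → ℝ} {c q K : ℝ} (h : IsTailExpansion p τ H c q K)
include h

/-- Lower bound for `1 - ∑ zⁿ⁺¹ pₙ` in the disc. -/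
theorem exists_logModulus_le (hne : ∀ z : ℂ, ‖z‖ ≤ 1 → z ≠ 1 →
      ∑' n, z ^ (n + 1) • ((p n : ℝ) : ℂ) ≠ 1) :
    ∃ κ : ℝ, 0 < κ ∧ ∀ z : ℂ, ‖z‖ < 1 →
      κ * logModulus ‖1 - z‖ ≤ ‖1 - ∑' n, z ^ (n + 1) • ((p n : ℝ) : ℂ)‖ := by
  obtain ⟨ε, hε, hε1, hεq⟩ : ∃ ε : ℝ, 0 < ε ∧ ε ≤ 1 ∧ ε < q - 1 := by
    have := h.one_lt_q
    exact ⟨min 1 ((q - 1) / 2), lt_min one_pos (by linarith), min_le_left _ _,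
      (min_le_right _ _).trans_lt (by linarith)⟩
  set a : ℝ := c⁻¹ + ∑' n, H (n + 1) with ha
  set K₂ : ℝ := 2 * ∑' n : ℕ, |H (n + 1)| * ((n + 1 : ℕ) : ℝ) ^ ε with hK₂
  have hK₂0 : 0 ≤ K₂ := by
    have : 0 ≤ ∑' n : ℕ, |H (n + 1)| * ((n + 1 : ℕ) : ℝ) ^ ε := tsum_nonneg fun n => by positivity
    positivity
  set B : ℝ := |a| + K₂ with hB
  have hB0 : 0 ≤ B := by positivity
  set δ : ℝ := Real.exp (-(2 * B + 5)) with hδ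
  have hδ0 : 0 < δ := Real.exp_pos _
  have hδ1 : δ ≤ 1 := Real.exp_le_one_iff.2 (by linarith)
  have hc := h.c_pos
  have hnear : ∀ z : ℂ, ‖z‖ < 1 → ‖1 - z‖ < δ →
      c / 2 * logModulus ‖1 - z‖ ≤ ‖1 - ∑' n, z ^ (n + 1) • ((p n : ℝ) : ℂ)‖ := by
    intro z hz hzδ
    have hz1 : z ≠ 1 := by rintro rfl; simp at hz
    have hρ : 0 < ‖1 - z‖ := norm_pos_iff.2 (sub_ne_zero.2 hz1.symm)
    have hlog : 2 * B + 5 ≤ -Real.log ‖1 - z‖ := by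
      have := Real.log_le_log hρ hzδ.le
      rw [hδ, Real.log_exp] at this
      linarith
    rw [h.one_sub_series_eq hz, norm_mul, norm_mul, Complex.norm_real, Real.norm_of_nonneg hc.le]
    have h1 := h.norm_H_series_le hε hε1 hεq hz.le
    have h2 : ‖1 - z‖ ^ ε ≤ 1 := Real.rpow_le_one hρ.le (hzδ.le.trans hδ1) hε.le
    have h3 := mul_le_mul_of_nonneg_left h2 hK₂0
    have h4 := neg_log_norm_le_norm_neg_log (1 - z)
    set L := -Complex.log (1 - z)
    set T := ∑' n, (z ^ (n + 1) - 1) * ((H (n + 1) : ℝ) : ℂ)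
    have h5 : ‖L‖ - B ≤ ‖L + (a : ℂ) + T‖ := by
      have e : L = (L + (a : ℂ) + T) - ((a : ℂ) + T) := by ring
      have h6 := norm_sub_le (L + (a : ℂ) + T) ((a : ℂ) + T)
      rw [← e] at h6
      have h7 := norm_add_le (a : ℂ) T
      rw [Complex.norm_real, Real.norm_eq_abs] at h7
      linarith
    rw [logModulus]
    have h8 : (5 - Real.log ‖1 - z‖) / 2 ≤ ‖L + (a : ℂ) + T‖ := by linarith
    calc c / 2 * (‖1 - z‖ * (5 - Real.log ‖1 - z‖))
        = c * ‖1 - z‖ * ((5 - Real.log ‖1 - z‖) / 2) := by ring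
      _ ≤ _ := mul_le_mul_of_nonneg_left h8 (by positivity)
  have hfar : ∃ κ : ℝ, 0 < κ ∧ ∀ z : ℂ, ‖z‖ ≤ 1 → δ ≤ ‖1 - z‖ →
      κ ≤ ‖1 - ∑' n, z ^ (n + 1) • ((p n : ℝ) : ℂ)‖ := by
    set s : Set ℂ := Metric.closedBall 0 1 ∩ {z | δ ≤ ‖1 - z‖} with hs
    have hsc : IsCompact s := (isCompact_closedBall _ _).inter_right
      (isClosed_le continuous_const (by fun_prop))
    have hcont : ContinuousOn (fun z : ℂ => ‖1 - ∑' n, z ^ (n + 1) • ((p n : ℝ) : ℂ)‖) s :=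
      (continuousOn_const.sub ((continuousOn_tsum_pow_succ_smul h.summable_norm_ofReal).mono
        Set.inter_subset_left)).norm
    have hmem : ∀ z : ℂ, ‖z‖ ≤ 1 → δ ≤ ‖1 - z‖ → z ∈ s := fun z h1 h2 => ⟨by simpa using h1, h2⟩
    rcases s.eq_empty_or_nonempty with hemp | hne'
    · refine ⟨1, one_pos, fun z h1 h2 => ?_⟩
      have := hmem z h1 h2
      rw [hemp] at this
      exact this.elim
    · obtain ⟨z₀, hz₀, hmin⟩ := hsc.exists_isMinOn hne' hcont
      refine ⟨_, norm_pos_iff.2 (sub_ne_zero.2 (hne z₀ (by simpa using hz₀.1) ?_).symm),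
        fun z h1 h2 => hmin (hmem z h1 h2)⟩
      rintro rfl
      have := hz₀.2
      simp only [Set.mem_ofPred_eq, sub_self, norm_zero] at this
      linarith
  obtain ⟨κ, hκ, hκf⟩ := hfar
  refine ⟨min (c / 2) (κ / 10), lt_min (by positivity) (by positivity), fun z hz => ?_⟩
  have hz1 : z ≠ 1 := by rintro rfl; simp at hz
  have hρ : 0 < ‖1 - z‖ := norm_pos_iff.2 (sub_ne_zero.2 hz1.symm)
  have hρ2 := norm_one_sub_le_two hz.le
  have hm := logModulus_pos hρ hρ2
  rcases lt_or_ge ‖1 - z‖ δ with hlt | hge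
  · exact (mul_le_mul_of_nonneg_right (min_le_left _ _) hm.le).trans (hnear z hz hlt)
  · refine (mul_le_mul_of_nonneg_right (min_le_right _ _) hm.le).trans ?_
    refine le_trans ?_ (hκf z hz.le hge)
    have := logModulus_le_ten hρ hρ2
    nlinarith

end IsTailExpansion

end ScalarSeries

section Spectral

theorem _root_.ContinuousLinearMap.circleIntegral_comp_comm {E G : Type*} [NormedAddCommGroup E]
    [NormedSpace ℂ E] [CompleteSpace E] [NormedAddCommGroup G] [NormedSpace ℂ G] [CompleteSpace G]
    (L : E →L[ℂ] G) {f : ℂ → E} {a : ℂ} {r : ℝ} (hf : CircleIntegrable f a r) :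
    ∮ z in C(a, r), L (f z) = L (∮ z in C(a, r), f z) := by
  have hi := hf.out
  have := L.intervalIntegral_comp_comm hi
  simp only [circleIntegral]
  rw [← this]
  simp

variable {B : Type*} [NormedAddCommGroup B] [NormedSpace ℂ B] [CompleteSpace B]

/-- If `1` is a simple isolated eigenvalue of `A` with eigenvector `e` and left eigenvector `ℓ`,
then `I - A + ℓ ⊗ e` is invertible. -/
theorem isUnit_one_sub_add_smulRight {A : B →L[ℂ] B} {e : B} {ℓ : B →L[ℂ] ℂ} (hℓe : ℓ e = 1)
    (hAe : A e = e) (hℓA : ∀ v, ℓ (A v) = ℓ v) (hA : IsSimpleIsolatedEigenvalue A 1) :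
    IsUnit (1 - A + ℓ.smulRight e) := by
  obtain ⟨-, r, hr, hspec, hrank⟩ := hA
  have he0 : e ≠ 0 := by rintro rfl; simp at hℓe
  have h2πi : (2 * (Real.pi : ℂ) * Complex.I) ≠ 0 := by
    simp [Real.pi_ne_zero, Complex.I_ne_zero]
  have hne1 : ∀ z ∈ Metric.sphere (1 : ℂ) r, z - 1 ≠ 0 := by
    intro z hz h0
    rw [mem_sphere_iff_norm, h0, norm_zero] at hz
    exact hr.ne hz
  have hres : ∀ z ∈ Metric.sphere (1 : ℂ) r, z ∈ resolventSet ℂ A := by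
    intro z hz
    by_contra hcon
    have h1 : z ∈ spectrum ℂ A ∩ Metric.closedBall 1 r := ⟨hcon, Metric.sphere_subset_closedBall hz⟩
    rw [hspec, Set.mem_singleton_iff] at h1
    exact hne1 z hz (sub_eq_zero.2 h1)
  have hcont : ContinuousOn (resolvent A) (Metric.sphere (1 : ℂ) r) := fun z hz =>
    (spectrum.hasDerivAt_resolvent_const_left (hres z hz)).continuousAt.continuousWithinAt
  have hcont' : ContinuousOn (fun z : ℂ => (z - 1)⁻¹ • resolvent A z) (Metric.sphere (1 : ℂ) r) :=
    ContinuousOn.smul (ContinuousOn.inv₀ (by fun_prop) hne1) hcont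
  have hci := hcont.circleIntegrable hr.le
  have hci' := hcont'.circleIntegrable hr.le
  have hright : ∀ z ∈ Metric.sphere (1 : ℂ) r, (algebraMap ℂ (B →L[ℂ] B) z - A) * resolvent A z = 1 :=
    fun z hz => Ring.mul_inverse_cancel _ (hres z hz)
  have hleft : ∀ z ∈ Metric.sphere (1 : ℂ) r, resolvent A z * (algebraMap ℂ (B →L[ℂ] B) z - A) = 1 :=
    fun z hz => Ring.inverse_mul_cancel _ (hres z hz)
  have hRe : ∀ z ∈ Metric.sphere (1 : ℂ) r, resolvent A z e = (z - 1)⁻¹ • e := by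
    intro z hz
    have h1 := DFunLike.congr_fun (hleft z hz) e
    have h2 : (algebraMap ℂ (B →L[ℂ] B) z - A) e = (z - 1) • e := by
      simp [Algebra.algebraMap_eq_smul_one, hAe, sub_smul]
    rw [mul_apply_eq_comp, h2, map_smul, one_apply_eq_self] at h1
    rw [← h1, smul_smul, h1, inv_mul_cancel₀ (hne1 z hz), one_smul]
  have hℓR : ∀ z ∈ Metric.sphere (1 : ℂ) r, ∀ v, ℓ (resolvent A z v) = (z - 1)⁻¹ * ℓ v := by
    intro z hz v
    have h1 := DFunLike.congr_fun (hright z hz) v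
    rw [mul_apply_eq_comp, one_apply_eq_self] at h1
    have h2 : ℓ v = (z - 1) * ℓ (resolvent A z v) := by
      conv_lhs => rw [← h1]
      simp [Algebra.algebraMap_eq_smul_one, hℓA, sub_mul]
    rw [h2, ← mul_assoc, inv_mul_cancel₀ (hne1 z hz), one_mul]
  have hinv : ∮ z in C((1 : ℂ), r), (z - 1)⁻¹ = 2 * (Real.pi : ℂ) * Complex.I :=
    circleIntegral.integral_sub_center_inv 1 hr.ne'
  have hinv2 : ∮ z in C((1 : ℂ), r), (z - 1)⁻¹ * (z - 1)⁻¹ = 0 := by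
    have := circleIntegral.integral_sub_zpow_of_ne (n := -2) (by norm_num) 1 1 r
    rw [← this]
    refine circleIntegral.integral_congr hr.le fun z _ => ?_
    rw [zpow_neg, ← mul_inv]
    norm_cast
    rw [sq]
  set P : B →L[ℂ] B := ℓ.smulRight e with hP
  set Q := spectralProjection A 1 r with hQ
  set S : B →L[ℂ] B := (2 * (Real.pi : ℂ) * Complex.I)⁻¹ •
    ∮ z in C((1 : ℂ), r), (z - 1)⁻¹ • resolvent A z with hS
  let ev : B → (B →L[ℂ] B) →L[ℂ] B := fun v => ContinuousLinearMap.apply ℂ B v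
  have hQe : Q e = e := by
    have h1 := (ev e).circleIntegral_comp_comm hci
    have h2 : Q e = (2 * (Real.pi : ℂ) * Complex.I)⁻¹ • ev e (∮ z in C((1 : ℂ), r), resolvent A z) :=
      rfl
    rw [h2, ← h1, circleIntegral.integral_congr (g := fun z => (z - 1)⁻¹ • e) hr.le
      fun z hz => ?_, circleIntegral.integral_smul_const, hinv, smul_smul,
      inv_mul_cancel₀ h2πi, one_smul]
    exact hRe z hz
  have hℓQ : ∀ v, ℓ (Q v) = ℓ v := by
    intro v
    have h1 := (ℓ.comp (ev v)).circleIntegral_comp_comm hci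
    have h2 : ℓ (Q v) = (2 * (Real.pi : ℂ) * Complex.I)⁻¹ *
        (ℓ.comp (ev v)) (∮ z in C((1 : ℂ), r), resolvent A z) := by
      change ℓ ((2 * (Real.pi : ℂ) * Complex.I)⁻¹ • _) = _
      rw [map_smul]
      rfl
    rw [h2, ← h1, circleIntegral.integral_congr (g := fun z => (z - 1)⁻¹ • ℓ v) hr.le
      fun z hz => ?_, circleIntegral.integral_smul_const, hinv, smul_eq_mul, ← mul_assoc,
      inv_mul_cancel₀ h2πi, one_mul]
    exact hℓR z hz v
  have hQP : Q = P := by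
    ext v
    have hmem : e ∈ LinearMap.range (Q : B →ₗ[ℂ] B) := ⟨e, hQe⟩
    have h1 := (finrank_eq_one_iff_of_nonzero' (⟨e, hmem⟩ : LinearMap.range (Q : B →ₗ[ℂ] B))
      (by simpa using he0)).1 hrank ⟨Q v, ⟨v, rfl⟩⟩
    obtain ⟨k, hk⟩ := h1
    have hk' : k • e = Q v := congrArg Subtype.val hk
    have h3 := hℓQ v
    rw [← hk', map_smul, hℓe, smul_eq_mul, mul_one] at h3
    rw [← hk', h3, hP, ContinuousLinearMap.smulRight_apply]
  have hSe : S e = 0 := by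
    have h1 := (ev e).circleIntegral_comp_comm hci'
    have h2 : S e = (2 * (Real.pi : ℂ) * Complex.I)⁻¹ •
      ev e (∮ z in C((1 : ℂ), r), (z - 1)⁻¹ • resolvent A z) := rfl
    rw [h2, ← h1, circleIntegral.integral_congr (g := fun z => ((z - 1)⁻¹ * (z - 1)⁻¹) • e) hr.le
      fun z hz => ?_, circleIntegral.integral_smul_const, hinv2, zero_smul, smul_zero]
    change (z - 1)⁻¹ • resolvent A z e = _
    rw [hRe z hz, smul_smul]
  have hℓS : ∀ v, ℓ (S v) = 0 := by
    intro v
    have h1 := (ℓ.comp (ev v)).circleIntegral_comp_comm hci'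
    have h2 : ℓ (S v) = (2 * (Real.pi : ℂ) * Complex.I)⁻¹ *
        (ℓ.comp (ev v)) (∮ z in C((1 : ℂ), r), (z - 1)⁻¹ • resolvent A z) := by
      change ℓ ((2 * (Real.pi : ℂ) * Complex.I)⁻¹ • _) = _
      rw [map_smul]
      rfl
    rw [h2, ← h1, circleIntegral.integral_congr (g := fun z => ((z - 1)⁻¹ * (z - 1)⁻¹) • ℓ v) hr.le
      fun z hz => ?_, circleIntegral.integral_smul_const, hinv2, zero_smul, mul_zero]
    change ℓ ((z - 1)⁻¹ • resolvent A z v) = _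
    simp only [map_smul, hℓR z hz, smul_eq_mul, mul_assoc]
  have hpole : ∮ z in C((1 : ℂ), r), ((z - 1)⁻¹ • (1 : B →L[ℂ] B) - resolvent A z)
      = (2 * (Real.pi : ℂ) * Complex.I) • (1 - Q) := by
    rw [circleIntegral.integral_sub _ hci, circleIntegral.integral_smul_const, hinv, hQ,
      spectralProjection, smul_sub, smul_smul, mul_inv_cancel₀ h2πi, one_smul]
    exact (ContinuousOn.smul (ContinuousOn.inv₀ (by fun_prop) hne1)
      continuousOn_const).circleIntegrable hr.le
  have hAS : (1 - A) * S = 1 - P := by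
    have h1 := (ContinuousLinearMap.mul ℂ (B →L[ℂ] B) (1 - A)).circleIntegral_comp_comm hci'
    simp only [ContinuousLinearMap.mul_apply'] at h1
    rw [hS, mul_smul_comm, ← h1, circleIntegral.integral_congr
      (g := fun z => (z - 1)⁻¹ • (1 : B →L[ℂ] B) - resolvent A z) hr.le fun z hz => ?_, hpole,
      smul_smul, inv_mul_cancel₀ h2πi, one_smul, hQP]
    have h2 : (1 - A) * resolvent A z = 1 - (z - 1) • resolvent A z := by
      have h3 : (1 - A) = (algebraMap ℂ (B →L[ℂ] B) z - A) - (z - 1) • (1 : B →L[ℂ] B) := by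
        rw [Algebra.algebraMap_eq_smul_one, sub_smul, one_smul]
        abel
      rw [h3, sub_mul, hright z hz, smul_mul_assoc, one_mul]
    beta_reduce
    rw [mul_smul_comm, h2, smul_sub, smul_smul, inv_mul_cancel₀ (hne1 z hz), one_smul]
  have hSA : S * (1 - A) = 1 - P := by
    have h1 := ((ContinuousLinearMap.mul ℂ (B →L[ℂ] B)).flip (1 - A)).circleIntegral_comp_comm hci'
    simp only [ContinuousLinearMap.flip_apply, ContinuousLinearMap.mul_apply'] at h1
    rw [hS, smul_mul_assoc, ← h1, circleIntegral.integral_congr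
      (g := fun z => (z - 1)⁻¹ • (1 : B →L[ℂ] B) - resolvent A z) hr.le fun z hz => ?_, hpole,
      smul_smul, inv_mul_cancel₀ h2πi, one_smul, hQP]
    have h2 : resolvent A z * (1 - A) = 1 - (z - 1) • resolvent A z := by
      have h3 : (1 - A) = (algebraMap ℂ (B →L[ℂ] B) z - A) - (z - 1) • (1 : B →L[ℂ] B) := by
        rw [Algebra.algebraMap_eq_smul_one, sub_smul, one_smul]
        abel
      rw [h3, mul_sub, hleft z hz, mul_smul_comm, mul_one]
    beta_reduce
    rw [smul_mul_assoc, h2, smul_sub, smul_smul, inv_mul_cancel₀ (hne1 z hz), one_smul]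
  have hPP : P * P = P := by ext v; simp [hP, hℓe]
  have hAP : A * P = P := by ext v; simp [hP, hAe]
  have hPA : P * A = P := by ext v; simp [hP, hℓA]
  have hPS : P * S = 0 := by ext v; simp [hP, hℓS]
  have hSP : S * P = 0 := by ext v; simp [hP, hSe]
  refine ⟨⟨1 - A + P, S + P, ?_, ?_⟩, rfl⟩
  · rw [mul_add, add_mul, hAS, add_mul, sub_mul, one_mul, hAP, hPS, hPP]
    abel
  · rw [mul_add, add_mul, add_mul, hSA, mul_sub, mul_one, hPA, hSP, hPP]
    abel

end Spectral

section RankOnePerturbation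

variable {B : Type*} [NormedAddCommGroup B] [NormedSpace ℂ B]

/-- If `1 - R + ℓ ⊗ e` is boundedly invertible and `R` is close to an operator fixing `e` and `ℓ`,
the inverse of `1 - R` is within bounded distance of the rank one operator
`(1 - ℓ (R e))⁻¹ ℓ ⊗ e`. -/
theorem norm_inverse_one_sub_sub_le {R R₁ : B →L[ℂ] B} {e : B} {ℓ : B →L[ℂ] ℂ} (hℓe : ℓ e = 1)
    (hRe : R₁ e = e) (hℓR : ∀ v, ℓ (R₁ v) = ℓ v) (hT : IsUnit (1 - R))
    (hW : IsUnit (1 - R + ℓ.smulRight e)) {M η κ : ℝ} (hη0 : 0 < η) (hκ0 : 0 < κ)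
    (hM : ‖Ring.inverse (1 - R + ℓ.smulRight e)‖ ≤ M) (hη : ‖R₁ - R‖ ≤ η)
    (hκ : κ * η ≤ ‖1 - ℓ (R e)‖) (hsmall : ‖ℓ‖ * ‖e‖ * M * η ≤ κ / 2) :
    ‖Ring.inverse (1 - R) - (1 - ℓ (R e))⁻¹ • ℓ.smulRight e‖
      ≤ M + 2 * (‖ℓ‖ * ‖e‖ * M) / κ ^ 2 * (‖ℓ‖ * M * (M * ‖e‖))
        + (‖ℓ‖ * M * (M * ‖e‖) + ‖ℓ‖ * (M * ‖e‖)) / κ := by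
  set T := Ring.inverse (1 - R) with hTdef
  set W := Ring.inverse (1 - R + ℓ.smulRight e) with hWdef
  set D := R₁ - R with hD
  set N := ‖ℓ‖ with hN
  set y := ‖e‖ with hy
  have hM0 : 0 ≤ M := (norm_nonneg _).trans hM
  have hN0 : 0 ≤ N := norm_nonneg _
  have hy0 : 0 ≤ y := norm_nonneg _
  have hWn : ∀ v, ‖W v‖ ≤ M * ‖v‖ := fun v => W.le_of_opNorm_le hM v
  have hDn : ∀ v, ‖D v‖ ≤ η * ‖v‖ := fun v => D.le_of_opNorm_le hη v
  have hℓn : ∀ v, ‖ℓ v‖ ≤ N * ‖v‖ := fun v => ℓ.le_opNorm v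
  have hWl : ∀ v, W (v - R v + ℓ v • e) = v := by
    intro v
    have := DFunLike.congr_fun (Ring.inverse_mul_cancel _ hW) v
    simpa using this
  have hWr : ∀ v, W v - R (W v) + ℓ (W v) • e = v := by
    intro v
    have := DFunLike.congr_fun (Ring.mul_inverse_cancel _ hW) v
    simpa using this
  have hTr : ∀ v, T v - R (T v) = v := by
    intro v
    have := DFunLike.congr_fun (Ring.mul_inverse_cancel _ hT) v
    simpa using this
  have hWe : W e = e - W (D e) := by
    have h1 := hWl e
    rw [hℓe, one_smul] at h1
    have h2 : e - R e + e = D e + e := by simp [hD, hRe]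
    rw [h2, map_add] at h1
    rw [eq_sub_iff_add_eq, add_comm]
    exact h1
  have hℓW : ∀ v, ℓ (W v) = ℓ v - ℓ (D (W v)) := by
    intro v
    have h1 := congrArg ℓ (hWr v)
    have h2 : ℓ (D (W v)) = ℓ (W v) - ℓ (R (W v)) := by simp [hD, hℓR]
    rw [map_add, map_sub, map_smul, hℓe, smul_eq_mul, mul_one] at h1
    rw [h2, ← h1]
    ring
  have hTW : ∀ v, T v = W v + ℓ (T v) • W e := by
    intro v
    have h1 := hWl (T v)
    rw [hTr v, map_add, map_smul] at h1
    exact h1.symm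
  set g := ℓ (R e) with hg
  set x := ℓ (D (W (D e))) with hx
  have hs : 1 - ℓ (W e) = (1 - g) - x := by
    have h1 : ℓ (D e) = 1 - g := by simp [hD, hRe, hℓe, hg]
    rw [hWe, map_sub, hℓe, hℓW (D e), h1]
    ring
  have hxn : ‖x‖ ≤ N * (y * M) * η * η := by
    calc ‖x‖ ≤ N * (η * (M * (η * y))) := by
          refine (hℓn _).trans ?_
          gcongr
          refine (hDn _).trans ?_
          gcongr
          refine (hWn _).trans ?_
          gcongr
          exact hDn e
      _ = _ := by ring
  have hxs : ‖x‖ ≤ κ * η / 2 := by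
    refine hxn.trans ?_
    have := mul_le_mul_of_nonneg_right hsmall hη0.le
    nlinarith
  set s := (1 - g) - x with hsdef
  have hsn : κ * η / 2 ≤ ‖s‖ := by
    have := norm_sub_norm_le (1 - g) x
    linarith
  have hκη : 0 < κ * η := by positivity
  have hs0 : s ≠ 0 := norm_pos_iff.1 (by linarith)
  have hg0 : 1 - g ≠ 0 := norm_pos_iff.1 (by linarith)
  have hℓT : ∀ v, ℓ (T v) = s⁻¹ * ℓ (W v) := by
    intro v
    have h1 := congrArg ℓ (hTW v)
    rw [map_add, map_smul, smul_eq_mul] at h1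
    rw [eq_inv_mul_iff_mul_eq₀ hs0, ← hs]
    linear_combination h1
  have hu : ‖(1 - g)⁻¹‖ ≤ (κ * η)⁻¹ := by
    rw [norm_inv]
    exact inv_anti₀ hκη hκ
  have hsu : ‖s⁻¹ - (1 - g)⁻¹‖ ≤ 2 * (N * y * M) / κ ^ 2 := by
    have h1 : s⁻¹ - (1 - g)⁻¹ = x * (s⁻¹ * (1 - g)⁻¹) := by
      field_simp
      rw [hsdef]
      ring
    rw [h1, norm_mul, norm_mul, norm_inv]
    have h2 : ‖s‖⁻¹ ≤ (κ * η / 2)⁻¹ := inv_anti₀ (by linarith) hsn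
    calc ‖x‖ * (‖s‖⁻¹ * ‖(1 - g)⁻¹‖)
        ≤ (N * (y * M) * η * η) * ((κ * η / 2)⁻¹ * (κ * η)⁻¹) := by gcongr
      _ = _ := by field_simp
  refine ContinuousLinearMap.opNorm_le_bound _ (by positivity) fun v => ?_
  have hv0 := norm_nonneg v
  have hdec : (T - (1 - g)⁻¹ • ℓ.smulRight e) v = W v + (s⁻¹ - (1 - g)⁻¹) • (ℓ (W v) • W e)
      + (1 - g)⁻¹ • (-(ℓ (D (W v)) • W e) - ℓ v • W (D e)) := by
    have h1 : -(ℓ (D (W v)) • W e) - ℓ v • W (D e) = ℓ (W v) • W e - ℓ v • e := by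
      rw [hℓW v, sub_smul]
      have : W (D e) = e - W e := by rw [hWe]; abel
      rw [this, smul_sub]
      abel
    rw [h1]
    simp only [sub_apply, smul_apply, ContinuousLinearMap.smulRight_apply]
    rw [hTW v, hℓT v, smul_sub, sub_smul, smul_smul, smul_smul, smul_smul]
    abel
  rw [hdec]
  have hA : ‖ℓ (W v)‖ ≤ N * M * ‖v‖ := by
    calc _ ≤ N * (M * ‖v‖) := (hℓn _).trans (by gcongr; exact hWn v)
      _ = _ := by ring
  have hWe' : ‖W e‖ ≤ M * y := hWn e
  have hB : ‖(s⁻¹ - (1 - g)⁻¹) • (ℓ (W v) • W e)‖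
      ≤ 2 * (N * y * M) / κ ^ 2 * (N * M * ‖v‖ * (M * y)) := by
    rw [norm_smul, norm_smul]
    gcongr
  have hC : ‖-(ℓ (D (W v)) • W e) - ℓ v • W (D e)‖
      ≤ (N * M * (M * y) + N * (M * y)) * η * ‖v‖ := by
    have h1 : ‖ℓ (D (W v)) • W e‖ ≤ (N * (η * (M * ‖v‖))) * (M * y) := by
      rw [norm_smul]
      gcongr
      refine (hℓn _).trans ?_
      gcongr
      refine (hDn _).trans ?_
      gcongr
      exact hWn v
    have h2 : ‖ℓ v • W (D e)‖ ≤ (N * ‖v‖) * (M * (η * y)) := by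
      rw [norm_smul]
      gcongr
      · exact hℓn v
      · refine (hWn _).trans ?_
        gcongr
        exact hDn e
    calc _ ≤ ‖ℓ (D (W v)) • W e‖ + ‖ℓ v • W (D e)‖ := by
          refine (norm_sub_le _ _).trans ?_
          rw [norm_neg]
      _ ≤ (N * (η * (M * ‖v‖))) * (M * y) + (N * ‖v‖) * (M * (η * y)) := add_le_add h1 h2
      _ = _ := by ring
  have hC' : ‖(1 - g)⁻¹ • (-(ℓ (D (W v)) • W e) - ℓ v • W (D e))‖
      ≤ (N * M * (M * y) + N * (M * y)) / κ * ‖v‖ := by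
    rw [norm_smul]
    calc _ ≤ (κ * η)⁻¹ * ((N * M * (M * y) + N * (M * y)) * η * ‖v‖) := by gcongr
      _ = _ := by field_simp
  calc _ ≤ ‖W v‖ + ‖(s⁻¹ - (1 - g)⁻¹) • (ℓ (W v) • W e)‖
        + ‖(1 - g)⁻¹ • (-(ℓ (D (W v)) • W e) - ℓ v • W (D e))‖ := norm_add₃_le
    _ ≤ M * ‖v‖ + 2 * (N * y * M) / κ ^ 2 * (N * M * ‖v‖ * (M * y))
        + (N * M * (M * y) + N * (M * y)) / κ * ‖v‖ :=
        add_le_add (add_le_add (hWn v) hB) hC'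
    _ = _ := by ring

end RankOnePerturbation

section OperatorBounds

variable {B : Type*} [NormedAddCommGroup B] [NormedSpace ℂ B]

/-- Operators `bₙ` dominated by the weights `pₙ`, such that `∑ bₙ` fixes the vector `e` and the
functional `ℓ`, with the spectral properties needed for operator renewal theory. -/
structure IsRenewalFamily (p : ℕ → ℝ) (b : ℕ → B →L[ℂ] B) (e : B) (ℓ : B →L[ℂ] ℂ) (C : ℝ) :
    Prop where
  const_nonneg : 0 ≤ C
  norm_le : ∀ n, ‖b n‖ ≤ C * p n
  apply_one : ℓ e = 1
  apply_mass : ∀ n, ℓ (b n e) = p n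
  fix_vector : (∑' n, (1 : ℂ) ^ (n + 1) • b n) e = e
  fix_functional : ∀ v, ℓ ((∑' n, (1 : ℂ) ^ (n + 1) • b n) v) = ℓ v
  isUnit_add : IsUnit (1 - (∑' n, (1 : ℂ) ^ (n + 1) • b n) + ℓ.smulRight e)
  isUnit_one_sub : ∀ z : ℂ, ‖z‖ ≤ 1 → z ≠ 1 → IsUnit (1 - ∑' n, z ^ (n + 1) • b n)

variable {p τ H : ℕ → ℝ} {c q K : ℝ} {b : ℕ → B →L[ℂ] B} {e : B} {ℓ : B →L[ℂ] ℂ}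
  {C : ℝ}

namespace IsRenewalFamily

variable (hb : IsRenewalFamily p b e ℓ C) (h : IsTailExpansion p τ H c q K)
include hb h

theorem summable_norm : Summable fun n => ‖b n‖ :=
  Summable.of_nonneg_of_le (fun _ => norm_nonneg _) hb.norm_le (h.hasSum_one.summable.mul_left C)

theorem apply_series [CompleteSpace B] {z : ℂ} (hz : ‖z‖ ≤ 1) :
    ℓ ((∑' n, z ^ (n + 1) • b n) e) = ∑' n, z ^ (n + 1) • ((p n : ℝ) : ℂ) := by
  have h1 := (summable_pow_succ_smul (hb.summable_norm h) hz).hasSum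
  have h2 := (ℓ.comp (ContinuousLinearMap.apply ℂ B e)).hasSum h1
  refine (h2.tsum_eq).symm.trans (tsum_congr fun n => ?_)
  simp [hb.apply_mass]

theorem series_ne_one {z : ℂ} (hz : ‖z‖ ≤ 1) (hz1 : z ≠ 1) :
    ∑' n, z ^ (n + 1) • ((p n : ℝ) : ℂ) ≠ 1 := by
  intro hg
  have hre : HasSum (fun n => (z ^ (n + 1)).re * p n) 1 := by
    have h1 := (summable_pow_succ_smul h.summable_norm_ofReal hz).hasSum
    rw [hg] at h1
    have h2 := Complex.hasSum_re h1
    simpa using h2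
  have hsub := h.hasSum_one.sub hre
  rw [sub_self] at hsub
  have hre1 : ∀ n : ℕ, (z ^ n).re ≤ 1 := fun n => by
    refine (Complex.re_le_norm _).trans ?_
    rw [norm_pow]
    exact pow_le_one₀ (norm_nonneg _) hz
  have hnn : ∀ n, 0 ≤ p n - (z ^ (n + 1)).re * p n := fun n => by
    nlinarith [h.nonneg n, hre1 (n + 1)]
  have hzero := (hasSum_zero_iff_of_nonneg hnn).1 hsub
  have heq : ∀ n, z ^ (n + 1) • b n = (1 : ℂ) ^ (n + 1) • b n := by
    intro n
    have h1 : p n - (z ^ (n + 1)).re * p n = 0 := congrFun hzero n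
    rcases eq_or_ne (p n) 0 with h0 | h0
    · have : b n = 0 := norm_le_zero_iff.1 ((hb.norm_le n).trans (by rw [h0, mul_zero]))
      rw [this, smul_zero, smul_zero]
    · have h2 : (z ^ (n + 1)).re = 1 := by
        have : p n * (1 - (z ^ (n + 1)).re) = 0 := by linarith
        rcases mul_eq_zero.1 this with h3 | h3
        · exact absurd h3 h0
        · linarith
      have h3 : ‖z ^ (n + 1)‖ ≤ 1 := by
        rw [norm_pow]; exact pow_le_one₀ (norm_nonneg _) hz
      have h4 : z ^ (n + 1) = 1 := by
        have h5 : Complex.normSq (z ^ (n + 1)) ≤ 1 := by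
          rw [Complex.normSq_eq_norm_sq]
          exact pow_le_one₀ (norm_nonneg _) h3
        rw [Complex.normSq_apply, h2] at h5
        refine Complex.ext h2 ?_
        rw [Complex.one_im]
        nlinarith
      rw [h4, one_pow]
  have hu := hb.isUnit_one_sub z hz hz1
  rw [tsum_congr heq] at hu
  have he : (1 - ∑' n, (1 : ℂ) ^ (n + 1) • b n) e = 0 := by
    rw [sub_apply, one_apply_eq_self, hb.fix_vector, sub_self]
  have h2 := DFunLike.congr_fun (Ring.inverse_mul_cancel _ hu) e
  rw [mul_apply_eq_comp, he, map_zero, one_apply_eq_self] at h2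
  have h3 := hb.apply_one
  rw [← h2, map_zero] at h3
  exact zero_ne_one h3

variable [CompleteSpace B]

/-- The resolvent `(1 - R(z))⁻¹` differs from its singular part by a bounded function in the
disc. -/
theorem exists_norm_inverse_sub_le :
    ∃ M : ℝ, 0 ≤ M ∧ ∀ z : ℂ, ‖z‖ < 1 →
      ‖Ring.inverse (1 - ∑' n, z ^ (n + 1) • b n)
        - (1 - ∑' n, z ^ (n + 1) • ((p n : ℝ) : ℂ))⁻¹ • ℓ.smulRight e‖ ≤ M := by
  obtain ⟨κ, hκ, hκz⟩ := h.exists_logModulus_le fun z hz hz1 => hb.series_ne_one h hz hz1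
  set R : ℂ → B →L[ℂ] B := fun z => ∑' n, z ^ (n + 1) • b n with hR
  set g : ℂ → ℂ := fun z => ∑' n, z ^ (n + 1) • ((p n : ℝ) : ℂ) with hg
  set C' : ℝ := C * (1 + c * (1 + K)) + 1 with hC'
  have hC'0 : 0 < C' := by
    have := mul_nonneg hb.const_nonneg (show 0 ≤ 1 + c * (1 + K) by linarith [h.const_nonneg])
    linarith
  have hmod : ∀ z : ℂ, ‖z‖ < 1 → ‖R 1 - R z‖ ≤ C' * logModulus ‖1 - z‖ := by
    intro z hz
    have hz1 : z ≠ 1 := by rintro rfl; simp at hz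
    have hρ : 0 < ‖1 - z‖ := norm_pos_iff.2 (sub_ne_zero.2 hz1.symm)
    have hρ2 := norm_one_sub_le_two hz.le
    have := norm_tsum_sub_tsum_le h.nonneg h.hasSum_tail h.const_nonneg h.tail_zero h.tail_le
      hb.const_nonneg hb.norm_le (z := 1) (w := z) (by simp) hz.le
    refine this.trans (mul_le_mul_of_nonneg_right (by linarith) (logModulus_pos hρ hρ2).le)
  -- invertibility near `1`
  set X₁ : B →L[ℂ] B := 1 - R 1 + ℓ.smulRight e with hX₁
  set M₁ := ‖Ring.inverse X₁‖ + 1 with hM₁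
  have hM₁0 : 0 ≤ M₁ := by positivity
  have hnhds : ∀ᶠ X in nhds X₁, IsUnit X ∧ ‖Ring.inverse X‖ ≤ M₁ := by
    obtain ⟨u, hu⟩ := hb.isUnit_add
    have hu' : (u : B →L[ℂ] B) = X₁ := hu
    have hcont : ContinuousAt Ring.inverse X₁ := by
      rw [← hu']; exact NormedRing.inverse_continuousAt u
    have h1 : ∀ᶠ X in nhds X₁, ‖Ring.inverse X‖ < M₁ :=
      hcont.norm.eventually_lt_const (by simp only [hM₁]; linarith)
    have h2 : ∀ᶠ X in nhds X₁, IsUnit X := by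
      rw [← hu']; exact Units.nhds u
    filter_upwards [h1, h2] with X h3 h4
    exact ⟨h4, h3.le⟩
  obtain ⟨ε, hε, hball⟩ := Metric.eventually_nhds_iff.1 hnhds
  set Nc := ‖ℓ‖ * ‖e‖ * M₁ with hNc
  have hNc0 : 0 ≤ Nc := by positivity
  have hsmall : ∀ᶠ x in nhds (0 : ℝ), C' * logModulus x < ε ∧
      Nc * (C' * logModulus x) < κ / C' / 2 := by
    have ht : Filter.Tendsto (fun x => C' * logModulus x) (nhds 0) (nhds 0) := by
      have := (continuous_logModulus.tendsto 0).const_mul C'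
      rwa [logModulus_zero, mul_zero] at this
    have ht2 : Filter.Tendsto (fun x => Nc * (C' * logModulus x)) (nhds 0) (nhds 0) := by
      simpa using ht.const_mul Nc
    exact (ht.eventually_lt_const hε).and (ht2.eventually_lt_const (by positivity))
  obtain ⟨δ, hδ, hδs⟩ := Metric.eventually_nhds_iff.1 hsmall
  set M₂ := M₁ + 2 * (‖ℓ‖ * ‖e‖ * M₁) / (κ / C') ^ 2 * (‖ℓ‖ * M₁ * (M₁ * ‖e‖))
        + (‖ℓ‖ * M₁ * (M₁ * ‖e‖) + ‖ℓ‖ * (M₁ * ‖e‖)) / (κ / C') with hM₂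
  have hM₂0 : 0 ≤ M₂ := by positivity
  have hnear : ∀ z : ℂ, ‖z‖ < 1 → ‖1 - z‖ < δ →
      ‖Ring.inverse (1 - R z) - (1 - g z)⁻¹ • ℓ.smulRight e‖ ≤ M₂ := by
    intro z hz hzδ
    have hz1 : z ≠ 1 := by rintro rfl; simp at hz
    have hρ : 0 < ‖1 - z‖ := norm_pos_iff.2 (sub_ne_zero.2 hz1.symm)
    have hρ2 := norm_one_sub_le_two hz.le
    have hm := logModulus_pos hρ hρ2
    obtain ⟨h1, h2⟩ := hδs (y := ‖1 - z‖) (by rwa [dist_zero_right, norm_norm])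
    have h3 := hball (y := 1 - R z + ℓ.smulRight e) (by
      rw [dist_eq_norm, hX₁, show 1 - R z + ℓ.smulRight e - (1 - R 1 + ℓ.smulRight e)
        = R 1 - R z by abel]
      exact (hmod z hz).trans_lt h1)
    have hgz : ℓ (R z e) = g z := hb.apply_series h hz.le
    have := norm_inverse_one_sub_sub_le (R := R z) (R₁ := R 1) hb.apply_one hb.fix_vector
      hb.fix_functional (hb.isUnit_one_sub z hz.le hz1) h3.1 (M := M₁)
      (η := C' * logModulus ‖1 - z‖) (κ := κ / C') (by positivity) (by positivity) h3.2
      (hmod z hz) (by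
        rw [hgz]
        refine le_trans (le_of_eq ?_) (hκz z hz)
        field_simp) h2.le
    rw [hgz] at this
    exact this
  have hfar : ∃ M₃ : ℝ, ∀ z : ℂ, ‖z‖ ≤ 1 → δ ≤ ‖1 - z‖ → ‖Ring.inverse (1 - R z)‖ ≤ M₃ := by
    set s : Set ℂ := Metric.closedBall 0 1 ∩ {z | δ ≤ ‖1 - z‖} with hs
    have hsc : IsCompact s := (isCompact_closedBall _ _).inter_right
      (isClosed_le continuous_const (by fun_prop))
    have hcont : ContinuousOn (fun z : ℂ => Ring.inverse (1 - R z)) s := by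
      intro z hz
      have hz1 : z ≠ 1 := by
        rintro rfl
        have := hz.2
        simp only [Set.mem_ofPred_eq, sub_self, norm_zero] at this
        linarith
      obtain ⟨u, hu⟩ := hb.isUnit_one_sub z (by simpa using hz.1) hz1
      have h1 : ContinuousWithinAt (fun z => 1 - R z) s z :=
        (continuousOn_const.sub ((continuousOn_tsum_pow_succ_smul (hb.summable_norm h)).mono
          Set.inter_subset_left)) z hz
      have h2 : ContinuousAt Ring.inverse ((fun z => 1 - R z) z) := by
        have hu' : (u : B →L[ℂ] B) = (fun z => 1 - R z) z := hu
        rw [← hu']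
        exact NormedRing.inverse_continuousAt u
      exact ContinuousAt.comp_continuousWithinAt (f := fun z => 1 - R z) h2 h1
    obtain ⟨M₃, hM₃⟩ := hsc.exists_bound_of_continuousOn hcont
    exact ⟨M₃, fun z h1 h2 => hM₃ z ⟨by simpa using h1, h2⟩⟩
  obtain ⟨M₃, hM₃⟩ := hfar
  set P : B →L[ℂ] B := ℓ.smulRight e with hP
  refine ⟨max M₂ (M₃ + (κ * (4 * δ))⁻¹ * ‖P‖), hM₂0.trans (le_max_left _ _), fun z hz => ?_⟩
  rcases lt_or_ge ‖1 - z‖ δ with hlt | hge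
  · exact (hnear z hz hlt).trans (le_max_left _ _)
  · refine le_trans ?_ (le_max_right _ _)
    have hρ : 0 < ‖1 - z‖ := hδ.trans_le hge
    have hρ2 := norm_one_sub_le_two hz.le
    have h1 : ‖(1 - g z)⁻¹‖ ≤ (κ * (4 * δ))⁻¹ := by
      rw [norm_inv]
      refine inv_anti₀ (by positivity) (le_trans ?_ (hκz z hz))
      have := four_mul_le_logModulus hρ hρ2
      gcongr
      linarith
    calc _ ≤ ‖Ring.inverse (1 - R z)‖ + ‖(1 - g z)⁻¹ • P‖ := norm_sub_le _ _
      _ ≤ M₃ + (κ * (4 * δ))⁻¹ * ‖P‖ := by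
          rw [norm_smul]
          gcongr
          exact hM₃ z hz.le hge

end IsRenewalFamily

end OperatorBounds

section OperatorCoefficients

theorem logModulus_le_of_le {x y : ℝ} (hx : 0 ≤ x) (hxy : x ≤ y) (hy : y ≤ 2) :
    logModulus x ≤ logModulus y := by
  rcases hx.eq_or_lt with rfl | hx
  · rcases hxy.eq_or_lt with rfl | h
    · exact le_rfl
    · rw [logModulus_zero]; exact (logModulus_pos h hy).le
  · exact logModulus_mono hx hxy hy

theorem norm_inverse_sub_inverse_le {𝒜 : Type*} [NormedRing 𝒜] {X Y : 𝒜} (hX : IsUnit X)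
    (hY : IsUnit Y) {m d : ℝ} (hXm : ‖Ring.inverse X‖ ≤ m) (hYm : ‖Ring.inverse Y‖ ≤ m)
    (hd : ‖X - Y‖ ≤ d) : ‖Ring.inverse X - Ring.inverse Y‖ ≤ m * m * d := by
  have hm : 0 ≤ m := (norm_nonneg _).trans hXm
  have h1 : Ring.inverse X - Ring.inverse Y = Ring.inverse X * (Y - X) * Ring.inverse Y := by
    rw [mul_sub, Ring.inverse_mul_cancel _ hX, sub_mul, one_mul, mul_assoc,
      Ring.mul_inverse_cancel _ hY, mul_one]
  have hd0 : 0 ≤ d := (norm_nonneg _).trans hd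
  rw [h1]
  calc _ ≤ ‖Ring.inverse X‖ * ‖Y - X‖ * ‖Ring.inverse Y‖ := norm_mul₃_le
    _ ≤ m * d * m := by rw [norm_sub_rev]; gcongr
    _ = _ := by ring

/-- If an inverse is `O(1 / logModulus)` near `1`, its modulus of continuity is controlled. -/
theorem norm_inverse_series_sub_le {𝒜 : Type*} [NormedRing 𝒜] {S : ℂ → 𝒜} {m C : ℝ}
    (hU : ∀ z : ℂ, ‖z‖ < 1 → IsUnit (1 - S z)) (hm0 : 0 ≤ m) (hC : 0 ≤ C)
    (hm : ∀ z : ℂ, ‖z‖ < 1 → ‖Ring.inverse (1 - S z)‖ ≤ m / logModulus ‖1 - z‖)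
    (hmod : ∀ z w : ℂ, ‖z‖ < 1 → ‖w‖ < 1 → ‖S z - S w‖ ≤ C * logModulus ‖z - w‖)
    {z w : ℂ} {ρ t : ℝ} (hz : ‖z‖ < 1) (hw : ‖w‖ < 1) (ht : ‖z - w‖ ≤ t) (ht2 : t ≤ 2)
    (hρ : 0 < ρ) (hρz : ρ ≤ ‖1 - z‖) (hρw : ρ ≤ ‖1 - w‖) :
    ‖Ring.inverse (1 - S z) - Ring.inverse (1 - S w)‖
      ≤ m ^ 2 * C * logModulus t / logModulus ρ ^ 2 := by
  have key : ∀ x : ℂ, ‖x‖ < 1 → ρ ≤ ‖1 - x‖ → ‖Ring.inverse (1 - S x)‖ ≤ m / logModulus ρ := by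
    intro x hx hρx
    have h2 := norm_one_sub_le_two hx.le
    exact (hm x hx).trans (div_le_div_of_nonneg_left hm0 (logModulus_pos hρ (hρx.trans h2))
      (logModulus_mono hρ hρx h2))
  have h1 := norm_inverse_sub_inverse_le (hU z hz) (hU w hw) (key z hz hρz) (key w hw hρw)
    (d := C * logModulus t) (by
      rw [show 1 - S z - (1 - S w) = S w - S z by abel, norm_sub_rev]
      refine (hmod z w hz hw).trans (mul_le_mul_of_nonneg_left ?_ hC)
      exact logModulus_le_of_le (norm_nonneg _) ht ht2)
  refine h1.trans (le_of_eq ?_)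
  ring

/-- The renewal sequence of the weights `p`, where `p n` is the mass at `n + 1`. -/
def scalarRenewal (p : ℕ → ℝ) : ℕ → ℝ
  | 0 => 1
  | n + 1 => ∑ i : Fin (n + 1), scalarRenewal p (n - i) * p i

theorem scalarRenewal_succ (p : ℕ → ℝ) (n : ℕ) :
    scalarRenewal p (n + 1) = ∑ i ∈ Finset.range (n + 1), scalarRenewal p (n - i) * p i := by
  rw [scalarRenewal, Fin.sum_univ_eq_sum_range (fun i => scalarRenewal p (n - i) * p i) (n + 1)]

theorem renewal_succ {B : Type*} [NormedAddCommGroup B] [NormedSpace ℂ B] (R : ℕ → B →L[ℂ] B)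
    (n : ℕ) : renewal R (n + 1) = ∑ i ∈ Finset.range (n + 1), renewal R (n - i) * R (i + 1) := by
  rw [renewal, Fin.sum_univ_eq_sum_range (fun i => (renewal R (n - i)).comp (R (i + 1))) (n + 1)]
  rfl

namespace IsTailExpansion

variable {p τ H : ℕ → ℝ} {c q K : ℝ} (h : IsTailExpansion p τ H c q K)
include h

theorem isUnit_one_sub_series {z : ℂ} (hz : ‖z‖ < 1) :
    IsUnit (1 - ∑' n, z ^ (n + 1) • ((p n : ℝ) : ℂ)) := by
  rw [isUnit_iff_ne_zero, sub_ne_zero]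
  intro hcon
  have h1 : ‖∑' n, z ^ (n + 1) • ((p n : ℝ) : ℂ)‖ ≤ ‖z‖ * 1 := by
    refine tsum_of_norm_bounded (h.hasSum_one.mul_left ‖z‖) fun n => ?_
    rw [norm_smul, norm_pow, Complex.norm_real, Real.norm_of_nonneg (h.nonneg n), pow_succ]
    refine mul_le_mul_of_nonneg_right ?_ (h.nonneg n)
    exact mul_le_of_le_one_left (norm_nonneg _) (pow_le_one₀ (norm_nonneg _) hz.le)
  rw [← hcon, norm_one] at h1
  linarith

theorem scalarRenewal_generating_function :
    (∀ z : ℂ, ‖z‖ < 1 → HasSum (fun n => z ^ n • ((scalarRenewal p n : ℝ) : ℂ))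
      (Ring.inverse (1 - ∑' n, z ^ (n + 1) • ((p n : ℝ) : ℂ)))) ∧
      ∀ r : ℝ, 0 ≤ r → r < 1 → Summable fun n => ‖((scalarRenewal p n : ℝ) : ℂ)‖ * r ^ n := by
  refine renewal_generating_function (t := fun n => ((scalarRenewal p n : ℝ) : ℂ))
    h.summable_norm_ofReal (by simp [scalarRenewal]) (fun n => ?_)
    fun z hz => h.isUnit_one_sub_series hz
  rw [scalarRenewal_succ]
  push_cast
  rfl

theorem norm_series_sub_le {z w : ℂ} (hz : ‖z‖ < 1) (hw : ‖w‖ < 1) :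
    ‖(∑' n, z ^ (n + 1) • ((p n : ℝ) : ℂ)) - ∑' n, w ^ (n + 1) • ((p n : ℝ) : ℂ)‖
      ≤ (1 + c * (1 + K)) * logModulus ‖z - w‖ := by
  have := norm_tsum_sub_tsum_le h.nonneg h.hasSum_tail h.const_nonneg h.tail_zero h.tail_le
    zero_le_one (b := fun n => ((p n : ℝ) : ℂ)) (fun n => by
      rw [Complex.norm_real, Real.norm_of_nonneg (h.nonneg n), one_mul]) hz.le hw.le
  rwa [one_mul] at this

end IsTailExpansion

theorem logModulus_sq_ge {x ρ : ℝ} (hx : 0 < x) (hxρ : x ≤ ρ) (hρ : ρ ≤ 2) :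
    ρ ^ (3 / 2 : ℝ) * (x ^ (1 / 2 : ℝ) * (5 - Real.log x) ^ 2) ≤ logModulus ρ ^ 2 := by
  have hρ0 := hx.trans_le hxρ
  have h1 := rpow_mul_five_sub_log_mono hx hxρ hρ
  have h4 := four_le_five_sub_log hx (hxρ.trans hρ)
  have h2 := pow_le_pow_left₀ (mul_nonneg (Real.rpow_nonneg hx.le _) (by linarith)) h1 2
  have e : ∀ w : ℝ, 0 < w → (w ^ (1 / 4 : ℝ)) ^ 2 = w ^ (1 / 2 : ℝ) := fun w hw => by
    rw [← Real.rpow_natCast, ← Real.rpow_mul hw.le]; norm_num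
  rw [mul_pow, mul_pow, e x hx, e ρ hρ0] at h2
  have e2 : ρ ^ (3 / 2 : ℝ) * ρ ^ (1 / 2 : ℝ) = ρ ^ 2 := by
    rw [← Real.rpow_add hρ0, ← Real.rpow_natCast]; norm_num
  calc _ ≤ ρ ^ (3 / 2 : ℝ) * (ρ ^ (1 / 2 : ℝ) * (5 - Real.log ρ) ^ 2) := by gcongr
    _ = logModulus ρ ^ 2 := by rw [← mul_assoc, e2, logModulus, mul_pow]

theorem logModulus_pi_div_le {n : ℕ} (hn : 4 ≤ n) :
    logModulus (Real.pi / n) ≤ 24 * (Real.log n / n) := by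
  have hn0 : (0 : ℝ) < n := by positivity
  have hn4 : (4 : ℝ) ≤ n := by exact_mod_cast hn
  have hlog : 1 ≤ Real.log n := by
    rw [Real.le_log_iff_exp_le hn0]
    linarith [Real.exp_one_lt_d9]
  have hlp : 0 ≤ Real.log Real.pi := Real.log_nonneg (by linarith [Real.pi_gt_three])
  rw [logModulus, Real.log_div Real.pi_ne_zero hn0.ne']
  calc Real.pi / n * (5 - (Real.log Real.pi - Real.log n)) ≤ 4 / n * (6 * Real.log n) := by
        have := Real.pi_lt_four
        refine mul_le_mul ?_ (by linarith) ?_ (by positivity)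
        · gcongr
        · have : Real.log Real.pi ≤ Real.log 4 := Real.log_le_log Real.pi_pos Real.pi_lt_four.le
          have : Real.log 4 ≤ Real.log n := Real.log_le_log (by norm_num) hn4
          linarith
    _ = _ := by ring

namespace IsRenewalFamily

variable {B : Type*} [NormedAddCommGroup B] [NormedSpace ℂ B] [CompleteSpace B]
  {p τ H : ℕ → ℝ} {c q K : ℝ} {Rn : ℕ → B →L[ℂ] B} {e : B} {ℓ : B →L[ℂ] ℂ} {C : ℝ}

/-- The renewal operators agree with the scalar renewal sequence times the projection, up to
`O((n log n)^{-1/2})`. -/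
theorem exists_norm_renewal_sub_le (hb : IsRenewalFamily p (fun n => Rn (n + 1)) e ℓ C)
    (h : IsTailExpansion p τ H c q K) :
    ∃ K₁ : ℝ, ∀ᶠ n : ℕ in Filter.atTop,
      ‖renewal Rn n - ((scalarRenewal p n : ℝ) : ℂ) • ℓ.smulRight e‖
        ≤ K₁ * ((n : ℝ) * Real.log n) ^ (-(1 / 2) : ℝ) := by
  obtain ⟨κ, hκ, hκz⟩ := h.exists_logModulus_le fun z hz hz1 => hb.series_ne_one h hz hz1
  obtain ⟨M, hM0, hM⟩ := hb.exists_norm_inverse_sub_le h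
  obtain ⟨hu, hus⟩ := h.scalarRenewal_generating_function
  have hne : ∀ z : ℂ, ‖z‖ < 1 → z ≠ 1 := by
    rintro z hz rfl
    simp at hz
  have hUnit : ∀ z : ℂ, ‖z‖ < 1 → IsUnit (1 - ∑' n, z ^ (n + 1) • Rn (n + 1)) :=
    fun z hz => hb.isUnit_one_sub z hz.le (hne z hz)
  obtain ⟨hT, hTs⟩ := renewal_generating_function (b := fun n => Rn (n + 1)) (t := renewal Rn)
    (hb.summable_norm h) (by rw [renewal]; rfl) (renewal_succ Rn) hUnit
  set S : ℂ → B →L[ℂ] B := fun z => ∑' n, z ^ (n + 1) • Rn (n + 1) with hS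
  set g : ℂ → ℂ := fun z => ∑' n, z ^ (n + 1) • ((p n : ℝ) : ℂ) with hg
  set P : B →L[ℂ] B := ℓ.smulRight e with hP
  set c₁ := 1 + c * (1 + K) with hc₁
  have hc₁0 : 0 ≤ c₁ := by linarith [h.const_nonneg]
  have hρ0 : ∀ z : ℂ, ‖z‖ < 1 → 0 < ‖1 - z‖ := fun z hz =>
    norm_pos_iff.2 (sub_ne_zero.2 (hne z hz).symm)
  have hκm : ∀ z : ℂ, ‖z‖ < 1 → ‖Ring.inverse (1 - g z)‖ ≤ κ⁻¹ / logModulus ‖1 - z‖ := by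
    intro z hz
    have h1 := logModulus_pos (hρ0 z hz) (norm_one_sub_le_two hz.le)
    rw [Ring.inverse_eq_inv', norm_inv, div_eq_mul_inv, ← mul_inv]
    exact inv_anti₀ (by positivity) (hκz z hz)
  set m := 10 * M + κ⁻¹ * ‖P‖ with hm
  have hm0 : 0 ≤ m := by positivity
  have hTm : ∀ z : ℂ, ‖z‖ < 1 → ‖Ring.inverse (1 - S z)‖ ≤ m / logModulus ‖1 - z‖ := by
    intro z hz
    have h1 := logModulus_pos (hρ0 z hz) (norm_one_sub_le_two hz.le)
    have h10 := logModulus_le_ten (hρ0 z hz) (norm_one_sub_le_two hz.le)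
    have h2 := hM z hz
    have h3 := hκm z hz
    rw [Ring.inverse_eq_inv'] at h3
    have h4 : ‖Ring.inverse (1 - S z)‖ ≤ M + ‖(1 - g z)⁻¹ • P‖ := by
      have := norm_le_norm_add_norm_sub ((1 - g z)⁻¹ • P) (Ring.inverse (1 - S z))
      rw [norm_sub_rev] at this
      have h2' : ‖Ring.inverse (1 - S z) - (1 - g z)⁻¹ • P‖ ≤ M := h2
      linarith
    rw [norm_smul] at h4
    rw [le_div_iff₀ h1]
    rw [le_div_iff₀ h1] at h3
    have h5 := mul_le_mul_of_nonneg_right h4 h1.le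
    have h6 := mul_le_mul_of_nonneg_right h3 (norm_nonneg P)
    have h7 := mul_le_mul_of_nonneg_left h10 hM0
    nlinarith
  set M₄ := m ^ 2 * (C * c₁) + κ⁻¹ ^ 2 * c₁ * ‖P‖ with hM₄
  have hCc : 0 ≤ C * c₁ := mul_nonneg hb.const_nonneg hc₁0
  have hM₄0 : 0 ≤ M₄ := by positivity
  have hf : ∀ z : ℂ, ‖z‖ < 1 → HasSum
      (fun n => z ^ n • (renewal Rn n - ((scalarRenewal p n : ℝ) : ℂ) • P))
      (Ring.inverse (1 - S z) - Ring.inverse (1 - g z) • P) := by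
    intro z hz
    refine ((hT z hz).sub ((hu z hz).smul_const P)).congr_fun fun n => ?_
    rw [smul_sub, smul_assoc]
  have ha : ∀ r : ℝ, 0 ≤ r → r < 1 →
      Summable fun n => ‖renewal Rn n - ((scalarRenewal p n : ℝ) : ℂ) • P‖ * r ^ n := by
    intro r hr hr1
    refine Summable.of_nonneg_of_le (fun n => by positivity) (fun n => ?_)
      ((hTs r hr hr1).add ((hus r hr hr1).mul_right ‖P‖))
    calc _ ≤ (‖renewal Rn n‖ + ‖((scalarRenewal p n : ℝ) : ℂ)‖ * ‖P‖) * r ^ n := by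
          gcongr
          refine (norm_sub_le _ _).trans ?_
          rw [norm_smul]
      _ = _ := by ring
  have hdiff : ∀ (z w : ℂ) (ρ t : ℝ), ‖z‖ < 1 → ‖w‖ < 1 → ‖z - w‖ ≤ t → t ≤ 2 → 0 < ρ →
      ρ ≤ ‖1 - z‖ → ρ ≤ ‖1 - w‖ →
      ‖(Ring.inverse (1 - S z) - Ring.inverse (1 - g z) • P)
        - (Ring.inverse (1 - S w) - Ring.inverse (1 - g w) • P)‖
        ≤ M₄ * logModulus t / logModulus ρ ^ 2 := by
    intro z w ρ t hz hw ht ht2 hρ hρz hρw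
    have h1 := norm_inverse_series_sub_le (S := S) hUnit hm0 hCc hTm (fun z w hz hw =>
      norm_tsum_sub_tsum_le h.nonneg h.hasSum_tail h.const_nonneg h.tail_zero h.tail_le
        hb.const_nonneg hb.norm_le hz.le hw.le) hz hw ht ht2 hρ hρz hρw
    have h2 := norm_inverse_series_sub_le (S := g) (fun z hz => h.isUnit_one_sub_series hz)
      (inv_nonneg.2 hκ.le) hc₁0 hκm (fun z w hz hw => h.norm_series_sub_le hz hw) hz hw ht ht2 hρ
      hρz hρw
    have e1 : (Ring.inverse (1 - S z) - Ring.inverse (1 - g z) • P)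
        - (Ring.inverse (1 - S w) - Ring.inverse (1 - g w) • P)
        = (Ring.inverse (1 - S z) - Ring.inverse (1 - S w))
          - (Ring.inverse (1 - g z) - Ring.inverse (1 - g w)) • P := by
      rw [sub_smul]; abel
    rw [e1]
    refine (norm_sub_le _ _).trans ?_
    rw [norm_smul]
    have h3 := mul_le_mul_of_nonneg_right h2 (norm_nonneg P)
    refine (add_le_add h1 h3).trans (le_of_eq ?_)
    rw [hM₄]
    ring
  refine ⟨100 * (M + M₄ * 288), ?_⟩
  have hcast := tendsto_natCast_atTop_atTop (R := ℝ)
  have hev1 : ∀ᶠ n : ℕ in Filter.atTop, Real.log n ≤ (64 * Real.pi ^ 2)⁻¹ * n := by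
    have := (Real.isLittleO_log_id_atTop.comp_tendsto hcast).bound
      (show (0 : ℝ) < (64 * Real.pi ^ 2)⁻¹ by positivity)
    filter_upwards [this] with n hn
    simp only [Function.comp, id, Real.norm_eq_abs, Nat.abs_cast] at hn
    exact (le_abs_self _).trans hn
  filter_upwards [hev1, Filter.eventually_ge_atTop 4] with n hn1 hn4
  have hn0 : (0 : ℝ) < n := by positivity
  have hn4' : (4 : ℝ) ≤ n := by exact_mod_cast hn4
  have hlog : 1 ≤ Real.log n := by
    rw [Real.le_log_iff_exp_le hn0]
    linarith [Real.exp_one_lt_d9]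
  have hlog0 : 0 < Real.log n := by linarith
  set A := ((n : ℝ) * Real.log n) ^ (-(1 / 2) : ℝ) with hA
  have hnl : 0 < (n : ℝ) * Real.log n := by positivity
  have hA0 : 0 < A := Real.rpow_pos_of_pos hnl _
  have hAsq : A * A = ((n : ℝ) * Real.log n)⁻¹ := by
    rw [hA, ← Real.rpow_add hnl, ← Real.rpow_neg_one]
    norm_num
  have hA1 : A ≤ 1 := by
    refine Real.rpow_le_one_of_one_le_of_nonpos ?_ (by norm_num)
    nlinarith
  have hnA : 8 * (Real.pi / n) ≤ A := by
    refine abs_le_of_sq_le_sq' ?_ hA0.le |>.2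
    rw [sq A, hAsq, le_inv_comm₀ (by positivity) hnl]
    calc (n : ℝ) * Real.log n ≤ n * ((64 * Real.pi ^ 2)⁻¹ * n) := by gcongr
      _ = ((8 * (Real.pi / n)) ^ 2)⁻¹ := by field_simp; norm_num
  have hx0 : 0 < A / 8 := by positivity
  have hlA : Real.log n / 2 ≤ 5 - Real.log (A / 8) := by
    rw [Real.log_div hA0.ne' (by norm_num), hA, Real.log_rpow hnl, Real.log_mul hn0.ne' hlog0.ne']
    have h1 : 0 ≤ Real.log (Real.log n) := Real.log_nonneg hlog
    have h2 : 0 ≤ Real.log 8 := Real.log_nonneg (by norm_num)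
    linarith
  set Q := (A / 8) ^ (1 / 2 : ℝ) * (5 - Real.log (A / 8)) ^ 2 with hQ
  have hQ0 : 0 < Q := by
    have : 0 < 5 - Real.log (A / 8) := by linarith
    positivity
  have hπn : Real.pi / n ≤ 2 := by linarith
  have hLπ : 0 < logModulus (Real.pi / n) := logModulus_pos (by positivity) hπn
  have hmain := norm_coeff_le hf ha (ε := 1) (C := M) (M := M₄ * logModulus (Real.pi / n) / Q)
    one_pos le_rfl hM0 (by positivity) (by omega : 1 ≤ n) hA1 hnA
    (fun z hz => by
      rw [sub_self, Real.rpow_zero, mul_one, Ring.inverse_eq_inv']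
      exact hM z hz)
    (fun z w ρ hz hw hzw hAρ hρ1 hρz hρw => by
      have hρp : 0 < ρ := hx0.trans_le hAρ
      refine (hdiff z w ρ _ hz hw hzw hπn hρp hρz hρw).trans ?_
      have h1 := logModulus_sq_ge hx0 hAρ (by linarith)
      rw [Real.rpow_neg hρp.le, ← div_eq_mul_inv, div_div]
      refine div_le_div_of_nonneg_left (by positivity) (by positivity) ?_
      rw [mul_comm]
      exact h1)
  refine hmain.trans ?_
  rw [div_one, Real.rpow_one, mul_assoc]
  refine mul_le_mul_of_nonneg_left ?_ (by norm_num)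
  rw [add_mul M]
  refine add_le_add le_rfl ?_
  have hA8 : (1 / 3) * A ^ (1 / 2 : ℝ) ≤ (A / 8) ^ (1 / 2 : ℝ) := by
    rw [show A / 8 = (1 / 8) * A by ring, Real.mul_rpow (by norm_num) hA0.le]
    gcongr
    rw [← Real.sqrt_eq_rpow]
    exact Real.le_sqrt_of_sq_le (by norm_num)
  have hQge : (1 / 3) * A ^ (1 / 2 : ℝ) * (Real.log n / 2) ^ 2 ≤ Q := by
    rw [hQ]
    gcongr
  have hAh : A ^ (1 / 2 : ℝ) * A ^ (1 / 2 : ℝ) = A := by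
    rw [← Real.rpow_add hA0]; norm_num
  have hAp : 0 < A ^ (1 / 2 : ℝ) := Real.rpow_pos_of_pos hA0 _
  have hAA : (1 : ℝ) / (n * Real.log n) = A * A := by rw [hAsq, one_div]
  calc M₄ * logModulus (Real.pi / n) / Q * A ^ (-(1 / 2) : ℝ)
      ≤ M₄ * (24 * (Real.log n / n)) / ((1 / 3) * A ^ (1 / 2 : ℝ) * (Real.log n / 2) ^ 2)
        * A ^ (-(1 / 2) : ℝ) := by
        have := logModulus_pi_div_le hn4
        gcongr
    _ = M₄ * 288 * (1 / (n * Real.log n)) / (A ^ (1 / 2 : ℝ) * A ^ (1 / 2 : ℝ)) := by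
        rw [Real.rpow_neg hA0.le]
        field_simp
        ring
    _ = M₄ * 288 * A := by
        rw [hAh, hAA]
        field_simp

end IsRenewalFamily

end OperatorCoefficients

section ReferenceSequence

/-- The Taylor coefficients of `(1 - z)^(s - 1)` at `0`. -/
def powCoeff (s : ℝ) (n : ℕ) : ℝ := ∏ k ∈ Finset.range n, (1 - s / (k + 1))

theorem continuous_powCoeff (n : ℕ) : Continuous fun s => powCoeff s n := by
  unfold powCoeff; fun_prop

theorem powCoeff_succ (s : ℝ) (n : ℕ) :
    powCoeff s (n + 1) = powCoeff s n * (1 - s / (n + 1)) := Finset.prod_range_succ _ _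

theorem powCoeff_mem {s : ℝ} (hs : 0 ≤ s) (hs1 : s ≤ 1) (n : ℕ) :
    0 ≤ powCoeff s n ∧ powCoeff s n ≤ 1 := by
  have h1 : ∀ k : ℕ, 0 ≤ 1 - s / ((k : ℝ) + 1) := fun k => by
    rw [sub_nonneg, div_le_one (by positivity)]
    linarith [(Nat.cast_nonneg k : (0 : ℝ) ≤ k)]
  refine ⟨Finset.prod_nonneg fun k _ => h1 k, Finset.prod_le_one (fun k _ => h1 k) fun k _ => ?_⟩
  have : 0 ≤ s / ((k : ℝ) + 1) := by positivity
  linarith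

theorem choose_eq_powCoeff (s : ℝ) (n : ℕ) :
    Ring.choose ((1 - s : ℂ) + n - 1) n = ((powCoeff s n : ℝ) : ℂ) := by
  have h1 : Ring.choose ((1 - s : ℂ) + n - 1) n = Ring.multichoose (1 - s : ℂ) n := by
    rw [Ring.choose]
    congr 1
    ring
  have h2 := Ring.factorial_nsmul_multichoose_eq_ascPochhammer (1 - s : ℂ) n
  rw [h1]
  have h3 : (ascPochhammer ℕ n).smeval (1 - s : ℂ) = n.factorial • ((powCoeff s n : ℝ) : ℂ) := by
    clear h1 h2
    induction n with
    | zero => simp [powCoeff]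
    | succ n ih =>
      rw [ascPochhammer_succ_right, Polynomial.smeval_mul, ih, powCoeff_succ, Nat.factorial_succ]
      have hn : ((n : ℂ) + 1) ≠ 0 := by exact_mod_cast Nat.succ_ne_zero n
      simp only [Polynomial.smeval_add, Polynomial.smeval_X, pow_one, Polynomial.smeval_natCast,
        pow_zero, nsmul_eq_mul, mul_one]
      push_cast
      field_simp
      ring
  rw [h3, nsmul_eq_mul, nsmul_eq_mul] at h2
  exact mul_left_cancel₀ (by exact_mod_cast n.factorial_ne_zero) h2

theorem hasSum_powCoeff (s : ℝ) {z : ℂ} (hz : ‖z‖ < 1) :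
    HasSum (fun n => z ^ n * ((powCoeff s n : ℝ) : ℂ)) ((1 - z) ^ ((s : ℂ) - 1)) := by
  have h1 := (Complex.one_div_one_sub_cpow_hasFPowerSeriesOnBall_zero (1 - s : ℂ)).hasSum (y := z)
    (by simpa [Metric.mem_eball, edist_zero_right, enorm_eq_nnnorm] using (by exact_mod_cast hz))
  rw [zero_add, one_div, ← Complex.cpow_neg, neg_sub] at h1
  refine h1.congr_fun fun n => ?_
  simp [FormalMultilinearSeries.ofScalars, choose_eq_powCoeff, mul_comm]

/-- `∫₀¹ e^{-as} (Taylor coefficient of (1 - z)^(s - 1)) ds`. -/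
def refCoeff (a : ℝ) (n : ℕ) : ℝ := ∫ s in (0 : ℝ)..1, Real.exp (-(a * s)) * powCoeff s n

/-- `∫₀¹ e^{-as} (1 - z)^(s - 1) ds`. -/
def refFun (a : ℝ) (z : ℂ) : ℂ :=
  ∫ s in (0 : ℝ)..1, ((Real.exp (-(a * s)) : ℝ) : ℂ) * (1 - z) ^ ((s : ℂ) - 1)

theorem neg_mul_le_abs (a : ℝ) {s : ℝ} (hs : 0 ≤ s) (hs1 : s ≤ 1) : -(a * s) ≤ |a| := by
  have h1 := neg_abs_le a
  have h2 := abs_nonneg a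
  nlinarith

theorem exp_neg_mul_le_exp_abs (a : ℝ) {s : ℝ} (hs : 0 ≤ s) (hs1 : s ≤ 1) :
    Real.exp (-(a * s)) ≤ Real.exp |a| := Real.exp_le_exp.2 (neg_mul_le_abs a hs hs1)

theorem hasSum_refFun (a : ℝ) {z : ℂ} (hz : ‖z‖ < 1) :
    HasSum (fun n => z ^ n • ((refCoeff a n : ℝ) : ℂ)) (refFun a z) := by
  have key : HasSum (fun n => ∫ s in (0 : ℝ)..1,
      ((Real.exp (-(a * s)) : ℝ) : ℂ) * (z ^ n * ((powCoeff s n : ℝ) : ℂ))) (refFun a z) := by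
    refine intervalIntegral.hasSum_integral_of_dominated_convergence
      (fun n _ => Real.exp |a| * ‖z‖ ^ n) (fun n => ?_) (fun n => ?_) ?_ ?_ ?_
    · have := continuous_powCoeff n
      exact Continuous.aestronglyMeasurable (by fun_prop)
    · refine Filter.Eventually.of_forall fun s hs => ?_
      rw [Set.uIoc_of_le zero_le_one] at hs
      obtain ⟨h1, h2⟩ := powCoeff_mem hs.1.le hs.2 n
      rw [norm_mul, norm_mul, norm_pow, Complex.norm_real, Complex.norm_real,
        Real.norm_of_nonneg (Real.exp_pos _).le, Real.norm_of_nonneg h1]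
      exact mul_le_mul (exp_neg_mul_le_exp_abs a hs.1.le hs.2)
        (mul_le_of_le_one_right (by positivity) h2) (by positivity) (Real.exp_pos _).le
    · exact Filter.Eventually.of_forall fun s _ =>
        (summable_geometric_of_lt_one (norm_nonneg _) hz).mul_left _
    · exact intervalIntegrable_const
    · exact Filter.Eventually.of_forall fun s _ => (hasSum_powCoeff s hz).mul_left _
  refine key.congr_fun fun n => ?_
  rw [refCoeff, ← intervalIntegral.integral_ofReal, smul_eq_mul,
    ← intervalIntegral.integral_const_mul]
  refine intervalIntegral.integral_congr fun s _ => ?_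
  push_cast
  ring

theorem abs_refCoeff_le (a : ℝ) (n : ℕ) : |refCoeff a n| ≤ Real.exp |a| := by
  have := intervalIntegral.norm_integral_le_of_norm_le_const (a := 0) (b := 1)
    (C := Real.exp |a|) (f := fun s => Real.exp (-(a * s)) * powCoeff s n) fun s hs => by
      rw [Set.uIoc_of_le zero_le_one] at hs
      obtain ⟨h1, h2⟩ := powCoeff_mem hs.1.le hs.2 n
      rw [norm_mul, Real.norm_of_nonneg (Real.exp_pos _).le, Real.norm_of_nonneg h1]
      exact (mul_le_of_le_one_right (Real.exp_pos _).le h2).trans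
        (exp_neg_mul_le_exp_abs a hs.1.le hs.2)
  simpa [refCoeff] using this

theorem refFun_eq (a : ℝ) {z : ℂ} (hz : ‖z‖ < 1) (hw : -Complex.log (1 - z) + a ≠ 0) :
    refFun a z = (1 - z)⁻¹ * (-Complex.log (1 - z) + a)⁻¹
      - Complex.exp (-a) * (-Complex.log (1 - z) + a)⁻¹ := by
  have hz1 : 1 - z ≠ 0 := by
    rw [sub_ne_zero]; rintro rfl; simp at hz
  set w := -Complex.log (1 - z) + a with hwdef
  have h1 : refFun a z = ∫ s in (0 : ℝ)..1, (1 - z)⁻¹ * Complex.exp (-w * s) := by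
    rw [refFun]
    refine intervalIntegral.integral_congr fun s _ => ?_
    rw [Complex.cpow_sub _ _ hz1, Complex.cpow_one, Complex.cpow_def_of_ne_zero hz1, hwdef]
    push_cast
    rw [mul_div_assoc', ← Complex.exp_add, div_eq_inv_mul]
    congr 2
    ring
  have h2 : Complex.exp (-w) = (1 - z) * Complex.exp (-a) := by
    rw [hwdef, neg_add, neg_neg, Complex.exp_add, Complex.exp_log hz1]
  rw [h1, intervalIntegral.integral_const_mul, integral_exp_mul_complex (neg_ne_zero.2 hw)]
  push_cast
  rw [mul_one, mul_zero, Complex.exp_zero, h2]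
  field_simp
  ring

theorem norm_refFun_le (a : ℝ) {z : ℂ} (hz : ‖z‖ < 1) :
    ‖refFun a z‖ ≤ Real.exp |a| * (2 / ‖1 - z‖) := by
  have hz1 : 1 - z ≠ 0 := by
    rw [sub_ne_zero]; rintro rfl; simp at hz
  have hρ : 0 < ‖1 - z‖ := norm_pos_iff.2 hz1
  have hρ2 := norm_one_sub_le_two hz.le
  have := intervalIntegral.norm_integral_le_of_norm_le_const (a := 0) (b := 1)
    (C := Real.exp |a| * (2 / ‖1 - z‖))
    (f := fun s : ℝ => ((Real.exp (-(a * s)) : ℝ) : ℂ) * (1 - z) ^ ((s : ℂ) - 1)) fun s hs => by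
      rw [Set.uIoc_of_le zero_le_one] at hs
      rw [norm_mul, Complex.norm_real, Real.norm_of_nonneg (Real.exp_pos _).le,
        Complex.cpow_sub _ _ hz1, Complex.cpow_one, norm_div, Complex.norm_cpow_real]
      gcongr
      · exact neg_mul_le_abs a hs.1.le hs.2
      · calc ‖1 - z‖ ^ s ≤ 2 ^ s := Real.rpow_le_rpow hρ.le hρ2 hs.1.le
          _ ≤ 2 ^ (1 : ℝ) := Real.rpow_le_rpow_of_exponent_le (by norm_num) hs.2
          _ = 2 := by norm_num
  simpa [refFun] using this

theorem norm_cpow_sub_cpow_le {x y : ℂ} {ρ s : ℝ} (hs : 0 ≤ s) (hs1 : s ≤ 1) (hx : 0 < x.re)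
    (hy : 0 < y.re) (hρ : 0 < ρ) (hρ1 : ρ ≤ 1) (hρx : ρ ≤ ‖x‖) (hρy : ρ ≤ ‖y‖)
    (hxy : ‖x - y‖ ≤ ρ) :
    ‖x ^ ((s : ℂ) - 1) - y ^ ((s : ℂ) - 1)‖ ≤ 4 / ρ ^ 2 * ‖x - y‖ := by
  have hre : ∀ v ∈ segment ℝ y x, 0 < v.re := by
    intro v hv
    have hc : Convex ℝ {v : ℂ | 0 < v.re} := convex_halfSpace_re_gt 0
    exact hc.segment_subset hy hx hv
  have hnorm : ∀ v ∈ segment ℝ y x, ρ / 2 ≤ ‖v‖ := by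
    intro v hv
    have h1 := dist_add_dist_of_mem_segment hv
    rw [dist_eq_norm, dist_eq_norm, dist_eq_norm, norm_sub_rev y x] at h1
    have h2 := norm_sub_norm_le y (y - v)
    have h3 := norm_sub_norm_le x (x - v)
    rw [sub_sub_cancel] at h2 h3
    rw [norm_sub_rev v x] at h1
    linarith
  have hslit : ∀ v ∈ segment ℝ y x, v ∈ Complex.slitPlane := fun v hv => Or.inl (hre v hv)
  refine Convex.norm_image_sub_le_of_norm_hasDerivWithin_le (𝕜 := ℂ)
    (f := fun v : ℂ => v ^ ((s : ℂ) - 1)) (f' := fun v => ((s : ℂ) - 1) * v ^ ((s : ℂ) - 1 - 1))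
    (s := segment ℝ y x) (fun v hv => ?_) (fun v hv => ?_) (convex_segment y x)
    (left_mem_segment ℝ y x) (right_mem_segment ℝ y x)
  · have := (hasDerivAt_id v).cpow_const (c := (s : ℂ) - 1) (hslit v hv)
    simpa using this.hasDerivWithinAt
  · have hv0 : 0 < ‖v‖ := lt_of_lt_of_le (by positivity) (hnorm v hv)
    have e : ((s : ℂ) - 1 - 1) = ((s - 2 : ℝ) : ℂ) := by push_cast; ring
    have e1 : ((s : ℂ) - 1) = ((s - 1 : ℝ) : ℂ) := by push_cast; ring
    rw [norm_mul, e, Complex.norm_cpow_real, e1, Complex.norm_real, Real.norm_eq_abs]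
    have h1 : |s - 1| ≤ 1 := abs_le.2 ⟨by linarith, by linarith⟩
    have h2 : ‖v‖ ^ (s - 2) ≤ 4 / ρ ^ 2 := by
      calc ‖v‖ ^ (s - 2) ≤ (ρ / 2) ^ (s - 2) :=
            Real.rpow_le_rpow_of_nonpos (by positivity) (hnorm v hv) (by linarith)
        _ ≤ (ρ / 2) ^ (-2 : ℝ) :=
            Real.rpow_le_rpow_of_exponent_ge (by positivity) (by linarith) (by linarith)
        _ = 4 / ρ ^ 2 := by
            rw [Real.rpow_neg (by positivity), Real.rpow_ofNat, div_pow, inv_div]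
            norm_num
    calc |s - 1| * ‖v‖ ^ (s - 2) ≤ 1 * (4 / ρ ^ 2) := by gcongr
      _ = _ := one_mul _

theorem norm_refFun_sub_le (a : ℝ) {z w : ℂ} {ρ : ℝ} (hz : ‖z‖ < 1) (hw : ‖w‖ < 1) (hρ : 0 < ρ)
    (hρ1 : ρ ≤ 1) (hρz : ρ ≤ ‖1 - z‖) (hρw : ρ ≤ ‖1 - w‖) (hzw : ‖z - w‖ ≤ ρ) :
    ‖refFun a z - refFun a w‖ ≤ Real.exp |a| * (4 / ρ ^ 2 * ‖z - w‖) := by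
  have hcont : ∀ x : ℂ, ‖x‖ < 1 → Continuous fun s : ℝ =>
      ((Real.exp (-(a * s)) : ℝ) : ℂ) * (1 - x) ^ ((s : ℂ) - 1) := by
    intro x hx
    have hx1 : 1 - x ≠ 0 := by
      rw [sub_ne_zero]; rintro rfl; simp at hx
    have : Continuous fun s : ℝ => (1 - x) ^ ((s : ℂ) - 1) :=
      Continuous.const_cpow (by fun_prop) (Or.inl hx1)
    fun_prop
  have hre : ∀ x : ℂ, ‖x‖ < 1 → 0 < (1 - x).re := by
    intro x hx
    have := (Complex.re_le_norm x).trans_lt hx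
    rw [Complex.sub_re, Complex.one_re]
    linarith
  rw [refFun, refFun, ← intervalIntegral.integral_sub ((hcont z hz).intervalIntegrable _ _)
    ((hcont w hw).intervalIntegrable _ _)]
  have := intervalIntegral.norm_integral_le_of_norm_le_const (a := 0) (b := 1)
    (C := Real.exp |a| * (4 / ρ ^ 2 * ‖z - w‖))
    (f := fun s : ℝ => ((Real.exp (-(a * s)) : ℝ) : ℂ) * (1 - z) ^ ((s : ℂ) - 1)
      - ((Real.exp (-(a * s)) : ℝ) : ℂ) * (1 - w) ^ ((s : ℂ) - 1)) fun s hs => by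
      rw [Set.uIoc_of_le zero_le_one] at hs
      have e : ‖1 - z - (1 - w)‖ = ‖z - w‖ := by
        rw [show 1 - z - (1 - w) = -(z - w) by ring, norm_neg]
      rw [← mul_sub, norm_mul, Complex.norm_real, Real.norm_of_nonneg (Real.exp_pos _).le, ← e]
      gcongr
      · exact neg_mul_le_abs a hs.1.le hs.2
      · exact norm_cpow_sub_cpow_le hs.1.le hs.2 (hre z hz) (hre w hw) hρ hρ1 hρz hρw (by rwa [e])
  simpa using this

theorem sum_inv_sq_le_two (n : ℕ) : ∑ k ∈ Finset.range n, (((k : ℝ) + 1) ^ 2)⁻¹ ≤ 2 := by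
  have h : ∀ n : ℕ, ∑ k ∈ Finset.range (n + 1), (((k : ℝ) + 1) ^ 2)⁻¹ ≤ 2 - ((n : ℝ) + 1)⁻¹ := by
    intro n
    induction n with
    | zero => norm_num
    | succ n ih =>
      rw [Finset.sum_range_succ]
      have h1 : (((n + 1 : ℕ) : ℝ) + 1) = (n : ℝ) + 2 := by push_cast; ring
      rw [h1]
      have h2 : (((n : ℝ) + 2) ^ 2)⁻¹ ≤ ((n : ℝ) + 1)⁻¹ - ((n : ℝ) + 2)⁻¹ := by
        rw [inv_sub_inv (by positivity) (by positivity), ← one_div, div_le_div_iff₀ (by positivity) (by positivity)]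
        nlinarith
      linarith
  cases n with
  | zero => simp
  | succ n =>
    have := h n
    have h2 : (0 : ℝ) ≤ ((n : ℝ) + 1)⁻¹ := by positivity
    linarith

theorem one_sub_sum_le_prod {x : ℕ → ℝ} (hx : ∀ k, 0 ≤ x k) (hx1 : ∀ k, x k ≤ 1) (n : ℕ) :
    1 - ∑ k ∈ Finset.range n, x k ≤ ∏ k ∈ Finset.range n, (1 - x k) := by
  induction n with
  | zero => simp
  | succ n ih =>
    rw [Finset.sum_range_succ, Finset.prod_range_succ]
    have h1 : ∏ k ∈ Finset.range n, (1 - x k) ≤ 1 :=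
      Finset.prod_le_one (fun k _ => by linarith [hx1 k]) fun k _ => by linarith [hx k]
    nlinarith [hx n]

theorem powCoeff_bounds {s : ℝ} (hs : 0 ≤ s) (hs1 : s ≤ 1) (n : ℕ) :
    Real.exp (-(s * ∑ k ∈ Finset.range n, ((k : ℝ) + 1)⁻¹)) * (1 - 2 * s ^ 2) ≤ powCoeff s n ∧
      powCoeff s n ≤ Real.exp (-(s * ∑ k ∈ Finset.range n, ((k : ℝ) + 1)⁻¹)) := by
  have hexp : Real.exp (-(s * ∑ k ∈ Finset.range n, ((k : ℝ) + 1)⁻¹))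
      = ∏ k ∈ Finset.range n, Real.exp (-(s / ((k : ℝ) + 1))) := by
    rw [← Real.exp_sum, Finset.mul_sum, ← Finset.sum_neg_distrib]
    simp [div_eq_mul_inv]
  have hx0 : ∀ k : ℕ, 0 ≤ s / ((k : ℝ) + 1) := fun k => by positivity
  have hx1 : ∀ k : ℕ, s / ((k : ℝ) + 1) ≤ 1 := fun k => by
    rw [div_le_one (by positivity)]
    linarith [(Nat.cast_nonneg k : (0 : ℝ) ≤ k)]
  have hsq1 : ∀ k : ℕ, (s / ((k : ℝ) + 1)) ^ 2 ≤ 1 := fun k => pow_le_one₀ (hx0 k) (hx1 k)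
  constructor
  · have h1 : 1 - 2 * s ^ 2 ≤ ∏ k ∈ Finset.range n, (1 - (s / ((k : ℝ) + 1)) ^ 2) := by
      refine le_trans ?_ (one_sub_sum_le_prod (x := fun k => (s / ((k : ℝ) + 1)) ^ 2)
        (fun k => by positivity) hsq1 n)
      have h2 : ∑ k ∈ Finset.range n, (s / ((k : ℝ) + 1)) ^ 2
          = s ^ 2 * ∑ k ∈ Finset.range n, (((k : ℝ) + 1) ^ 2)⁻¹ := by
        rw [Finset.mul_sum]
        exact Finset.sum_congr rfl fun k _ => by rw [div_pow, div_eq_mul_inv]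
      rw [h2]
      nlinarith [sum_inv_sq_le_two n, sq_nonneg s]
    refine (mul_le_mul_of_nonneg_left h1 (Real.exp_pos _).le).trans ?_
    rw [hexp, ← Finset.prod_mul_distrib, powCoeff]
    refine Finset.prod_le_prod (fun k _ => mul_nonneg (Real.exp_pos _).le (by linarith [hsq1 k]))
      fun k _ => ?_
    set x := s / ((k : ℝ) + 1)
    have h3 : Real.exp (-x) * (1 + x) ≤ 1 := by
      rw [Real.exp_neg, inv_mul_le_one₀ (Real.exp_pos _), add_comm]
      exact Real.add_one_le_exp x
    have h4 : 0 ≤ 1 - x := by linarith [hx1 k]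
    nlinarith
  · rw [hexp, powCoeff]
    refine Finset.prod_le_prod (fun k _ => by linarith [hx1 k]) fun k _ => ?_
    exact Real.one_sub_le_exp_neg _

theorem integral_exp_neg_mul {b : ℝ} (hb : b ≠ 0) :
    ∫ s in (0 : ℝ)..1, Real.exp (-(b * s)) = (1 - Real.exp (-b)) / b := by
  have h1 : ∀ s : ℝ, HasDerivAt (fun s => -(Real.exp (-(b * s)) / b)) (Real.exp (-(b * s))) s := by
    intro s
    have h2 : HasDerivAt (fun s => -(b * s)) (-b) s := by
      have h4 := ((hasDerivAt_id' s).const_mul b).neg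
      rw [mul_one] at h4
      exact h4
    have h3 := (h2.exp.div_const b).neg
    refine h3.congr_deriv ?_
    field_simp
  rw [intervalIntegral.integral_eq_sub_of_hasDerivAt (fun s _ => h1 s)
    (Continuous.intervalIntegrable (by fun_prop) _ _)]
  simp
  ring

/-- The reference sequence is `1 / (a + Hₙ)` up to a third order error, with `Hₙ` the harmonic
numbers. -/
theorem abs_refCoeff_sub_le (a : ℝ) (n : ℕ)
    (hpos : 0 < a + ∑ k ∈ Finset.range n, ((k : ℝ) + 1)⁻¹) :
    |refCoeff a n - (a + ∑ k ∈ Finset.range n, ((k : ℝ) + 1)⁻¹)⁻¹|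
      ≤ 34 / (a + ∑ k ∈ Finset.range n, ((k : ℝ) + 1)⁻¹) ^ 3 := by
  set S := ∑ k ∈ Finset.range n, ((k : ℝ) + 1)⁻¹ with hS
  set b := a + S with hb
  have hc := continuous_powCoeff n
  have hsq : ∀ x : ℝ, 0 ≤ x → x ^ 2 ≤ 2 * Real.exp x := by
    intro x hx
    have := Real.quadratic_le_exp_of_nonneg hx
    nlinarith
  have hpt : ∀ s ∈ Set.uIoc (0 : ℝ) 1, |Real.exp (-(a * s)) * powCoeff s n - Real.exp (-(b * s))|
      ≤ 16 / b ^ 2 * Real.exp (-(b / 2 * s)) := by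
    intro s hs
    rw [Set.uIoc_of_le zero_le_one] at hs
    obtain ⟨h1, h2⟩ := powCoeff_bounds hs.1.le hs.2 n
    rw [← hS] at h1 h2
    have he : Real.exp (-(b * s)) = Real.exp (-(a * s)) * Real.exp (-(s * S)) := by
      rw [← Real.exp_add]; congr 1; rw [hb]; ring
    have h3 : |Real.exp (-(a * s)) * powCoeff s n - Real.exp (-(b * s))|
        ≤ Real.exp (-(b * s)) * (2 * s ^ 2) := by
      rw [he, ← mul_sub, abs_mul, abs_of_pos (Real.exp_pos _), mul_assoc]
      refine mul_le_mul_of_nonneg_left ?_ (Real.exp_pos _).le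
      rw [abs_le]
      have h4 := Real.exp_pos (-(s * S))
      constructor
      · linarith
      · have : 0 ≤ Real.exp (-(s * S)) * (2 * s ^ 2) := by positivity
        linarith
    refine h3.trans ?_
    have h5 : Real.exp (-(b * s)) = Real.exp (-(b / 2 * s)) * Real.exp (-(b / 2 * s)) := by
      rw [← Real.exp_add]; congr 1; ring
    have h6 := hsq (b / 2 * s) (by have := hs.1; positivity)
    have h7 : Real.exp (-(b / 2 * s)) * (b / 2 * s) ^ 2 ≤ 2 := by
      rw [Real.exp_neg, inv_mul_le_iff₀ (Real.exp_pos _), mul_comm _ (2 : ℝ)]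
      exact h6
    have h8 : Real.exp (-(b / 2 * s)) * (2 * s ^ 2) ≤ 16 / b ^ 2 := by
      rw [le_div_iff₀ (by positivity)]
      nlinarith
    rw [h5, mul_assoc, mul_comm]
    exact mul_le_mul_of_nonneg_right h8 (Real.exp_pos _).le
  have hint : |refCoeff a n - (1 - Real.exp (-b)) / b|
      ≤ ∫ s in (0 : ℝ)..1, 16 / b ^ 2 * Real.exp (-(b / 2 * s)) := by
    rw [refCoeff, ← integral_exp_neg_mul hpos.ne', ← intervalIntegral.integral_sub
      (Continuous.intervalIntegrable (by fun_prop) _ _)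
      (Continuous.intervalIntegrable (by fun_prop) _ _), ← Real.norm_eq_abs]
    refine intervalIntegral.norm_integral_le_of_norm_le zero_le_one
      (Filter.Eventually.of_forall fun s hs => ?_)
      (Continuous.intervalIntegrable (by fun_prop) _ _)
    rw [Real.norm_eq_abs]
    exact hpt s (by rwa [Set.uIoc_of_le zero_le_one])
  rw [intervalIntegral.integral_const_mul, integral_exp_neg_mul (by positivity)] at hint
  have h9 : 16 / b ^ 2 * ((1 - Real.exp (-(b / 2))) / (b / 2)) ≤ 32 / b ^ 3 := by
    have : 16 / b ^ 2 * ((1 - Real.exp (-(b / 2))) / (b / 2))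
        = 32 / b ^ 3 * (1 - Real.exp (-(b / 2))) := by field_simp; ring
    rw [this]
    exact mul_le_of_le_one_right (by positivity) (by linarith [Real.exp_pos (-(b / 2))])
  have h10 : Real.exp (-b) / b ≤ 2 / b ^ 3 := by
    rw [div_le_div_iff₀ hpos (by positivity), Real.exp_neg]
    have h11 := hsq b hpos.le
    rw [inv_mul_le_iff₀ (Real.exp_pos _)]
    nlinarith
  have e : refCoeff a n - b⁻¹ = (refCoeff a n - (1 - Real.exp (-b)) / b) - Real.exp (-b) / b := by
    field_simp
    ring
  rw [e]
  refine (abs_sub _ _).trans ?_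
  rw [abs_of_pos (show 0 < Real.exp (-b) / b by positivity)]
  have : 34 / b ^ 3 = 32 / b ^ 3 + 2 / b ^ 3 := by ring
  linarith

end ReferenceSequence

section ScalarAsymptotics

theorem eventually_log_pow_le_rpow (k : ℕ) {s : ℝ} (hs : 0 < s) :
    ∀ᶠ n : ℕ in Filter.atTop, Real.log n ^ k ≤ (n : ℝ) ^ s := by
  have := ((isLittleO_log_rpow_rpow_atTop (k : ℝ) hs).comp_tendsto
    (tendsto_natCast_atTop_atTop (R := ℝ))).bound one_pos
  filter_upwards [this] with n hn
  simp only [Function.comp, Real.norm_eq_abs, one_mul, Real.rpow_natCast] at hn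
  exact (le_abs_self _).trans (hn.trans_eq (abs_of_nonneg (by positivity)))

namespace IsTailExpansion

variable {p τ H : ℕ → ℝ} {c q K : ℝ} (h : IsTailExpansion p τ H c q K)
include h

/-- Near `1`, the generating function of the renewal sequence agrees with the reference function up
to an integrable power. -/
theorem exists_norm_inverse_sub_refFun_le (hne : ∀ z : ℂ, ‖z‖ ≤ 1 → z ≠ 1 →
      ∑' n, z ^ (n + 1) • ((p n : ℝ) : ℂ) ≠ 1) :
    ∃ ε C : ℝ, 0 < ε ∧ ε ≤ 1 ∧ 0 ≤ C ∧ ∀ z : ℂ, ‖z‖ < 1 →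
      ‖Ring.inverse (1 - ∑' n, z ^ (n + 1) • ((p n : ℝ) : ℂ))
        - (c : ℂ)⁻¹ * refFun (c⁻¹ + ∑' n, H (n + 1)) z‖ ≤ C * ‖1 - z‖ ^ (ε - 1) := by
  obtain ⟨κ, hκ, hκz⟩ := h.exists_logModulus_le hne
  obtain ⟨ε, hε, hε1, hεq⟩ : ∃ ε : ℝ, 0 < ε ∧ ε ≤ 1 ∧ ε < q - 1 := by
    have := h.one_lt_q
    exact ⟨min 1 ((q - 1) / 2), lt_min one_pos (by linarith), min_le_left _ _,
      (min_le_right _ _).trans_lt (by linarith)⟩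
  set a : ℝ := c⁻¹ + ∑' n, H (n + 1) with ha
  set K₂ : ℝ := 2 * ∑' n : ℕ, |H (n + 1)| * ((n + 1 : ℕ) : ℝ) ^ ε with hK₂
  have hK₂0 : 0 ≤ K₂ := by
    have : 0 ≤ ∑' n : ℕ, |H (n + 1)| * ((n + 1 : ℕ) : ℝ) ^ ε := tsum_nonneg fun n => by positivity
    positivity
  have hc := h.c_pos
  have hc' : (c : ℂ) ≠ 0 := by exact_mod_cast hc.ne'
  set δ : ℝ := Real.exp (-(|a| + K₂ + 1)) with hδ
  have hδ0 : 0 < δ := Real.exp_pos _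
  have hδ1 : δ ≤ 1 := Real.exp_le_one_iff.2 (by linarith [abs_nonneg a])
  set g : ℂ → ℂ := fun z => ∑' n, z ^ (n + 1) • ((p n : ℝ) : ℂ) with hg
  set C₁ := c⁻¹ * (K₂ + Real.exp (-a)) with hC₁
  set C₂ := 2 * ((κ * (4 * δ))⁻¹ + c⁻¹ * (Real.exp |a| * (2 / δ))) with hC₂
  have hC₁0 : 0 ≤ C₁ := by positivity
  refine ⟨ε, max C₁ C₂, hε, hε1, hC₁0.trans (le_max_left _ _), fun z hz => ?_⟩
  have hz1 : 1 - z ≠ 0 := by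
    rw [sub_ne_zero]; rintro rfl; simp at hz
  have hρ : 0 < ‖1 - z‖ := norm_pos_iff.2 hz1
  have hρ2 := norm_one_sub_le_two hz.le
  have hρε : 0 ≤ ‖1 - z‖ ^ (ε - 1) := Real.rpow_nonneg hρ.le _
  rw [Ring.inverse_eq_inv']
  rcases lt_or_ge ‖1 - z‖ δ with hlt | hge
  · refine le_trans ?_ (mul_le_mul_of_nonneg_right (le_max_left _ _) hρε)
    have hρ1 : ‖1 - z‖ ≤ 1 := hlt.le.trans hδ1
    have hlog : |a| + K₂ + 1 ≤ -Real.log ‖1 - z‖ := by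
      have := Real.log_le_log hρ hlt.le
      rw [hδ, Real.log_exp] at this
      linarith
    have h1 := h.norm_H_series_le hε hε1 hεq hz.le
    have h2 : ‖1 - z‖ ^ ε ≤ 1 := Real.rpow_le_one hρ.le hρ1 hε.le
    have h3 := mul_le_mul_of_nonneg_left h2 hK₂0
    have h4 := neg_log_norm_le_norm_neg_log (1 - z)
    have hgz := h.one_sub_series_eq hz
    set L := -Complex.log (1 - z) with hL
    set Z := ∑' n, (z ^ (n + 1) - 1) * ((H (n + 1) : ℝ) : ℂ) with hZ
    set w := L + (a : ℂ) with hw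
    have hwn : ‖L‖ - |a| ≤ ‖w‖ := by
      have := norm_sub_norm_le L (-(a : ℂ))
      rw [norm_neg (a : ℂ), sub_neg_eq_add, Complex.norm_real, Real.norm_eq_abs] at this
      exact this
    have hwZ : ‖w‖ - ‖Z‖ ≤ ‖w + Z‖ := by
      have := norm_sub_norm_le w (-Z)
      rwa [norm_neg, sub_neg_eq_add] at this
    have hw1 : 1 ≤ ‖w‖ := by linarith
    have hwZ1 : 1 ≤ ‖w + Z‖ := by linarith
    have hw0 : w ≠ 0 := norm_pos_iff.1 (by linarith)
    have hwZ0 : w + Z ≠ 0 := norm_pos_iff.1 (by linarith)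
    rw [hgz, refFun_eq a hz hw0]
    have e : (↑c * (1 - z) * (w + Z))⁻¹ - (c : ℂ)⁻¹ * ((1 - z)⁻¹ * w⁻¹ - Complex.exp (-a) * w⁻¹)
        = (c : ℂ)⁻¹ * (-(Z * (1 - z)⁻¹ * (w⁻¹ * (w + Z)⁻¹)) + Complex.exp (-a) * w⁻¹) := by
      field_simp
      ring
    rw [e, norm_mul, norm_inv, Complex.norm_real, Real.norm_of_nonneg hc.le, hC₁, mul_assoc c⁻¹]
    refine mul_le_mul_of_nonneg_left ?_ (inv_nonneg.2 hc.le)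
    refine (norm_add_le _ _).trans ?_
    rw [norm_neg, norm_mul, norm_mul, norm_mul, norm_mul, norm_inv, norm_inv, norm_inv]
    have hw1' : ‖w‖⁻¹ ≤ 1 := inv_le_one_of_one_le₀ hw1
    have hwZ1' : ‖w + Z‖⁻¹ ≤ 1 := inv_le_one_of_one_le₀ hwZ1
    have hexp : ‖Complex.exp (-a)‖ = Real.exp (-a) := by
      rw [Complex.norm_exp]; simp
    have hone : 1 ≤ ‖1 - z‖ ^ (ε - 1) :=
      Real.one_le_rpow_of_pos_of_le_one_of_nonpos hρ hρ1 (by linarith)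
    have h5 : ‖Z‖ * ‖1 - z‖⁻¹ ≤ K₂ * ‖1 - z‖ ^ (ε - 1) := by
      rw [Real.rpow_sub hρ, Real.rpow_one, div_eq_mul_inv, ← mul_assoc]
      exact mul_le_mul_of_nonneg_right h1 (by positivity)
    have h6 : ‖w‖⁻¹ * ‖w + Z‖⁻¹ ≤ 1 := mul_le_one₀ hw1' (by positivity) hwZ1'
    have h7 : ‖Z‖ * ‖1 - z‖⁻¹ * (‖w‖⁻¹ * ‖w + Z‖⁻¹) ≤ K₂ * ‖1 - z‖ ^ (ε - 1) :=
      (mul_le_of_le_one_right (by positivity) h6).trans h5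
    have h8 : ‖Complex.exp (-a)‖ * ‖w‖⁻¹ ≤ Real.exp (-a) * ‖1 - z‖ ^ (ε - 1) := by
      rw [hexp]
      exact mul_le_mul_of_nonneg_left (hw1'.trans hone) (Real.exp_pos _).le
    rw [add_mul]
    exact add_le_add h7 h8
  · refine le_trans ?_ (mul_le_mul_of_nonneg_right (le_max_right _ _) hρε)
    have h1 : ‖(1 - g z)⁻¹‖ ≤ (κ * (4 * δ))⁻¹ := by
      rw [norm_inv]
      refine inv_anti₀ (by positivity) (le_trans ?_ (hκz z hz))
      have := four_mul_le_logModulus hρ hρ2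
      gcongr
      linarith
    have h2 : ‖(c : ℂ)⁻¹ * refFun a z‖ ≤ c⁻¹ * (Real.exp |a| * (2 / δ)) := by
      rw [norm_mul, norm_inv, Complex.norm_real, Real.norm_of_nonneg hc.le]
      refine mul_le_mul_of_nonneg_left ((norm_refFun_le a hz).trans ?_) (by positivity)
      gcongr
    have hhalf : 1 / 2 ≤ ‖1 - z‖ ^ (ε - 1) := by
      calc (1 / 2 : ℝ) = 2 ^ (-1 : ℝ) := by rw [Real.rpow_neg_one]; norm_num
        _ ≤ 2 ^ (ε - 1) := Real.rpow_le_rpow_of_exponent_le (by norm_num) (by linarith)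
        _ ≤ ‖1 - z‖ ^ (ε - 1) := Real.rpow_le_rpow_of_nonpos hρ hρ2 (by linarith)
    have h3 := (norm_sub_le ((1 - g z)⁻¹) ((c : ℂ)⁻¹ * refFun a z)).trans (add_le_add h1 h2)
    refine h3.trans ?_
    have h0 : 0 ≤ (κ * (4 * δ))⁻¹ + c⁻¹ * (Real.exp |a| * (2 / δ)) := by positivity
    rw [hC₂]
    nlinarith

/-- The scalar renewal sequence agrees with the reference sequence up to `O((log n)⁻³)`. -/
theorem exists_abs_scalarRenewal_sub_le (hne : ∀ z : ℂ, ‖z‖ ≤ 1 → z ≠ 1 →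
      ∑' n, z ^ (n + 1) • ((p n : ℝ) : ℂ) ≠ 1) :
    ∃ K₂ : ℝ, ∀ᶠ n : ℕ in Filter.atTop,
      |scalarRenewal p n - c⁻¹ * refCoeff (c⁻¹ + ∑' n, H (n + 1)) n| ≤ K₂ / Real.log n ^ 3 := by
  obtain ⟨κ, hκ, hκz⟩ := h.exists_logModulus_le hne
  obtain ⟨ε, C, hε, hε1, hC, hCz⟩ := h.exists_norm_inverse_sub_refFun_le hne
  obtain ⟨hu, hus⟩ := h.scalarRenewal_generating_function
  have hc := h.c_pos
  set a : ℝ := c⁻¹ + ∑' n, H (n + 1) with ha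
  set g : ℂ → ℂ := fun z => ∑' n, z ^ (n + 1) • ((p n : ℝ) : ℂ) with hg
  set c₁ := 1 + c * (1 + K) with hc₁
  have hc₁0 : 0 ≤ c₁ := by linarith [h.const_nonneg]
  have hκm : ∀ z : ℂ, ‖z‖ < 1 → ‖Ring.inverse (1 - g z)‖ ≤ κ⁻¹ / logModulus ‖1 - z‖ := by
    intro z hz
    have hz1 : 1 - z ≠ 0 := by
      rw [sub_ne_zero]; rintro rfl; simp at hz
    have h1 := logModulus_pos (norm_pos_iff.2 hz1) (norm_one_sub_le_two hz.le)
    rw [Ring.inverse_eq_inv', norm_inv, div_eq_mul_inv, ← mul_inv]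
    exact inv_anti₀ (by positivity) (hκz z hz)
  have hf : ∀ z : ℂ, ‖z‖ < 1 → HasSum
      (fun n => z ^ n • (((scalarRenewal p n - c⁻¹ * refCoeff a n : ℝ)) : ℂ))
      (Ring.inverse (1 - g z) - (c : ℂ)⁻¹ * refFun a z) := by
    intro z hz
    refine ((hu z hz).sub ((hasSum_refFun a hz).mul_left (c : ℂ)⁻¹)).congr_fun fun n => ?_
    simp only [smul_eq_mul]
    push_cast
    ring
  have hs : ∀ r : ℝ, 0 ≤ r → r < 1 → Summable fun n =>
      ‖(((scalarRenewal p n - c⁻¹ * refCoeff a n : ℝ)) : ℂ)‖ * r ^ n := by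
    intro r hr hr1
    refine Summable.of_nonneg_of_le (fun n => by positivity) (fun n => ?_)
      ((hus r hr hr1).add ((summable_geometric_of_lt_one hr hr1).mul_left (c⁻¹ * Real.exp |a|)))
    rw [← add_mul]
    refine mul_le_mul_of_nonneg_right ?_ (by positivity)
    rw [Complex.norm_real, Complex.norm_real, Real.norm_eq_abs, Real.norm_eq_abs]
    refine (abs_sub _ _).trans (add_le_add le_rfl ?_)
    rw [abs_mul, abs_of_pos (inv_pos.2 hc)]
    exact mul_le_mul_of_nonneg_left (abs_refCoeff_le a n) (by positivity)
  set M₅ := κ⁻¹ ^ 2 * c₁ + c⁻¹ * (Real.exp |a| * 4) with hM₅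
  have hM₅0 : 0 ≤ M₅ := by positivity
  refine ⟨100 / ε * (C + M₅ * 72), ?_⟩
  filter_upwards [eventually_log_pow_le_rpow 3 (show 0 < ε / 2 by positivity),
    eventually_log_pow_le_rpow 4 (show (0 : ℝ) < 1 / 2 by norm_num),
    Filter.eventually_ge_atTop 1024] with n hl1 hl2 hn
  have hn' : (1024 : ℝ) ≤ n := by exact_mod_cast hn
  have hn0 : (0 : ℝ) < n := by linarith
  have hlog : 1 ≤ Real.log n := by
    rw [Real.le_log_iff_exp_le hn0]
    linarith [Real.exp_one_lt_d9]
  have hlog0 : 0 < Real.log n := by linarith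
  set A := (n : ℝ) ^ (-(1 / 2) : ℝ) with hA
  have hA0 : 0 < A := Real.rpow_pos_of_pos hn0 _
  have hA1 : A ≤ 1 := Real.rpow_le_one_of_one_le_of_nonpos (by linarith) (by norm_num)
  have hAsq : A * A = (n : ℝ)⁻¹ := by
    rw [hA, ← Real.rpow_add hn0, ← Real.rpow_neg_one]
    norm_num
  have hnA : 8 * (Real.pi / n) ≤ A := by
    refine abs_le_of_sq_le_sq' ?_ hA0.le |>.2
    rw [sq A, hAsq, mul_pow, div_pow, ← one_div, mul_div_assoc', div_le_div_iff₀ (by positivity) hn0]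
    have := Real.pi_lt_d2
    have h3 := Real.pi_pos
    have : Real.pi ^ 2 ≤ 10 := by nlinarith
    nlinarith
  have hπ0 := Real.pi_pos
  have hx0 : 0 < A / 8 := by positivity
  have hπA : Real.pi / n ≤ A / 8 := by linarith
  have hπn : Real.pi / n ≤ 2 := by linarith
  have hLπ : 0 < logModulus (Real.pi / n) := logModulus_pos (by positivity) hπn
  have hLπ4 := four_mul_le_logModulus (show 0 < Real.pi / n by positivity) hπn
  have hπn0 : 0 < Real.pi / n := by positivity
  have hmain := norm_coeff_le hf hs (ε := ε) (C := C)
    (M := M₅ * logModulus (Real.pi / n) * (A / 8) ^ (-(1 / 2) : ℝ))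
    hε hε1 hC (by positivity) (by omega : 1 ≤ n) hA1 hnA hCz
    (fun z w ρ hz hw hzw hAρ hρ1 hρz hρw => by
      have hρp : 0 < ρ := hx0.trans_le hAρ
      have h1 := norm_inverse_series_sub_le (S := g) (fun z hz => h.isUnit_one_sub_series hz)
        (inv_nonneg.2 hκ.le) hc₁0 hκm (fun z w hz hw => h.norm_series_sub_le hz hw) hz hw hzw hπn
        hρp hρz hρw
      have h2 := norm_refFun_sub_le a hz hw hρp hρ1 hρz hρw (by linarith)
      have e1 : (Ring.inverse (1 - g z) - (c : ℂ)⁻¹ * refFun a z)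
          - (Ring.inverse (1 - g w) - (c : ℂ)⁻¹ * refFun a w)
          = (Ring.inverse (1 - g z) - Ring.inverse (1 - g w))
            - (c : ℂ)⁻¹ * (refFun a z - refFun a w) := by ring
      rw [e1]
      have h3 : κ⁻¹ ^ 2 * c₁ * logModulus (Real.pi / n) / logModulus ρ ^ 2
          ≤ κ⁻¹ ^ 2 * c₁ * logModulus (Real.pi / n) / ρ ^ 2 := by
        have := four_mul_le_logModulus hρp (by linarith)
        gcongr
        linarith
      have h4 : ‖(c : ℂ)⁻¹ * (refFun a z - refFun a w)‖
          ≤ c⁻¹ * (Real.exp |a| * (4 / ρ ^ 2 * logModulus (Real.pi / n))) := by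
        rw [norm_mul, norm_inv, Complex.norm_real, Real.norm_of_nonneg hc.le]
        refine mul_le_mul_of_nonneg_left (h2.trans ?_) (by positivity)
        gcongr
        linarith
      have h5 : (ρ ^ 2)⁻¹ ≤ (A / 8) ^ (-(1 / 2) : ℝ) * ρ ^ (-(3 / 2) : ℝ) := by
        have e2 : (ρ ^ 2)⁻¹ = ρ ^ (-(1 / 2) : ℝ) * ρ ^ (-(3 / 2) : ℝ) := by
          rw [← Real.rpow_add hρp, ← Real.rpow_natCast, ← Real.rpow_neg hρp.le]
          norm_num
        rw [e2]
        exact mul_le_mul_of_nonneg_right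
          (Real.rpow_le_rpow_of_nonpos hx0 hAρ (by norm_num)) (by positivity)
      calc _ ≤ κ⁻¹ ^ 2 * c₁ * logModulus (Real.pi / n) / ρ ^ 2
            + c⁻¹ * (Real.exp |a| * (4 / ρ ^ 2 * logModulus (Real.pi / n))) :=
            (norm_sub_le _ _).trans (add_le_add (h1.trans h3) h4)
        _ = M₅ * logModulus (Real.pi / n) * (ρ ^ 2)⁻¹ := by rw [hM₅]; ring
        _ ≤ M₅ * logModulus (Real.pi / n) * ((A / 8) ^ (-(1 / 2) : ℝ) * ρ ^ (-(3 / 2) : ℝ)) := by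
            gcongr
        _ = _ := by ring)
  rw [Complex.norm_real, Real.norm_eq_abs] at hmain
  refine hmain.trans ?_
  rw [mul_div_assoc, add_div]
  refine mul_le_mul_of_nonneg_left ?_ (by positivity)
  have hl3 : 0 < Real.log n ^ 3 := by positivity
  have hA8 : (A / 8) ^ (-(1 / 2) : ℝ) * A ^ (-(1 / 2) : ℝ) ≤ 3 * (n : ℝ) ^ (1 / 2 : ℝ) := by
    have e1 : A ^ (-(1 / 2) : ℝ) * A ^ (-(1 / 2) : ℝ) = (n : ℝ) ^ (1 / 2 : ℝ) := by
      rw [← Real.rpow_add hA0, hA, ← Real.rpow_mul hn0.le]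
      norm_num
    have e2 : (A / 8) ^ (-(1 / 2) : ℝ) ≤ 3 * A ^ (-(1 / 2) : ℝ) := by
      rw [show A / 8 = (1 / 8) * A by ring, Real.mul_rpow (by norm_num) hA0.le]
      refine mul_le_mul_of_nonneg_right ?_ (by positivity)
      rw [one_div, Real.inv_rpow (by norm_num), Real.rpow_neg (by norm_num), inv_inv,
        ← Real.sqrt_eq_rpow, Real.sqrt_le_left (by norm_num)]
      norm_num
    calc _ ≤ 3 * A ^ (-(1 / 2) : ℝ) * A ^ (-(1 / 2) : ℝ) :=
          mul_le_mul_of_nonneg_right e2 (by positivity)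
      _ = _ := by rw [mul_assoc, e1]
  refine add_le_add ?_ ?_
  · rw [div_eq_mul_inv]
    refine mul_le_mul_of_nonneg_left ?_ hC
    have e3 : A ^ ε = ((n : ℝ) ^ (ε / 2))⁻¹ := by
      rw [hA, ← Real.rpow_mul hn0.le, ← Real.rpow_neg hn0.le]
      congr 1
      ring
    rw [e3]
    exact inv_anti₀ hl3 hl1
  · have h24 := logModulus_pi_div_le (show 4 ≤ n by omega)
    have e4 : (n : ℝ) ^ (1 / 2 : ℝ) * (n : ℝ) ^ (1 / 2 : ℝ) = n := by
      rw [← Real.rpow_add hn0]; norm_num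
    have hn12 : 0 < (n : ℝ) ^ (1 / 2 : ℝ) := Real.rpow_pos_of_pos hn0 _
    calc M₅ * logModulus (Real.pi / n) * (A / 8) ^ (-(1 / 2) : ℝ) * A ^ (-(1 / 2) : ℝ)
        = M₅ * logModulus (Real.pi / n) * ((A / 8) ^ (-(1 / 2) : ℝ) * A ^ (-(1 / 2) : ℝ)) := by ring
      _ ≤ M₅ * (24 * (Real.log n / n)) * (3 * (n : ℝ) ^ (1 / 2 : ℝ)) := by gcongr
      _ = M₅ * 72 * (Real.log n * (n : ℝ) ^ (1 / 2 : ℝ) / n) := by ring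
      _ ≤ M₅ * 72 * (1 / Real.log n ^ 3) := by
          refine mul_le_mul_of_nonneg_left ?_ (by positivity)
          rw [div_le_div_iff₀ hn0 hl3, one_mul]
          calc Real.log n * (n : ℝ) ^ (1 / 2 : ℝ) * Real.log n ^ 3
              = Real.log n ^ 4 * (n : ℝ) ^ (1 / 2 : ℝ) := by ring
            _ ≤ (n : ℝ) ^ (1 / 2 : ℝ) * (n : ℝ) ^ (1 / 2 : ℝ) := by gcongr
            _ = n := e4
      _ = _ := by ring

end IsTailExpansion

end ScalarAsymptotics

section TailConstant

theorem measurable_tailCorrection (c : ℝ) (H : ℕ → ℝ) : Measurable (tailCorrection c H) := by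
  unfold tailCorrection
  refine Measurable.ite measurableSet_Iio measurable_const ?_
  have h1 : Measurable fun x : ℝ => ((⌊x⌋₊ : ℝ))⁻¹ :=
    (measurable_of_countable fun n : ℕ => ((n : ℝ))⁻¹).comp Nat.measurable_floor
  have h2 : Measurable fun x : ℝ => H ⌊x⌋₊ := (measurable_of_countable H).comp Nat.measurable_floor
  exact (h1.sub measurable_inv).add h2

theorem integral_tailCorrection_unit (c : ℝ) (H : ℕ → ℝ) (k : ℕ) :
    ∫ x in ((k + 1 : ℕ) : ℝ)..((k + 1 + 1 : ℕ) : ℝ), tailCorrection c H x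
      = ((k + 1 : ℕ) : ℝ)⁻¹ + H (k + 1)
        - (Real.log ((k + 1 + 1 : ℕ) : ℝ) - Real.log ((k + 1 : ℕ) : ℝ)) := by
  have hk : (0 : ℝ) < ((k + 1 : ℕ) : ℝ) := by positivity
  have hk1 : (1 : ℝ) ≤ ((k + 1 : ℕ) : ℝ) := by push_cast; linarith [(Nat.cast_nonneg k : (0 : ℝ) ≤ k)]
  have hle : ((k + 1 : ℕ) : ℝ) ≤ ((k + 1 + 1 : ℕ) : ℝ) := by push_cast; linarith
  have h0 : (0 : ℝ) ∉ Set.uIcc ((k + 1 : ℕ) : ℝ) ((k + 1 + 1 : ℕ) : ℝ) := by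
    rw [Set.uIcc_of_le hle, Set.mem_Icc]
    push Not
    intro h
    linarith
  have h1 : ∫ x in ((k + 1 : ℕ) : ℝ)..((k + 1 + 1 : ℕ) : ℝ), tailCorrection c H x
      = ∫ x in ((k + 1 : ℕ) : ℝ)..((k + 1 + 1 : ℕ) : ℝ),
        ((((k + 1 : ℕ) : ℝ)⁻¹ + H (k + 1)) - x⁻¹) := by
    refine intervalIntegral.integral_congr_Ioo_of_le hle fun x hx => ?_
    have hfl : ⌊x⌋₊ = k + 1 := by
      rw [Nat.floor_eq_iff (hk.le.trans hx.1.le)]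
      refine ⟨hx.1.le, ?_⟩
      have := hx.2
      push_cast at this ⊢
      exact this
    have hx1 : ¬ x < 1 := not_lt.2 (hk1.trans hx.1.le)
    rw [tailCorrection, if_neg hx1, hfl]
    ring
  rw [h1, intervalIntegral.integral_sub intervalIntegrable_const
    (intervalIntegral.intervalIntegrable_inv (fun x hx hx0 => h0 (hx0 ▸ hx)) continuousOn_id), integral_inv h0,
    Real.log_div (by positivity) hk.ne', intervalIntegral.integral_const]
  push_cast
  rw [smul_eq_mul]
  ring

theorem integral_tailCorrection_zero_one (c : ℝ) (H : ℕ → ℝ) :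
    ∫ x in (0 : ℝ)..1, tailCorrection c H x = c⁻¹ := by
  have h1 : ∫ x in (0 : ℝ)..1, tailCorrection c H x = ∫ x in (0 : ℝ)..1, c⁻¹ := by
    refine intervalIntegral.integral_congr_Ioo_of_le zero_le_one fun x hx => ?_
    rw [tailCorrection, if_pos hx.2, one_div]
  rw [h1]
  simp

namespace IsTailExpansion

variable {p τ H : ℕ → ℝ} {c q K : ℝ} (h : IsTailExpansion p τ H c q K)
include h

theorem integrableOn_tailCorrection : IntegrableOn (tailCorrection c H) (Set.Ioi 0) := by
  have h1 : IntegrableOn (tailCorrection c H) (Set.Ioo 0 1) := by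
    refine (integrableOn_const (C := 1 / c) (by simp)).congr_fun (fun x hx => ?_) measurableSet_Ioo
    rw [tailCorrection, if_pos hx.2]
  have h2 : IntegrableOn (tailCorrection c H) (Set.Ici 1) := by
    rw [integrableOn_Ici_iff_integrableOn_Ioi]
    have hq := h.one_lt_q
    have hd1 : IntegrableOn (fun x : ℝ => 2 * x ^ (-2 : ℝ)) (Set.Ioi 1) :=
      (integrableOn_Ioi_rpow_of_lt (by norm_num) one_pos).const_mul 2
    have hd2 : IntegrableOn (fun x : ℝ => K * 2 ^ q * x ^ (-q)) (Set.Ioi 1) :=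
      (integrableOn_Ioi_rpow_of_lt (by linarith) one_pos).const_mul _
    refine Integrable.mono' (hd1.add hd2) (measurable_tailCorrection c H).aestronglyMeasurable ?_
    filter_upwards [ae_restrict_mem measurableSet_Ioi] with x hx
    have hx1 : (1 : ℝ) < x := hx
    have hx0 : (0 : ℝ) < x := by linarith
    have hm1 : 1 ≤ ⌊x⌋₊ := Nat.one_le_floor_iff x |>.2 hx1.le
    set m := ⌊x⌋₊ with hm
    have hm0 : (0 : ℝ) < m := by exact_mod_cast hm1
    have hm1' : (1 : ℝ) ≤ m := by exact_mod_cast hm1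
    have hmx : (m : ℝ) ≤ x := Nat.floor_le hx0.le
    have hxm : x < m + 1 := Nat.lt_floor_add_one x
    have hmx2 : x / 2 ≤ m := by linarith
    rw [tailCorrection, if_neg (not_lt.2 hx1.le), ← hm]
    change _ ≤ 2 * x ^ (-2 : ℝ) + K * 2 ^ q * x ^ (-q)
    refine (norm_add_le _ _).trans (add_le_add ?_ ?_)
    · rw [Real.norm_eq_abs, inv_sub_inv hm0.ne' hx0.ne', abs_div, abs_of_nonneg (by linarith),
        abs_of_pos (by positivity), Real.rpow_neg hx0.le, Real.rpow_ofNat, div_le_iff₀ (by positivity)]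
      have : 2 * (x ^ 2)⁻¹ * (m * x) = 2 * (m / x) := by field_simp
      rw [this]
      have h3 : 1 / 2 ≤ (m : ℝ) / x := by rw [le_div_iff₀ hx0]; linarith
      linarith
    · rw [Real.norm_eq_abs]
      refine (h.abs_H_le m hm1).trans ?_
      rw [mul_assoc]
      refine mul_le_mul_of_nonneg_left ?_ h.K_nonneg
      calc (m : ℝ) ^ (-q) ≤ (x / 2) ^ (-q) :=
            Real.rpow_le_rpow_of_nonpos (by positivity) hmx2 (by linarith)
        _ = 2 ^ q * x ^ (-q) := by
            rw [Real.div_rpow hx0.le (by norm_num), Real.rpow_neg (by norm_num : (0 : ℝ) ≤ 2),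
              div_inv_eq_mul, mul_comm]
  refine (h1.union h2).mono_set fun x hx => ?_
  rcases lt_or_ge x 1 with h3 | h3
  · exact Or.inl ⟨hx, h3⟩
  · exact Or.inr h3

theorem tailConstant_eq :
    tailConstant c H = c⁻¹ + ∑' n, H (n + 1) + Real.eulerMascheroniConstant := by
  have hint := h.integrableOn_tailCorrection
  have hii : ∀ x y : ℝ, 0 ≤ x → x ≤ y → IntervalIntegrable (tailCorrection c H) volume x y := by
    intro x y hx hxy
    rw [intervalIntegrable_iff_integrableOn_Ioc_of_le hxy]
    exact hint.mono_set fun t ht => lt_of_le_of_lt hx ht.1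
  have hpart : ∀ N : ℕ, ∫ x in (0 : ℝ)..((N + 1 : ℕ) : ℝ), tailCorrection c H x
      = c⁻¹ + (∑ j ∈ Finset.range N, H (j + 1)) + ((harmonic N : ℝ) - Real.log (N + 1)) := by
    intro N
    induction N with
    | zero => simp [integral_tailCorrection_zero_one]
    | succ N ih =>
      rw [← intervalIntegral.integral_add_adjacent_intervals
        (hii 0 ((N + 1 : ℕ) : ℝ) le_rfl (by positivity))
        (hii ((N + 1 : ℕ) : ℝ) ((N + 1 + 1 : ℕ) : ℝ) (by positivity) (by push_cast; linarith)), ih,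
        integral_tailCorrection_unit, Finset.sum_range_succ, harmonic_succ]
      push_cast
      ring
  have ht1 : Filter.Tendsto (fun N : ℕ => ∫ x in (0 : ℝ)..((N + 1 : ℕ) : ℝ), tailCorrection c H x)
      Filter.atTop (nhds (tailConstant c H)) :=
    intervalIntegral_tendsto_integral_Ioi 0 hint
      ((tendsto_natCast_atTop_atTop (R := ℝ)).comp (Filter.tendsto_add_atTop_nat 1))
  have ht2 : Filter.Tendsto (fun N : ℕ => c⁻¹ + (∑ j ∈ Finset.range N, H (j + 1))
      + ((harmonic N : ℝ) - Real.log (N + 1))) Filter.atTop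
      (nhds (c⁻¹ + ∑' n, H (n + 1) + Real.eulerMascheroniConstant)) :=
    (tendsto_const_nhds.add h.summable_abs_H.of_abs.hasSum.tendsto_sum_nat).add
      Real.tendsto_harmonic_sub_log_add_one
  simp only [hpart] at ht1
  exact tendsto_nhds_unique ht1 ht2

/-- Second order asymptotics of the scalar renewal sequence. -/
theorem exists_abs_scalarRenewal_expansion_le (hne : ∀ z : ℂ, ‖z‖ ≤ 1 → z ≠ 1 →
      ∑' n, z ^ (n + 1) • ((p n : ℝ) : ℂ) ≠ 1) :
    ∃ K₃ : ℝ, ∀ᶠ n : ℕ in Filter.atTop,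
      |c * Real.log n * scalarRenewal p n - 1 + tailConstant c H * (Real.log n)⁻¹|
        ≤ K₃ * Real.log n ^ (-2 : ℤ) := by
  obtain ⟨K₂, hK₂⟩ := h.exists_abs_scalarRenewal_sub_le hne
  have hc := h.c_pos
  rw [h.tailConstant_eq]
  set a : ℝ := c⁻¹ + ∑' n, H (n + 1) with ha
  set d := a + Real.eulerMascheroniConstant with hd
  refine ⟨c * K₂ + 272 + 2 * (1 + d ^ 2 + |d|), ?_⟩
  have hlogt : Filter.Tendsto (fun n : ℕ => Real.log n) Filter.atTop Filter.atTop :=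
    Real.tendsto_log_atTop.comp tendsto_natCast_atTop_atTop
  filter_upwards [hK₂, hlogt.eventually_ge_atTop (max 1 (2 * |d|)), Filter.eventually_ge_atTop 1]
    with n h1 hl hn
  have hn0 : (0 : ℝ) < n := by exact_mod_cast hn
  set l := Real.log n with hldef
  have hl1 : 1 ≤ l := (le_max_left _ _).trans hl
  have hld : 2 * |d| ≤ l := (le_max_right _ _).trans hl
  have hl0 : 0 < l := by linarith
  set S := ∑ k ∈ Finset.range n, ((k : ℝ) + 1)⁻¹ with hS
  have hharm : (harmonic n : ℝ) = S := by
    rw [harmonic, hS]; push_cast; rfl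
  set r := S - l - Real.eulerMascheroniConstant with hr
  have hr0 : 0 ≤ r := by
    have := Real.eulerMascheroniConstant_lt_eulerMascheroniSeq' n
    rw [Real.eulerMascheroniSeq', if_neg (by omega), hharm] at this
    linarith
  have hrl : r * l ≤ 1 := by
    have h2 := Real.eulerMascheroniSeq_lt_eulerMascheroniConstant n
    rw [Real.eulerMascheroniSeq, hharm] at h2
    have h3 : Real.log (n + 1) - l ≤ (n : ℝ)⁻¹ := by
      rw [hldef, ← Real.log_div (by positivity) hn0.ne']
      refine (Real.log_le_sub_one_of_pos (by positivity)).trans (le_of_eq ?_)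
      field_simp
      ring
    have h4 : r ≤ (n : ℝ)⁻¹ := by linarith
    have h5 : l ≤ n := (Real.log_le_self hn0.le)
    calc r * l ≤ (n : ℝ)⁻¹ * n := mul_le_mul h4 h5 hl0.le (by positivity)
      _ = 1 := inv_mul_cancel₀ hn0.ne'
  have hr1 : r ≤ 1 := by nlinarith
  set b := a + S with hb
  have hbd : b = l + d + r := by rw [hb, hd, hr]; ring
  have hbl : l / 2 ≤ b := by
    rw [hbd]
    have := neg_abs_le d
    linarith
  have hb0 : 0 < b := by linarith
  have h2 : |refCoeff a n - b⁻¹| ≤ 34 / b ^ 3 := abs_refCoeff_sub_le a n hb0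
  have h3 : 34 / b ^ 3 ≤ 272 / l ^ 3 := by
    have h4 : (l / 2) ^ 3 ≤ b ^ 3 := pow_le_pow_left₀ (by positivity) hbl 3
    rw [div_le_div_iff₀ (by positivity) (by positivity)]
    nlinarith
  have h4 : |b⁻¹ - l⁻¹ + d / l ^ 2| ≤ 2 * (1 + d ^ 2 + |d|) / l ^ 3 := by
    have e : b⁻¹ - l⁻¹ + d / l ^ 2 = (-(r * l) + d ^ 2 + d * r) / (b * l ^ 2) := by
      have : b * l ^ 2 * (b⁻¹ - l⁻¹ + d / l ^ 2) = -(r * l) + d ^ 2 + d * r := by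
        field_simp
        rw [hbd]
        ring
      rw [eq_div_iff (by positivity), mul_comm]
      exact this
    rw [e, abs_div, abs_of_pos (by positivity : 0 < b * l ^ 2)]
    have hnum : |-(r * l) + d ^ 2 + d * r| ≤ 1 + d ^ 2 + |d| := by
      refine (abs_add_le _ _).trans (add_le_add ((abs_add_le _ _).trans (add_le_add ?_ ?_)) ?_)
      · rw [abs_neg, abs_of_nonneg (by positivity)]
        exact hrl
      · rw [abs_of_nonneg (sq_nonneg d)]
      · rw [abs_mul, abs_of_nonneg hr0]
        exact mul_le_of_le_one_right (abs_nonneg d) hr1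
    calc _ ≤ (1 + d ^ 2 + |d|) / (l / 2 * l ^ 2) := by gcongr
      _ = _ := by field_simp
  have e : c * l * scalarRenewal p n - 1 + d * l⁻¹
      = l * (c * (scalarRenewal p n - c⁻¹ * refCoeff a n) + (refCoeff a n - b⁻¹)
        + (b⁻¹ - l⁻¹ + d / l ^ 2)) := by
    field_simp
    ring
  rw [e, abs_mul, abs_of_pos hl0]
  have h5 : |c * (scalarRenewal p n - c⁻¹ * refCoeff a n) + (refCoeff a n - b⁻¹)
        + (b⁻¹ - l⁻¹ + d / l ^ 2)|
      ≤ c * (K₂ / l ^ 3) + 272 / l ^ 3 + 2 * (1 + d ^ 2 + |d|) / l ^ 3 := by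
    refine (abs_add_le _ _).trans (add_le_add ((abs_add_le _ _).trans (add_le_add ?_ ?_)) h4)
    · rw [abs_mul, abs_of_pos hc]
      exact mul_le_mul_of_nonneg_left h1 hc.le
    · exact h2.trans h3
  refine (mul_le_mul_of_nonneg_left h5 hl0.le).trans (le_of_eq ?_)
  rw [zpow_neg]
  norm_cast
  field_simp

end IsTailExpansion

end TailConstant

section TransferOperator

variable {Y : Type*} [MeasurableSpace Y] {μ : Measure Y}

theorem ae_norm_le_norm_Linf (v : Lp ℂ ∞ μ) : ∀ᵐ y ∂μ, ‖v y‖ ≤ ‖v‖ := by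
  filter_upwards [ae_le_eLpNormEssSup (f := v) (μ := μ)] with y hy
  rw [Lp.norm_def, eLpNorm_exponent_top]
  have h2 := ENNReal.toReal_mono (by
    rw [← eLpNorm_exponent_top]; exact Lp.eLpNorm_ne_top v) hy
  simpa using h2

theorem hasSum_measureReal_eq_succ [IsFiniteMeasure μ] {φ : Y → ℕ} (hφ : Measurable φ) (m : ℕ) :
    HasSum (fun n => if m ≤ n then μ.real {y | φ y = n + 1} else 0) (μ.real {y | m < φ y}) := by
  set s : ℕ → Set Y := fun n => if m ≤ n then {y | φ y = n + 1} else ∅ with hs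
  have hmeas : ∀ n, MeasurableSet (s n) := by
    intro n
    simp only [hs]
    split_ifs
    · exact hφ (measurableSet_singleton (n + 1))
    · exact MeasurableSet.empty
  have hdisj : Pairwise (Function.onFun Disjoint s) := by
    intro i j hij
    rw [Function.onFun, Set.disjoint_left]
    intro y hi hj
    simp only [hs] at hi hj
    split_ifs at hi hj
    · have h1 : φ y = i + 1 := hi
      have h2 : φ y = j + 1 := hj
      omega
    all_goals simp_all
  have hU : ⋃ n, s n = {y | m < φ y} := by
    ext y
    simp only [Set.mem_iUnion, hs, Set.mem_ofPred_eq]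
    constructor
    · rintro ⟨n, hn⟩
      split_ifs at hn with hmn
      · have h1 : φ y = n + 1 := hn
        omega
      · exact hn.elim
    · intro hy
      refine ⟨φ y - 1, ?_⟩
      rw [if_pos (by omega)]
      show φ y = φ y - 1 + 1
      omega
  have h1 := measure_iUnion hdisj hmeas (μ := μ)
  rw [hU] at h1
  have hne : ∑' n, μ (s n) ≠ ∞ := by rw [← h1]; exact measure_ne_top _ _
  have h2 := ENNReal.hasSum_toReal hne
  rw [← ENNReal.tsum_toReal_eq (fun n => measure_ne_top _ _), ← h1] at h2
  refine h2.congr_fun fun n => ?_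
  simp only [hs]
  split_ifs
  · rfl
  · simp

theorem isTailExpansion_measureReal [IsProbabilityMeasure μ] {φ : Y → ℕ} (hφ : Measurable φ)
    (hφ_pos : ∀ y, 1 ≤ φ y) {c q K : ℝ} (hc : 0 < c) (hq : 1 < q) {H : ℕ → ℝ}
    (hH : ∀ n : ℕ, 1 ≤ n → |H n| ≤ K * (n : ℝ) ^ (-q))
    (htail : ∀ n : ℕ, 1 ≤ n → μ.real {y | n < φ y} = c * ((n : ℝ)⁻¹ + H n)) :
    IsTailExpansion (fun n => μ.real {y | φ y = n + 1}) (fun m => μ.real {y | m < φ y}) H c q K where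
  nonneg _ := measureReal_nonneg
  hasSum_tail := hasSum_measureReal_eq_succ hφ
  tail_zero := by
    have : {y | 0 < φ y} = Set.univ := Set.eq_univ_of_forall fun y => hφ_pos y
    rw [this]
    simp
  c_pos := hc
  one_lt_q := hq
  tail_eq := htail
  abs_H_le := hH

variable [IsProbabilityMeasure μ] {B : Type*} [NormedAddCommGroup B] [NormedSpace ℂ B]

/-- The functional `v ↦ ∫_s v dμ` on `B`. -/
def setMean (S : BoundedFunctionSpace μ B) (s : Set Y) : B →L[ℂ] ℂ :=
  LinearMap.mkContinuous
    { toFun := fun v => ∫ y in s, S.incl v y ∂μ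
      map_add' := fun v w => by
        rw [map_add, integral_congr_ae (ae_restrict_of_ae (Lp.coeFn_add _ _))]
        exact integral_add (((Lp.memLp (S.incl v)).integrable le_top).integrableOn)
          (((Lp.memLp (S.incl w)).integrable le_top).integrableOn)
      map_smul' := fun a v => by
        rw [map_smul, integral_congr_ae (ae_restrict_of_ae (Lp.coeFn_smul _ _)), RingHom.id_apply]
        exact integral_const_mul a _ }
    1
    (fun v => by
      change ‖∫ y in s, S.incl v y ∂μ‖ ≤ 1 * ‖v‖
      have h1 := norm_integral_le_of_norm_le_const (ae_restrict_of_ae (s := s)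
        (ae_norm_le_norm_Linf (S.incl v)))
      have h2 : (μ.restrict s).real Set.univ ≤ 1 := by
        rw [measureReal_restrict_apply_univ]
        exact measureReal_le_one
      refine h1.trans ?_
      rw [one_mul]
      exact (mul_le_of_le_one_right (norm_nonneg _) h2).trans (S.norm_incl_le v))

theorem setMean_apply (S : BoundedFunctionSpace μ B) (s : Set Y) (v : B) :
    setMean S s v = ∫ y in s, S.incl v y ∂μ := rfl

theorem meanProjection_eq (S : BoundedFunctionSpace μ B) :
    meanProjection S = (setMean S Set.univ).smulRight S.one := by
  ext v
  rw [ContinuousLinearMap.smulRight_apply, setMean_apply, Measure.restrict_univ]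
  rfl

theorem setMean_one (S : BoundedFunctionSpace μ B) (s : Set Y) :
    setMean S s S.one = ((μ.real s : ℝ) : ℂ) := by
  rw [setMean_apply, S.incl_one, integral_congr_ae (ae_restrict_of_ae (Lp.coeFn_const _ _ _))]
  simp

variable {F : Y → Y} {φ : Y → ℕ} {R : Lp ℂ 1 μ →L[ℂ] Lp ℂ 1 μ} {Rn : ℕ → B →L[ℂ] B}
  {S : BoundedFunctionSpace μ B}

theorem setMean_apply_transfer (hF : MeasurePreserving F μ μ) (hφ : Measurable φ)
    (hR : IsTransferOperator μ F R)
    (hRn : ∀ n : ℕ, 1 ≤ n → ∀ v : B, (S.incl (Rn n v) : Y → ℂ) =ᵐ[μ]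
      (R (indicatorL1 (hφ (measurableSet_singleton n)) (S.incl v)) : Y → ℂ))
    {s : Set Y} (hs : MeasurableSet s) {n : ℕ} (hn : 1 ≤ n) (v : B) :
    setMean S s (Rn n v) = ∫ y in {y | φ y = n} ∩ F ⁻¹' s, S.incl v y ∂μ := by
  have hmem : MemLp (s.indicator fun _ => (1 : ℂ)) ∞ μ := (memLp_const 1).indicator hs
  have h1 := hR (indicatorL1 (hφ (measurableSet_singleton n)) (S.incl v)) _ hmem
  have hmul : ∀ (t : Set Y) (f : Y → ℂ),
      (fun y => f y * t.indicator (fun _ => (1 : ℂ)) y) = t.indicator f := by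
    intro t f
    funext y
    by_cases hy : y ∈ t <;> simp [hy]
  have hl : setMean S s (Rn n v) = ∫ y, R (indicatorL1 (hφ (measurableSet_singleton n))
      (S.incl v)) y * s.indicator (fun _ => (1 : ℂ)) y ∂μ := by
    rw [hmul, integral_indicator hs, setMean_apply]
    exact integral_congr_ae (ae_restrict_of_ae (hRn n hn v))
  have hFs : MeasurableSet (F ⁻¹' s) := hF.measurable hs
  have hφn : MeasurableSet {y | φ y = n} := hφ (measurableSet_singleton n)
  rw [hl, h1, ← integral_indicator (hφn.inter hFs)]
  refine integral_congr_ae ?_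
  have h2 : (indicatorL1 (hφ (measurableSet_singleton n)) (S.incl v) : Y → ℂ) =ᵐ[μ]
      (φ ⁻¹' {n}).indicator (S.incl v) := MemLp.coeFn_toLp _
  filter_upwards [h2] with y hy
  rw [hy]
  by_cases h3 : φ y = n <;> by_cases h4 : F y ∈ s <;> simp [Set.indicator, h3, h4]

variable [CompleteSpace B]

theorem setMean_apply_returnSeries (hF : MeasurePreserving F μ μ) (hφ : Measurable φ)
    (hφ_pos : ∀ y, 1 ≤ φ y) (hR : IsTransferOperator μ F R)
    (hRn : ∀ n : ℕ, 1 ≤ n → ∀ v : B, (S.incl (Rn n v) : Y → ℂ) =ᵐ[μ]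
      (R (indicatorL1 (hφ (measurableSet_singleton n)) (S.incl v)) : Y → ℂ))
    (hsum : Summable fun n => ‖Rn (n + 1)‖) {s : Set Y} (hs : MeasurableSet s) (v : B) :
    setMean S s ((∑' n, (1 : ℂ) ^ (n + 1) • Rn (n + 1)) v) = ∫ y in F ⁻¹' s, S.incl v y ∂μ := by
  have h1 := (summable_pow_succ_smul (b := fun n => Rn (n + 1)) hsum (z := 1) (by simp)).hasSum
  have h2 := ((setMean S s).comp (ContinuousLinearMap.apply ℂ B v)).hasSum h1
  have hFs : MeasurableSet (F ⁻¹' s) := hF.measurable hs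
  have hint : IntegrableOn (S.incl v) (⋃ n : ℕ, {y | φ y = n + 1} ∩ F ⁻¹' s) μ :=
    ((Lp.memLp (S.incl v)).integrable le_top).integrableOn
  have h3 := hasSum_integral_iUnion (μ := μ) (f := S.incl v)
    (s := fun n : ℕ => {y | φ y = n + 1} ∩ F ⁻¹' s)
    (fun n => (hφ (measurableSet_singleton (n + 1))).inter hFs) (by
      intro i j hij
      rw [Function.onFun, Set.disjoint_left]
      rintro y ⟨hi, -⟩ ⟨hj, -⟩
      have h4 : φ y = i + 1 := hi
      have h5 : φ y = j + 1 := hj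
      omega) hint
  have hU : ⋃ n : ℕ, {y | φ y = n + 1} ∩ F ⁻¹' s = F ⁻¹' s := by
    rw [← Set.iUnion_inter]
    refine Set.inter_eq_right.2 fun y _ => Set.mem_iUnion.2 ⟨φ y - 1, ?_⟩
    show φ y = φ y - 1 + 1
    have := hφ_pos y
    omega
  rw [hU] at h3
  refine h2.unique (h3.congr_fun fun n => ?_)
  rw [← setMean_apply_transfer hF hφ hR hRn hs (by omega : 1 ≤ n + 1)]
  simp

theorem isRenewalFamily_of_transfer (hF : MeasurePreserving F μ μ) (hφ : Measurable φ)
    (hφ_pos : ∀ y, 1 ≤ φ y) (hR : IsTransferOperator μ F R)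
    (hRn : ∀ n : ℕ, 1 ≤ n → ∀ v : B, (S.incl (Rn n v) : Y → ℂ) =ᵐ[μ]
      (R (indicatorL1 (hφ (measurableSet_singleton n)) (S.incl v)) : Y → ℂ))
    {C : ℝ} (hC : 0 < C) (hH1 : ∀ n : ℕ, 1 ≤ n → ‖Rn n‖ ≤ C * μ.real {y | φ y = n})
    (hH2i : IsSimpleIsolatedEigenvalue (returnSeries Rn 1) 1)
    (hH2ii : ∀ z : ℂ, ‖z‖ ≤ 1 → z ≠ 1 → (1 : ℂ) ∉ spectrum ℂ (returnSeries Rn z)) :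
    IsRenewalFamily (fun n => μ.real {y | φ y = n + 1}) (fun n => Rn (n + 1)) S.one
      (setMean S Set.univ) C := by
  have hp : Summable fun n => μ.real {y | φ y = n + 1} := by
    simpa using (hasSum_measureReal_eq_succ (μ := μ) hφ 0).summable
  have hle : ∀ n, ‖Rn (n + 1)‖ ≤ C * μ.real {y | φ y = n + 1} := fun n => hH1 (n + 1) (by omega)
  have hsum : Summable fun n => ‖Rn (n + 1)‖ :=
    Summable.of_nonneg_of_le (fun _ => norm_nonneg _) hle (hp.mul_left C)
  have hone : setMean S Set.univ S.one = 1 := by simp [setMean_one]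
  have hfun : ∀ v, setMean S Set.univ ((∑' n, (1 : ℂ) ^ (n + 1) • Rn (n + 1)) v)
      = setMean S Set.univ v := by
    intro v
    rw [setMean_apply_returnSeries hF hφ hφ_pos hR hRn hsum MeasurableSet.univ, Set.preimage_univ]
    rfl
  have hvec : (∑' n, (1 : ℂ) ^ (n + 1) • Rn (n + 1)) S.one = S.one := by
    apply S.incl_injective
    refine Lp.ext (Integrable.ae_eq_of_forall_setIntegral_eq _ _
      ((Lp.memLp _).integrable le_top) ((Lp.memLp _).integrable le_top) fun s hs _ => ?_)
    have h1 := setMean_apply_returnSeries hF hφ hφ_pos hR hRn hsum hs S.one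
    rw [setMean_apply] at h1
    rw [h1, ← setMean_apply, ← setMean_apply, setMean_one, setMean_one,
      hF.measureReal_preimage hs.nullMeasurableSet]
  refine ⟨hC.le, hle, hone, fun n => ?_, hvec, hfun,
    isUnit_one_sub_add_smulRight hone hvec hfun hH2i, fun z hz hz1 => ?_⟩
  · rw [setMean_apply_transfer hF hφ hR hRn MeasurableSet.univ (by omega), Set.preimage_univ,
      Set.inter_univ, ← setMean_apply, setMean_one]
  · have h1 := hH2ii z hz hz1
    rw [spectrum.notMem_iff, map_one] at h1
    exact h1

end TransferOperator

end OperatorRenewal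

end

theorem operator_renewal_second_order_beta_one
    {Y : Type*} [MeasurableSpace Y] (μ : Measure Y) [IsProbabilityMeasure μ]
    (F : Y → Y) (hF : MeasurePreserving F μ μ)
    (φ : Y → ℕ) (hφ : Measurable φ) (hφ_pos : ∀ y, 1 ≤ φ y)
    (R : Lp ℂ 1 μ →L[ℂ] Lp ℂ 1 μ) (hR : OperatorRenewal.IsTransferOperator μ F R)
    {B : Type*} [NormedAddCommGroup B] [NormedSpace ℂ B] [CompleteSpace B]
    (S : OperatorRenewal.BoundedFunctionSpace μ B)
    (c : ℝ) (hc : 0 < c) (q : ℝ) (hq : 1 < q) (H : ℕ → ℝ)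
    (hH : ∃ K : ℝ, ∀ n : ℕ, 1 ≤ n → |H n| ≤ K * (n : ℝ) ^ (-q))
    (htail : ∀ n : ℕ, 1 ≤ n → μ.real {y | n < φ y} = c * ((n : ℝ)⁻¹ + H n))
    (Rn : ℕ → B →L[ℂ] B)
    (hRn : ∀ n : ℕ, 1 ≤ n → ∀ v : B, (S.incl (Rn n v) : Y → ℂ) =ᵐ[μ]
      (R (OperatorRenewal.indicatorL1 (hφ (measurableSet_singleton n)) (S.incl v)) : Y → ℂ))
    (hH1 : ∃ C : ℝ, 0 < C ∧ ∀ n : ℕ, 1 ≤ n → ‖Rn n‖ ≤ C * μ.real {y | φ y = n})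
    (hH2i : OperatorRenewal.IsSimpleIsolatedEigenvalue (OperatorRenewal.returnSeries Rn 1) 1)
    (hH2ii : ∀ z : ℂ, ‖z‖ ≤ 1 → z ≠ 1 →
      (1 : ℂ) ∉ spectrum ℂ (OperatorRenewal.returnSeries Rn z)) :
    IntegrableOn (OperatorRenewal.tailCorrection c H) (Set.Ioi 0) ∧
    ∃ (e : ℕ → ℝ) (K : ℝ), ∀ n : ℕ, 2 ≤ n →
      |e n| ≤ K * (Real.log n) ^ (-2 : ℤ) ∧
      ‖(Real.log n : ℂ) • OperatorRenewal.renewal Rn n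
          - ((c⁻¹ * (1 - OperatorRenewal.tailConstant c H * (Real.log n)⁻¹ + e n) : ℝ) : ℂ)
            • OperatorRenewal.meanProjection S‖
        ≤ K * ((Real.log n) ^ (1 / 2 : ℝ) * (n : ℝ) ^ (-(1 / 2) : ℝ)) := by
  obtain ⟨K, hK⟩ := hH
  obtain ⟨C, hC, hCn⟩ := hH1
  have h := OperatorRenewal.isTailExpansion_measureReal hφ hφ_pos hc hq hK htail
  have hb := OperatorRenewal.isRenewalFamily_of_transfer hF hφ hφ_pos hR hRn hC hCn hH2i hH2ii
  refine ⟨h.integrableOn_tailCorrection, ?_⟩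
  obtain ⟨K₁, hK₁⟩ := hb.exists_norm_renewal_sub_le h
  obtain ⟨K₃, hK₃⟩ := h.exists_abs_scalarRenewal_expansion_le
    fun z hz hz1 => hb.series_ne_one h hz hz1
  rw [← OperatorRenewal.meanProjection_eq] at hK₁
  set u := OperatorRenewal.scalarRenewal fun n => μ.real {y | φ y = n + 1} with hu
  set P := OperatorRenewal.meanProjection S with hP
  set d := OperatorRenewal.tailConstant c H with hd
  set e : ℕ → ℝ := fun n => c * Real.log n * u n - 1 + d * (Real.log n)⁻¹ with he
  have hbig1 : e =O[Filter.atTop] fun n : ℕ => Real.log n ^ (-2 : ℤ) := by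
    refine Asymptotics.IsBigO.of_bound K₃ ?_
    filter_upwards [hK₃] with n hn
    rw [Real.norm_eq_abs, Real.norm_of_nonneg (zpow_nonneg (Real.log_natCast_nonneg n) _)]
    exact hn
  set D : ℕ → B →L[ℂ] B := fun n => (Real.log n : ℂ) • OperatorRenewal.renewal Rn n
    - ((c⁻¹ * (1 - d * (Real.log n)⁻¹ + e n) : ℝ) : ℂ) • P with hD
  have hbig2 : D =O[Filter.atTop]
      fun n : ℕ => Real.log n ^ (1 / 2 : ℝ) * (n : ℝ) ^ (-(1 / 2) : ℝ) := by
    refine Asymptotics.IsBigO.of_bound K₁ ?_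
    filter_upwards [hK₁, Filter.eventually_ge_atTop 2] with n hn hn2
    have hn0 : (0 : ℝ) < n := by positivity
    have hl : 0 < Real.log n := Real.log_pos (by exact_mod_cast hn2)
    have hcoef : c⁻¹ * (1 - d * (Real.log n)⁻¹ + e n) = Real.log n * u n := by
      simp only [he]
      field_simp
      ring
    have hDn : D n = (Real.log n : ℂ) • (OperatorRenewal.renewal Rn n - ((u n : ℝ) : ℂ) • P) := by
      simp only [hD]
      rw [hcoef, smul_sub, smul_smul, ← Complex.ofReal_mul]
    rw [hDn, norm_smul, Complex.norm_real, Real.norm_of_nonneg hl.le,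
      Real.norm_of_nonneg (by positivity)]
    refine (mul_le_mul_of_nonneg_left hn hl.le).trans (le_of_eq ?_)
    rw [Real.mul_rpow hn0.le hl.le]
    have : Real.log n * Real.log n ^ (-(1 / 2) : ℝ) = Real.log n ^ (1 / 2 : ℝ) := by
      nth_rewrite 1 [← Real.rpow_one (Real.log n)]
      rw [← Real.rpow_add hl]
      norm_num
    rw [← this]
    ring
  obtain ⟨C₁, hC₁, hC₁n⟩ := Asymptotics.bound_of_isBigO_nat_atTop hbig1
  obtain ⟨C₂, hC₂, hC₂n⟩ := Asymptotics.bound_of_isBigO_nat_atTop hbig2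
  refine ⟨e, max C₁ C₂, fun n hn2 => ?_⟩
  have hn0 : (0 : ℝ) < n := by positivity
  have hl : 0 < Real.log n := Real.log_pos (by exact_mod_cast hn2)
  have hg1 : 0 < Real.log n ^ (-2 : ℤ) := zpow_pos hl _
  have hg2 : 0 < Real.log n ^ (1 / 2 : ℝ) * (n : ℝ) ^ (-(1 / 2) : ℝ) := by positivity
  constructor
  · have h1 := hC₁n (x := n) hg1.ne'
    rw [Real.norm_eq_abs, Real.norm_of_nonneg hg1.le] at h1
    exact h1.trans (mul_le_mul_of_nonneg_right (le_max_left _ _) hg1.le)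
  · have h1 := hC₂n (x := n) hg2.ne'
    rw [Real.norm_of_nonneg hg2.le] at h1
    exact h1.trans (mul_le_mul_of_nonneg_right (le_max_right _ _) hg2.le)
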